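/- Let (T²,g) be a Riemannian torus. Suppose there exists a primitive translation element τ whose minimal axes do not foliate ℝ², i.e. the union of the images of the minimal axes of τ is not all of ℝ². Then there exist an integer k ≥ 2 and a non-primitive axis of τ^k, i.e. an axis α of τ^k with α(ℝ) ≠ τ α(ℝ). -/

import Mathlib

open Filter Topology Set
open scoped ENNReal

noncomputable section

/-- The Euclidean norm of a point of `ℝ × ℝ` (the universal covering of `T²`). -/
def norm2 (p : ℝ × ℝ) : ℝ := Real.sqrt (p.1 ^ 2 + p.2 ^ 2)

/-- The translation vector of the covering transformation `τ_{(m,n)}` of `T² = ℝ²/ℤ²`. -/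
def lat (k : ℤ × ℤ) : ℝ × ℝ := ((k.1 : ℝ), (k.2 : ℝ))

/-- The transl of a curve in `ℝ²` by the covering transformation `τ_k`. -/
def transl (k : ℤ × ℤ) (c : ℝ → ℝ × ℝ) : ℝ → ℝ × ℝ := fun t => c t + lat k

/-- The asymptotic direction `δ(τ_k)` of the axes of the translation element `τ_k`. -/
def latDir (k : ℤ × ℤ) : ℝ × ℝ := (norm2 (lat k))⁻¹ • lat k

/-- A smooth Riemannian metric on the torus `T² = ℝ²/ℤ²`, described through its lift to the
universal covering `ℝ²`: a smooth family of positive definite symmetric bilinear forms on the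
tangent spaces of `ℝ²`, invariant under the deck transformation group `ℤ²`. -/
structure TorusMetric where
  g : (ℝ × ℝ) → (ℝ × ℝ) → (ℝ × ℝ) → ℝ
  smooth : ContDiff ℝ (⊤ : ℕ∞) fun p : (ℝ × ℝ) × (ℝ × ℝ) × (ℝ × ℝ) => g p.1 p.2.1 p.2.2
  symm : ∀ x v w, g x v w = g x w v
  linear : ∀ x w, IsLinearMap ℝ fun v => g x v w
  posdef : ∀ x v, v ≠ 0 → 0 < g x v v
  periodic : ∀ (k : ℤ × ℤ) (x v w : ℝ × ℝ), g (x + lat k) v w = g x v w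

namespace TorusMetric

/-- The Riemannian length of the curve `c` between the parameters `a` and `b`. -/
def length (M : TorusMetric) (c : ℝ → ℝ × ℝ) (a b : ℝ) : ℝ :=
  ∫ t in a..b, Real.sqrt (M.g (c t) (deriv c t) (deriv c t))

/-- The Riemannian distance on the universal covering `ℝ²` (hence also on `T²`). -/
def dist (M : TorusMetric) (x y : ℝ × ℝ) : ℝ :=
  sInf {L | ∃ c : ℝ → ℝ × ℝ, ContDiff ℝ 1 c ∧ c 0 = x ∧ c 1 = y ∧ L = M.length c 0 1}

/-- A (complete, unit speed) geodesic of the lifted metric on the universal covering `ℝ²`: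
a smooth curve with constant unit speed which is locally length minimizing. -/
def IsGeodesic (M : TorusMetric) (c : ℝ → ℝ × ℝ) : Prop :=
  ContDiff ℝ (⊤ : ℕ∞) c ∧ (∀ t, M.g (c t) (deriv c t) (deriv c t) = 1) ∧
    ∀ t : ℝ, ∃ ε > 0, ∀ s₁ s₂, t - ε ≤ s₁ → s₁ ≤ s₂ → s₂ ≤ t + ε →
      M.dist (c s₁) (c s₂) = M.length c s₁ s₂

end TorusMetric

/-- The distance between two points of the unit tangent bundle `ST²` of the torus; points of
`ST²` are represented by points of the tangent bundle `ℝ² × ℝ²` of the universal covering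
(the deck transformations act trivially on the vector component). -/
def phaseDist (p q : (ℝ × ℝ) × (ℝ × ℝ)) : ℝ :=
  sInf {r : ℝ | ∃ k : ℤ × ℤ, r = norm2 (p.1 - (q.1 + lat k)) + norm2 (p.2 - q.2)}

/-- A `(φ,ε)`-separated set with respect to time `T` for the geodesic flow `φ` of `M` on
`ST²`: a finite family of geodesics (each geodesic `c` representing the phase point
`(c 0, ċ 0) ∈ ST²`, of which `t ↦ (c t, ċ t)` is the flow orbit) such that any two distinct
members satisfy `max_{0 ≤ t ≤ T} d(φᵗ v, φᵗ w) > ε`. -/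
def IsSeparated (M : TorusMetric) (ε T : ℝ) (F : Finset (ℝ → ℝ × ℝ)) : Prop :=
  (∀ c ∈ F, M.IsGeodesic c) ∧
    ∀ c₁ ∈ F, ∀ c₂ ∈ F, c₁ ≠ c₂ →
      ∃ t ∈ Set.Icc (0 : ℝ) T, ε < phaseDist (c₁ t, deriv c₁ t) (c₂ t, deriv c₂ t)

/-- `r_T(φ, ε)`: the maximal cardinality of `(φ,ε)`-separated sets with respect to `T`. -/
def sepCount (M : TorusMetric) (ε T : ℝ) : ℝ≥0∞ :=
  ⨆ (F : Finset (ℝ → ℝ × ℝ)) (_ : IsSeparated M ε T F), (F.card : ℝ≥0∞)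

/-- Extended real logarithm of an extended nonnegative real. -/
def elog (x : ℝ≥0∞) : EReal :=
  if x = 0 then ⊥ else if x = ⊤ then ⊤ else ((Real.log x.toReal : ℝ) : EReal)

/-- Bowen's topological entropy `h_top(g)` of the geodesic flow of `g` on `ST²`:
`lim_{ε → 0} limsup_{T → ∞} (1/T) log r_T(φ,ε)`; since `r_T(φ,ε)` is monotone in `ε`,
the limit `ε → 0` is realized as the supremum over `ε > 0`. -/
def topEnt (M : TorusMetric) : EReal :=
  ⨆ (ε : ℝ) (_ : 0 < ε),
    Filter.limsup (fun T : ℝ => ((T⁻¹ : ℝ) : EReal) * elog (sepCount M ε T)) Filter.atTop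

/-- The forward ray `c⁺` of `c` is escaping: `‖c(t)‖ → ∞` as `t → ∞`. -/
def EscapesForward (c : ℝ → ℝ × ℝ) : Prop :=
  Filter.Tendsto (fun t => norm2 (c t)) Filter.atTop Filter.atTop

/-- The backward ray `c⁻` of `c` is escaping: `‖c(-t)‖ → ∞` as `t → ∞`. -/
def EscapesBackward (c : ℝ → ℝ × ℝ) : Prop :=
  Filter.Tendsto (fun t => norm2 (c (-t))) Filter.atTop Filter.atTop

/-- `z ∈ S¹` is the asymptotic direction `δ(c⁺) = lim_{t → ∞} c(t)/‖c(t)‖` of the forward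
ray of `c`. -/
def HasDirection (c : ℝ → ℝ × ℝ) (z : ℝ × ℝ) : Prop :=
  norm2 z = 1 ∧ Filter.Tendsto (fun t => (norm2 (c t))⁻¹ • c t) Filter.atTop (nhds z)

/-- The canonical projection `π : S¹ → P¹(ℝ) ≅ ℝ ∪ {∞}`, sending `(x, y)` to `y/x` if
`x ≠ 0` and to `∞` otherwise; `ℝ ∪ {∞}` is the one-point compactification of `ℝ`. -/
def projPt (z : ℝ × ℝ) : OnePoint ℝ :=
  if z.1 = 0 then OnePoint.infty else ((z.2 / z.1 : ℝ) : OnePoint ℝ)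

/-- `crossDet v w ≠ 0` expresses transversality of two directions in `ℝ²`. -/
def crossDet (v w : ℝ × ℝ) : ℝ := v.1 * w.2 - v.2 * w.1

/-- The set of points at which the curve `c₁` (restricted to parameters in `D₁`) and the
curve `c₂` (restricted to parameters in `D₂`) intersect transversally. -/
def transInter (c₁ c₂ : ℝ → ℝ × ℝ) (D₁ D₂ : Set ℝ) : Set (ℝ × ℝ) :=
  {x | ∃ s ∈ D₁, ∃ t ∈ D₂, c₁ s = x ∧ c₂ t = x ∧ crossDet (deriv c₁ s) (deriv c₂ t) ≠ 0}

/-- The geodesic `c` is an axis of the (nontrivial) translation element `τ_k`: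
`τ_k c(t) = c(t + ℓ)` for some `ℓ` and all `t`. -/
def IsAxisOf (M : TorusMetric) (c : ℝ → ℝ × ℝ) (k : ℤ × ℤ) : Prop :=
  M.IsGeodesic c ∧ k ≠ 0 ∧ ∃ ℓ : ℝ, ∀ t, c (t + ℓ) = c t + lat k

/-- The geodesic `c` is an axis of some nontrivial translation element. -/
def IsAxis (M : TorusMetric) (c : ℝ → ℝ × ℝ) : Prop := ∃ k : ℤ × ℤ, IsAxisOf M c k

/-- The curve `c` is minimal: each of its segments minimizes the Riemannian length between
its endpoints. -/
def IsMinimal (M : TorusMetric) (c : ℝ → ℝ × ℝ) : Prop :=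
  ∀ s t : ℝ, s ≤ t → M.dist (c s) (c t) = M.length c s t

/-- Equivalence of translation elements: `τ₁^a = τ₂^b` for some nonzero integers `a, b`. -/
def TransEquiv (k₁ k₂ : ℤ × ℤ) : Prop := ∃ a b : ℤ, a ≠ 0 ∧ b ≠ 0 ∧ a • k₁ = b • k₂

/-- A translation element is primitive if it is not a nontrivial power of another
translation element. -/
def IsPrimitive (k : ℤ × ℤ) : Prop := k ≠ 0 ∧ ∀ (j : ℤ × ℤ) (n : ℤ), k = n • j → IsUnit n

/-- The metric `g` on `T²` is flat, i.e. its Gaussian curvature vanishes identically;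
equivalently (by the theorems of Myers–Steenrod and Cartan–Hadamard), the universal covering
`ℝ²` with the induced Riemannian distance is isometric to the Euclidean plane. -/
def IsFlat (M : TorusMetric) : Prop :=
  ∃ F : (ℝ × ℝ) ≃ (ℝ × ℝ), ∀ x y, M.dist x y = norm2 (F x - F y)

/-! ### Periodic functions -/

theorem lat_add (j k : ℤ × ℤ) : lat (j + k) = lat j + lat k := by
  simp [lat]

theorem lat_neg (k : ℤ × ℤ) : lat (-k) = -lat k := by
  simp [lat]

theorem lat_zero : lat 0 = 0 := by
  simp [lat]

theorem lat_zsmul (n : ℤ) (k : ℤ × ℤ) : lat (n • k) = (n : ℝ) • lat k := by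
  simp [lat]

theorem exists_lat_sub_mem (x : ℝ × ℝ) : ∃ k : ℤ × ℤ, x + lat k ∈ Icc (0 : ℝ × ℝ) 1 := by
  refine ⟨(-⌊x.1⌋, -⌊x.2⌋), ?_⟩
  simp only [lat, mem_Icc, Prod.le_def, Prod.fst_add, Prod.snd_add, Prod.fst_zero, Prod.snd_zero,
    Prod.fst_one, Prod.snd_one]
  push_cast
  refine ⟨⟨?_, ?_⟩, ?_, ?_⟩
  · linarith [Int.floor_le x.1]
  · linarith [Int.floor_le x.2]
  · linarith [Int.lt_floor_add_one x.1]
  · linarith [Int.lt_floor_add_one x.2]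

theorem periodic_bdd {X F : Type*} [TopologicalSpace X] [NormedAddCommGroup F]
    (φ : (ℝ × ℝ) × X → F) {S : Set X} (hS : IsCompact S) (hφ : Continuous φ)
    (hp : ∀ (k : ℤ × ℤ) x v, φ (x + lat k, v) = φ (x, v)) :
    ∃ C > 0, ∀ x, ∀ v ∈ S, ‖φ (x, v)‖ ≤ C := by
  have hc : IsCompact (Icc (0 : ℝ × ℝ) 1 ×ˢ S) := isCompact_Icc.prod hS
  obtain ⟨C, hC⟩ := hc.exists_bound_of_continuousOn hφ.continuousOn
  refine ⟨max C 1, by positivity, fun x v hv => ?_⟩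
  obtain ⟨k, hk⟩ := exists_lat_sub_mem x
  rw [← hp k]
  exact (hC _ ⟨hk, hv⟩).trans (le_max_left _ _)

/-- A smooth function on `ℝ² × ℝ²`, periodic in the first variable, is Lipschitz
on `ℝ² × B` for every ball `B`. -/
theorem periodic_lip {F : Type*} [NormedAddCommGroup F] [NormedSpace ℝ F]
    (φ : (ℝ × ℝ) × (ℝ × ℝ) → F) (hφ : ContDiff ℝ 1 φ)
    (hp : ∀ (k : ℤ × ℤ) x v, φ (x + lat k, v) = φ (x, v)) (R : ℝ) :
    ∃ C : NNReal, LipschitzOnWith C φ (univ ×ˢ Metric.closedBall (0 : ℝ × ℝ) R) := by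
  have hp' : ∀ (k : ℤ × ℤ) x v, fderiv ℝ φ (x + lat k, v) = fderiv ℝ φ (x, v) := by
    intro k x v
    have h : φ = fun z => φ (z + (lat k, 0)) := by
      funext z
      obtain ⟨y, w⟩ := z
      simp [hp]
    conv_rhs => rw [h]
    rw [fderiv_comp_add_right]
    simp
  obtain ⟨C, hC0, hC⟩ := periodic_bdd (fderiv ℝ φ) (isCompact_closedBall (0 : ℝ × ℝ) R)
    (hφ.continuous_fderiv one_ne_zero) hp'
  refine ⟨⟨C, hC0.le⟩, ?_⟩
  refine Convex.lipschitzOnWith_of_nnnorm_fderiv_le (𝕜 := ℝ)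
    (fun x _ => (hφ.differentiable one_ne_zero).differentiableAt) ?_
    (convex_univ.prod (convex_closedBall _ _))
  rintro ⟨x, v⟩ ⟨-, hv⟩
  exact hC x v hv

namespace TorusMetric

variable (M : TorusMetric)

/-- The quadratic form of the metric. -/
def quad (z : (ℝ × ℝ) × (ℝ × ℝ)) : ℝ := M.g z.1 z.2 z.2

/-- The norm of tangent vectors. -/
def nrm (x v : ℝ × ℝ) : ℝ := Real.sqrt (M.g x v v)

theorem g_add_left (x u v w : ℝ × ℝ) : M.g x (u + v) w = M.g x u w + M.g x v w :=
  (M.linear x w).map_add u v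

theorem g_smul_left (x v w : ℝ × ℝ) (a : ℝ) : M.g x (a • v) w = a * M.g x v w :=
  (M.linear x w).map_smul a v

theorem g_add_right (x u v w : ℝ × ℝ) : M.g x w (u + v) = M.g x w u + M.g x w v := by
  rw [M.symm, g_add_left, M.symm, M.symm x v]

theorem g_smul_right (x v w : ℝ × ℝ) (a : ℝ) : M.g x v (a • w) = a * M.g x v w := by
  rw [M.symm, g_smul_left, M.symm]

theorem g_self_nonneg (x v : ℝ × ℝ) : 0 ≤ M.g x v v := by
  by_cases h : v = 0
  · rw [h, show (0 : ℝ × ℝ) = (0 : ℝ) • 0 by simp, g_smul_left]; simp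
  · exact (M.posdef x v h).le

theorem nrm_nonneg (x v : ℝ × ℝ) : 0 ≤ M.nrm x v := Real.sqrt_nonneg _

theorem nrm_sq (x v : ℝ × ℝ) : M.nrm x v ^ 2 = M.g x v v := Real.sq_sqrt (M.g_self_nonneg x v)

theorem nrm_smul (x v : ℝ × ℝ) (a : ℝ) : M.nrm x (a • v) = |a| * M.nrm x v := by
  rw [nrm, g_smul_left, g_smul_right, ← mul_assoc, Real.sqrt_mul (mul_self_nonneg a),
    Real.sqrt_mul_self_eq_abs, nrm]

theorem nrm_neg (x v : ℝ × ℝ) : M.nrm x (-v) = M.nrm x v := by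
  have := M.nrm_smul x v (-1)
  simpa using this

theorem cauchy_schwarz (x v w : ℝ × ℝ) : M.g x v w ≤ M.nrm x v * M.nrm x w := by
  have h : ∀ t : ℝ, 0 ≤ M.g x w w * (t * t) + (2 * M.g x v w) * t + M.g x v v := by
    intro t
    have := M.g_self_nonneg x (v + t • w)
    rw [g_add_left, g_add_right, g_add_right, g_smul_left, g_smul_left, g_smul_right, g_smul_right,
      M.symm x w v] at this
    linarith
  have hd := discrim_le_zero h
  rw [discrim] at hd
  rw [← M.nrm_sq x v, ← M.nrm_sq x w] at hd
  refine le_of_abs_le (abs_le_of_sq_le_sq ?_ (mul_nonneg (M.nrm_nonneg _ _) (M.nrm_nonneg _ _)))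
  nlinarith

theorem nrm_add_le (x v w : ℝ × ℝ) : M.nrm x (v + w) ≤ M.nrm x v + M.nrm x w := by
  refine le_of_sq_le_sq ?_ (add_nonneg (M.nrm_nonneg _ _) (M.nrm_nonneg _ _))
  rw [nrm_sq, g_add_left, g_add_right, g_add_right, M.symm x w v]
  have := M.cauchy_schwarz x v w
  nlinarith [M.nrm_sq x v, M.nrm_sq x w]

theorem contDiff_quad : ContDiff ℝ (⊤ : ℕ∞) M.quad :=
  M.smooth.comp (contDiff_fst.prodMk (contDiff_snd.prodMk contDiff_snd))

theorem continuous_nrm : Continuous fun z : (ℝ × ℝ) × (ℝ × ℝ) => M.nrm z.1 z.2 :=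
  Real.continuous_sqrt.comp M.contDiff_quad.continuous

theorem nrm_periodic (k : ℤ × ℤ) (x v : ℝ × ℝ) : M.nrm (x + lat k) v = M.nrm x v := by
  rw [nrm, M.periodic, nrm]

theorem exists_nrm_bounds : ∃ lo hi : ℝ, 0 < lo ∧ 0 < hi ∧
    ∀ x v, lo * ‖v‖ ≤ M.nrm x v ∧ M.nrm x v ≤ hi * ‖v‖ := by
  have hS : IsCompact (Metric.sphere (0 : ℝ × ℝ) 1) := isCompact_sphere _ _
  have hne : (Icc (0 : ℝ × ℝ) 1 ×ˢ Metric.sphere (0 : ℝ × ℝ) 1).Nonempty :=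
    ⟨(0, (1, 0)), by simp, by simp [Prod.norm_def]⟩
  obtain ⟨z, hz, hmin⟩ := (isCompact_Icc.prod hS).exists_isMinOn hne M.continuous_nrm.continuousOn
  obtain ⟨z', hz', hmax⟩ := (isCompact_Icc.prod hS).exists_isMaxOn hne
    M.continuous_nrm.continuousOn
  have hpos : ∀ z ∈ (Icc (0 : ℝ × ℝ) 1 ×ˢ Metric.sphere (0 : ℝ × ℝ) 1), 0 < M.nrm z.1 z.2 := by
    intro z hz
    refine Real.sqrt_pos.2 (M.posdef _ _ ?_)
    have := hz.2
    rintro h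
    simp [h] at this
  refine ⟨M.nrm z.1 z.2, M.nrm z'.1 z'.2, hpos z hz, hpos z' hz', fun x v => ?_⟩
  obtain ⟨k, hk⟩ := exists_lat_sub_mem x
  rw [← M.nrm_periodic k x]
  by_cases hv : v = 0
  · subst hv
    have : M.nrm (x + lat k) 0 = 0 := by
      have := M.nrm_smul (x + lat k) 0 0
      simpa using this
    simp [this]
  · have hn : 0 < ‖v‖ := norm_pos_iff.2 hv
    have hmem : (x + lat k, ‖v‖⁻¹ • v) ∈ (Icc (0 : ℝ × ℝ) 1 ×ˢ Metric.sphere (0 : ℝ × ℝ) 1) := by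
      refine ⟨hk, ?_⟩
      simp [norm_smul, hn.ne']
    have h1 := hmin hmem
    have h2 := hmax hmem
    simp only [mem_ofPred_eq, nrm_smul, abs_inv, abs_norm] at h1 h2
    constructor
    · calc _ ≤ (‖v‖⁻¹ * M.nrm (x + lat k) v) * ‖v‖ := by gcongr
        _ = _ := by field_simp
    · calc _ = (‖v‖⁻¹ * M.nrm (x + lat k) v) * ‖v‖ := by field_simp
        _ ≤ _ := by gcongr

/-- A uniform lower bound of the metric against the sup norm. -/
def lo : ℝ := M.exists_nrm_bounds.choose

/-- A uniform upper bound of the metric against the sup norm. -/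
def hi : ℝ := M.exists_nrm_bounds.choose_spec.choose

theorem lo_pos : 0 < M.lo := M.exists_nrm_bounds.choose_spec.choose_spec.1

theorem hi_pos : 0 < M.hi := M.exists_nrm_bounds.choose_spec.choose_spec.2.1

theorem lo_le_nrm (x v : ℝ × ℝ) : M.lo * ‖v‖ ≤ M.nrm x v :=
  (M.exists_nrm_bounds.choose_spec.choose_spec.2.2 x v).1

theorem nrm_le_hi (x v : ℝ × ℝ) : M.nrm x v ≤ M.hi * ‖v‖ :=
  (M.exists_nrm_bounds.choose_spec.choose_spec.2.2 x v).2

theorem exists_nrm_lip : ∃ K : ℝ, 0 < K ∧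
    ∀ x y v, |M.nrm x v - M.nrm y v| ≤ K * ‖x - y‖ * ‖v‖ := by
  obtain ⟨C, hC⟩ := periodic_lip M.quad (M.contDiff_quad.of_le (by exact_mod_cast le_top))
    (fun k x v => M.periodic k x v v) 1
  refine ⟨C / (2 * M.lo) + 1, by have := M.lo_pos; positivity, fun x y v => ?_⟩
  have key : ∀ v : ℝ × ℝ, ‖v‖ = 1 →
      |M.nrm x v - M.nrm y v| ≤ (C / (2 * M.lo) + 1) * ‖x - y‖ := by
    intro v hv
    have h1 := hC.dist_le_mul (x, v) ⟨mem_univ _, by simp [hv]⟩ (y, v) ⟨mem_univ _, by simp [hv]⟩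
    have h2 : Dist.dist (x, v) (y, v) = ‖x - y‖ := by simp [dist_eq_norm]
    rw [h2, Real.dist_eq] at h1
    have h3 : M.quad (x, v) - M.quad (y, v)
        = (M.nrm x v - M.nrm y v) * (M.nrm x v + M.nrm y v) := by
      rw [quad, quad, ← nrm_sq, ← nrm_sq]; ring
    have h4 : 2 * M.lo ≤ M.nrm x v + M.nrm y v := by
      have := M.lo_le_nrm x v
      have := M.lo_le_nrm y v
      rw [hv] at *
      linarith
    have hlo := M.lo_pos
    rw [h3, abs_mul, abs_of_pos (by linarith : 0 < M.nrm x v + M.nrm y v)] at h1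
    have h5 : |M.nrm x v - M.nrm y v| * (2 * M.lo) ≤ C * ‖x - y‖ :=
      (mul_le_mul_of_nonneg_left h4 (abs_nonneg _)).trans h1
    have h6 : |M.nrm x v - M.nrm y v| ≤ C / (2 * M.lo) * ‖x - y‖ := by
      rw [div_mul_eq_mul_div, le_div_iff₀ (by linarith)]
      exact h5
    have := norm_nonneg (x - y)
    nlinarith
  by_cases hv : v = 0
  · have : ∀ x, M.nrm x 0 = 0 := fun x => by simpa using M.nrm_smul x 0 0
    simp [hv, this]
  · have hn : 0 < ‖v‖ := norm_pos_iff.2 hv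
    have := key (‖v‖⁻¹ • v) (by simp [norm_smul, hn.ne'])
    rw [nrm_smul, nrm_smul, ← mul_sub, abs_mul, abs_abs, abs_inv, abs_norm,
      inv_mul_le_iff₀ hn] at this
    linarith

/-- A uniform Lipschitz constant of the metric. -/
def lipK : ℝ := M.exists_nrm_lip.choose

theorem lipK_pos : 0 < M.lipK := M.exists_nrm_lip.choose_spec.1

theorem nrm_lip (x y v : ℝ × ℝ) : |M.nrm x v - M.nrm y v| ≤ M.lipK * ‖x - y‖ * ‖v‖ :=
  M.exists_nrm_lip.choose_spec.2 x y v

end TorusMetric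

namespace TorusMetric

variable (M : TorusMetric)

theorem continuous_nrm_comp {X : Type*} [TopologicalSpace X] {f h : X → ℝ × ℝ}
    (hf : Continuous f) (hh : Continuous h) : Continuous fun t => M.nrm (f t) (h t) :=
  M.continuous_nrm.comp (hf.prodMk hh)

theorem continuousOn_nrm_comp {X : Type*} [TopologicalSpace X] {f h : X → ℝ × ℝ} {s : Set X}
    (hf : ContinuousOn f s) (hh : ContinuousOn h s) : ContinuousOn (fun t => M.nrm (f t) (h t)) s :=
  M.continuous_nrm.comp_continuousOn (hf.prodMk hh)

theorem length_nonneg {c : ℝ → ℝ × ℝ} {a b : ℝ} (hab : a ≤ b) : 0 ≤ M.length c a b :=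
  intervalIntegral.integral_nonneg hab fun _ _ => Real.sqrt_nonneg _

theorem bddBelow_lengths (x y : ℝ × ℝ) : BddBelow {L | ∃ c : ℝ → ℝ × ℝ,
    ContDiff ℝ 1 c ∧ c 0 = x ∧ c 1 = y ∧ L = M.length c 0 1} := by
  refine ⟨0, ?_⟩
  rintro L ⟨c, -, -, -, rfl⟩
  exact M.length_nonneg zero_le_one

theorem hasDerivAt_line (x y : ℝ × ℝ) (t : ℝ) :
    HasDerivAt (fun t : ℝ => x + t • (y - x)) (y - x) t := by
  simpa using ((hasDerivAt_id t).smul_const (y - x)).const_add x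

theorem contDiff_line (x y : ℝ × ℝ) : ContDiff ℝ 1 fun t : ℝ => x + t • (y - x) := by
  fun_prop

theorem nonempty_lengths (x y : ℝ × ℝ) : {L | ∃ c : ℝ → ℝ × ℝ,
    ContDiff ℝ 1 c ∧ c 0 = x ∧ c 1 = y ∧ L = M.length c 0 1}.Nonempty :=
  ⟨_, _, contDiff_line x y, by simp, by simp, rfl⟩

theorem dist_le_length {c : ℝ → ℝ × ℝ} (hc : ContDiff ℝ 1 c) :
    M.dist (c 0) (c 1) ≤ M.length c 0 1 :=
  csInf_le (M.bddBelow_lengths _ _) ⟨c, hc, rfl, rfl, rfl⟩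

theorem dist_nonneg (x y : ℝ × ℝ) : 0 ≤ M.dist x y := by
  refine le_csInf (M.nonempty_lengths x y) ?_
  rintro L ⟨c, -, -, -, rfl⟩
  exact M.length_nonneg zero_le_one

theorem exists_length_lt {x y : ℝ × ℝ} {r : ℝ} (h : M.dist x y < r) : ∃ c : ℝ → ℝ × ℝ,
    ContDiff ℝ 1 c ∧ c 0 = x ∧ c 1 = y ∧ M.length c 0 1 < r := by
  obtain ⟨L, ⟨c, h1, h2, h3, rfl⟩, h4⟩ := exists_lt_of_csInf_lt (M.nonempty_lengths x y) h
  exact ⟨c, h1, h2, h3, h4⟩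

theorem dist_self (x : ℝ × ℝ) : M.dist x x = 0 := by
  refine le_antisymm ?_ (M.dist_nonneg x x)
  have h := M.dist_le_length (c := fun _ => x) contDiff_const
  have h0 : M.g x 0 0 = 0 := (M.linear x 0).map_zero
  simpa [length, h0] using h

/-- The distance is bounded by the length of arcs which are `C¹` on a compact interval. -/
theorem dist_le_integral {γ v : ℝ → ℝ × ℝ} {a b : ℝ} (hab : a ≤ b)
    (hv : ContinuousOn v (Icc a b)) (hγ : ContinuousOn γ (Icc a b))
    (hd : ∀ t ∈ Ioo a b, HasDerivAt γ (v t) t) :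
    M.dist (γ a) (γ b) ≤ ∫ t in a..b, M.nrm (γ t) (v t) := by
  set w : ℝ → ℝ × ℝ := fun t => v (projIcc a b hab t) with hw
  have hwc : Continuous w := by
    have := continuousOn_iff_continuous_domRestrict.1 hv
    exact this.comp continuous_projIcc
  have hwv : ∀ t ∈ Icc a b, w t = v t := fun t ht => by
    simp only [hw]; rw [projIcc_of_mem hab ht]
  set Γ : ℝ → ℝ × ℝ := fun t => γ a + ∫ s in a..t, w s with hΓ
  have hΓd : ∀ t, HasDerivAt Γ (w t) t := fun t => by
    refine HasDerivAt.const_add _ ?_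
    exact intervalIntegral.integral_hasDerivAt_right (hwc.intervalIntegrable _ _)
      (hwc.stronglyMeasurableAtFilter _ _) hwc.continuousAt
  have hΓe : ∀ t ∈ Icc a b, Γ t = γ t := by
    intro t ht
    have h1 : ∫ s in a..t, w s = γ t - γ a := by
      refine intervalIntegral.integral_eq_sub_of_hasDerivAt_of_le ht.1
        (hγ.mono (Icc_subset_Icc_right ht.2)) (fun s hs => ?_) (hwc.intervalIntegrable _ _)
      rw [hwv s ⟨hs.1.le, hs.2.le.trans ht.2⟩]
      exact hd s ⟨hs.1, hs.2.trans_le ht.2⟩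
    simp [hΓ, h1]
  set c : ℝ → ℝ × ℝ := fun s => Γ ((b - a) * s + a) with hc
  have hcd : ∀ s, HasDerivAt c ((b - a) • w ((b - a) * s + a)) s := by
    intro s
    have h1 : HasDerivAt (fun s : ℝ => (b - a) * s + a) (b - a) s := by
      simpa using ((hasDerivAt_id s).const_mul (b - a)).add_const a
    exact (hΓd _).scomp s h1
  have hcc : ContDiff ℝ 1 c := by
    rw [contDiff_one_iff_deriv]
    refine ⟨fun s => (hcd s).differentiableAt, ?_⟩
    have : deriv c = fun s => (b - a) • w ((b - a) * s + a) := funext fun s => (hcd s).deriv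
    rw [this]
    fun_prop
  have h := M.dist_le_length hcc
  have hb : 0 ≤ b - a := sub_nonneg.2 hab
  have e0 : c 0 = γ a := by simp [hc, hΓ]
  have e1 : c 1 = γ b := by
    simp only [hc, mul_one, sub_add_cancel]
    exact hΓe b ⟨hab, le_rfl⟩
  rw [e0, e1] at h
  refine h.trans (le_of_eq ?_)
  have e2 : ∫ t in a..b, M.nrm (γ t) (v t) = ∫ t in a..b, M.nrm (Γ t) (w t) := by
    refine intervalIntegral.integral_congr fun t ht => ?_
    rw [uIcc_of_le hab] at ht
    simp only [hΓe t ht, hwv t ht]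
  rw [e2, length]
  have e3 := intervalIntegral.smul_integral_comp_mul_add (a := 0) (b := 1)
    (fun t => M.nrm (Γ t) (w t)) (b - a) a
  simp only [mul_zero, zero_add, mul_one, sub_add_cancel] at e3
  rw [← e3, smul_eq_mul, ← intervalIntegral.integral_const_mul]
  refine intervalIntegral.integral_congr fun s _ => ?_
  simp only [(hcd s).deriv]
  rw [← nrm, nrm_smul, abs_of_nonneg hb]

theorem length_eq_integral {c : ℝ → ℝ × ℝ} {a b : ℝ} :
    M.length c a b = ∫ t in a..b, M.nrm (c t) (deriv c t) := rfl

theorem dist_le_length_of_contDiff {c : ℝ → ℝ × ℝ} (hc : ContDiff ℝ 1 c) {a b : ℝ}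
    (hab : a ≤ b) : M.dist (c a) (c b) ≤ M.length c a b :=
  M.dist_le_integral hab (hc.continuous_deriv le_rfl).continuousOn hc.continuous.continuousOn
    fun t _ => (hc.differentiable one_ne_zero t).hasDerivAt

theorem dist_comm (x y : ℝ × ℝ) : M.dist x y = M.dist y x := by
  have key : ∀ x y, M.dist x y ≤ M.dist y x := by
    intro x y
    refine le_csInf (M.nonempty_lengths y x) ?_
    rintro L ⟨c, hc, rfl, rfl, rfl⟩
    have h := M.dist_le_integral (γ := fun t => c (1 - t)) (v := fun t => -deriv c (1 - t))
      zero_le_one ((hc.continuous_deriv le_rfl).comp (continuous_const.sub continuous_id)).neg.continuousOn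
      (hc.continuous.comp (continuous_const.sub continuous_id)).continuousOn
      fun t _ => by
        have h1 : HasDerivAt (fun t : ℝ => 1 - t) (-1) t := by
          simpa using (hasDerivAt_id t).const_sub 1
        simpa [Function.comp_def] using
          ((hc.differentiable one_ne_zero (1 - t)).hasDerivAt).scomp t h1
    simp only [sub_zero, sub_self, nrm_neg] at h
    rw [intervalIntegral.integral_comp_sub_left (fun t => M.nrm (c t) (deriv c t)) 1] at h
    rw [length_eq_integral]
    simpa using h
  exact le_antisymm (key x y) (key y x)

theorem dist_add_lat (k : ℤ × ℤ) (x y : ℝ × ℝ) : M.dist (x + lat k) (y + lat k) = M.dist x y := by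
  have key : ∀ (k : ℤ × ℤ) x y, M.dist (x + lat k) (y + lat k) ≤ M.dist x y := by
    intro k x y
    refine le_csInf (M.nonempty_lengths x y) ?_
    rintro L ⟨c, hc, rfl, rfl, rfl⟩
    have h := M.dist_le_length (c := fun t => c t + lat k) (hc.add contDiff_const)
    simpa [length, M.periodic] using h
  refine le_antisymm (key k x y) ?_
  have := key (-k) (x + lat k) (y + lat k)
  simpa [lat_neg] using this

theorem lo_mul_le_length {c : ℝ → ℝ × ℝ} (hc : ContDiff ℝ 1 c) {a b : ℝ} (hab : a ≤ b) :
    M.lo * ‖c b - c a‖ ≤ M.length c a b := by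
  have hcd := hc.continuous_deriv le_rfl
  have h1 : ∫ t in a..b, deriv c t = c b - c a :=
    intervalIntegral.integral_eq_sub_of_hasDerivAt
      (fun t _ => (hc.differentiable one_ne_zero t).hasDerivAt) (hcd.intervalIntegrable _ _)
  have h2 : ‖c b - c a‖ ≤ ∫ t in a..b, ‖deriv c t‖ := by
    rw [← h1]; exact intervalIntegral.norm_integral_le_integral_norm hab
  calc M.lo * ‖c b - c a‖ ≤ M.lo * ∫ t in a..b, ‖deriv c t‖ := by
        have := M.lo_pos; gcongr
    _ = ∫ t in a..b, M.lo * ‖deriv c t‖ := (intervalIntegral.integral_const_mul _ _).symm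
    _ ≤ _ := intervalIntegral.integral_mono_on hab
        ((continuous_const.mul hcd.norm).intervalIntegrable _ _)
        ((M.continuous_nrm_comp hc.continuous hcd).intervalIntegrable _ _)
        fun t _ => M.lo_le_nrm _ _

theorem lo_mul_le_dist (x y : ℝ × ℝ) : M.lo * ‖x - y‖ ≤ M.dist x y := by
  refine le_csInf (M.nonempty_lengths x y) ?_
  rintro L ⟨c, hc, rfl, rfl, rfl⟩
  rw [norm_sub_rev]
  exact M.lo_mul_le_length hc zero_le_one

theorem dist_le_hi_mul (x y : ℝ × ℝ) : M.dist x y ≤ M.hi * ‖x - y‖ := by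
  have h := M.dist_le_length (contDiff_line x y)
  simp only [zero_smul, add_zero, one_smul, add_sub_cancel] at h
  refine h.trans ?_
  have h2 : M.length (fun t : ℝ => x + t • (y - x)) 0 1 ≤ ∫ t in (0 : ℝ)..1, M.hi * ‖x - y‖ := by
    refine intervalIntegral.integral_mono_on zero_le_one ?_ (by simp) fun t _ => ?_
    · refine (M.continuous_nrm_comp (contDiff_line x y).continuous
        ((contDiff_line x y).continuous_deriv le_rfl)).intervalIntegrable _ _
    · rw [(hasDerivAt_line x y t).deriv, norm_sub_rev]
      exact M.nrm_le_hi _ _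
  simpa using h2

theorem eq_of_dist_eq_zero {x y : ℝ × ℝ} (h : M.dist x y = 0) : x = y := by
  have h1 := M.lo_mul_le_dist x y
  have h2 := M.lo_pos
  have h3 := norm_nonneg (x - y)
  have : ‖x - y‖ = 0 := by nlinarith
  exact sub_eq_zero.1 (norm_eq_zero.1 this)

theorem dist_triangle (x y z : ℝ × ℝ) : M.dist x z ≤ M.dist x y + M.dist y z := by
  refine le_of_forall_pos_le_add fun ε hε => ?_
  obtain ⟨c, hc, rfl, rfl, hcl⟩ := M.exists_length_lt (lt_add_of_pos_right (M.dist x y) (half_pos hε))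
  obtain ⟨e, he, he0, rfl, hel⟩ :=
    M.exists_length_lt (lt_add_of_pos_right (M.dist (c 1) z) (half_pos hε))
  set θ := Real.smoothTransition
  have hθ : ContDiff ℝ 1 θ := Real.smoothTransition.contDiff
  have hθd : ∀ t, HasDerivAt θ (deriv θ t) t := fun t =>
    (hθ.differentiable one_ne_zero t).hasDerivAt
  have hθc : Continuous (deriv θ) := hθ.continuous_deriv le_rfl
  have hθ0 : ∀ t, t ≤ 0 → deriv θ t = 0 := fun t ht => by
    refine IsLocalMin.deriv_eq_zero (Eventually.of_forall fun s => ?_)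
    exact (Real.smoothTransition.zero_of_nonpos ht).le.trans (Real.smoothTransition.nonneg s)
  have hθ1 : ∀ t, 1 ≤ t → deriv θ t = 0 := fun t ht => by
    refine IsLocalMax.deriv_eq_zero (Eventually.of_forall fun s => ?_)
    exact (Real.smoothTransition.le_one s).trans_eq (Real.smoothTransition.one_of_one_le ht).symm
  have hθn : ∀ t, 0 ≤ deriv θ t := fun t => Real.smoothTransition.monotone.deriv_nonneg
  have hθl : ∀ f : ℝ → ℝ × ℝ, ContDiff ℝ 1 f →
      ∫ t in (0 : ℝ)..1, M.nrm (f (θ t)) (deriv θ t • deriv f (θ t)) = M.length f 0 1 := by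
    intro f hf
    have h := intervalIntegral.integral_comp_mul_deriv (a := 0) (b := 1) (f := θ) (f' := deriv θ)
      (g := fun t => M.nrm (f t) (deriv f t)) (fun t _ => hθd t) hθc.continuousOn
      (M.continuous_nrm_comp hf.continuous (hf.continuous_deriv le_rfl))
    rw [show θ 0 = 0 from Real.smoothTransition.zero,
      show θ 1 = 1 from Real.smoothTransition.one] at h
    rw [length_eq_integral, ← h]
    refine intervalIntegral.integral_congr fun t _ => ?_
    simp only [nrm_smul, abs_of_nonneg (hθn t), Function.comp]
    ring
  have hcd := hc.continuous_deriv le_rfl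
  have hed := he.continuous_deriv le_rfl
  set γ : ℝ → ℝ × ℝ := fun t => c (θ t) + e (θ (t - 1)) - c 1 with hγ
  set v : ℝ → ℝ × ℝ := fun t =>
    deriv θ t • deriv c (θ t) + deriv θ (t - 1) • deriv e (θ (t - 1)) with hv
  have hγv : ∀ t, HasDerivAt γ (v t) t := by
    intro t
    have h1 : HasDerivAt (fun t : ℝ => t - 1) 1 t := (hasDerivAt_id t).sub_const 1
    have h2 := ((hc.differentiable one_ne_zero (θ t)).hasDerivAt).scomp t (hθd t)
    have h4 : HasDerivAt (fun t => θ (t - 1)) (deriv θ (t - 1)) t := by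
      simpa [Function.comp_def] using (hθd (t - 1)).scomp t h1
    have h3 := ((he.differentiable one_ne_zero (θ (t - 1))).hasDerivAt).scomp t h4
    exact (h2.add h3).sub_const _
  have hγc : Continuous γ := continuous_iff_continuousAt.2 fun t => (hγv t).continuousAt
  have hvc : Continuous v := by
    have := hθ.continuous
    simp only [hv]
    fun_prop
  have h := M.dist_le_integral (γ := γ) (v := v) (a := 0) (b := 2) (by norm_num)
    hvc.continuousOn hγc.continuousOn fun t _ => hγv t
  have hI := M.continuous_nrm_comp hγc hvc
  rw [← intervalIntegral.integral_add_adjacent_intervals (b := 1) (hI.intervalIntegrable _ _)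
    (hI.intervalIntegrable _ _)] at h
  have i1 : ∫ t in (0 : ℝ)..1, M.nrm (γ t) (v t) = M.length c 0 1 := by
    rw [← hθl c hc]
    refine intervalIntegral.integral_congr fun t ht => ?_
    rw [uIcc_of_le zero_le_one] at ht
    have a1 : θ (t - 1) = 0 := Real.smoothTransition.zero_of_nonpos (by linarith [ht.2])
    have a2 := hθ0 (t - 1) (by linarith [ht.2])
    simp [hγ, hv, a1, a2, he0]
  have i2 : ∫ t in (1 : ℝ)..2, M.nrm (γ t) (v t) = M.length e 0 1 := by
    rw [← hθl e he, show (1 : ℝ) = 0 + 1 by norm_num, show (2 : ℝ) = 1 + 1 by norm_num]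
    rw [← intervalIntegral.integral_comp_add_right]
    norm_num
    refine intervalIntegral.integral_congr fun t ht => ?_
    rw [uIcc_of_le zero_le_one] at ht
    have a1 : θ (t + 1) = 1 := Real.smoothTransition.one_of_one_le (by linarith [ht.1])
    have a2 := hθ1 (t + 1) (by linarith [ht.1])
    simp [hγ, hv, a1, a2]
  rw [i1, i2] at h
  have g0 : γ 0 = c 0 := by
    have a1 : θ 0 = 0 := Real.smoothTransition.zero
    have a2 : θ (0 - 1) = 0 := Real.smoothTransition.zero_of_nonpos (by norm_num)
    simp [hγ, a1, a2, he0, -zero_sub]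
  have g2 : γ 2 = e 1 := by
    have a1 : θ 2 = 1 := Real.smoothTransition.one_of_one_le (by norm_num)
    have a2 : θ (2 - 1) = 1 := Real.smoothTransition.one_of_one_le (by norm_num)
    simp only [hγ, a1, a2]
    abel
  rw [g0, g2] at h
  linarith

/-- The bilinear form `g_q(·, e)` as a continuous linear functional. -/
def gL (q e : ℝ × ℝ) : (ℝ × ℝ) →L[ℝ] ℝ :=
  LinearMap.toContinuousLinearMap (IsLinearMap.mk' (fun v => M.g q v e) (M.linear q e))

theorem gL_apply (q e v : ℝ × ℝ) : M.gL q e v = M.g q v e := rfl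

theorem nrm_sub_le_integral {q : ℝ × ℝ} {c : ℝ → ℝ × ℝ} (hc : ContDiff ℝ 1 c) {a b : ℝ}
    (hab : a ≤ b) : M.nrm q (c b - c a) ≤ ∫ t in a..b, M.nrm q (deriv c t) := by
  have hcd := hc.continuous_deriv le_rfl
  set e := c b - c a with he
  have h1 : ∫ t in a..b, M.g q (deriv c t) e = M.g q e e := by
    have := intervalIntegral.integral_eq_sub_of_hasDerivAt (a := a) (b := b)
      (f := fun t => M.gL q e (c t)) (f' := fun t => M.gL q e (deriv c t))
      (fun t _ => (M.gL q e).hasFDerivAt.comp_hasDerivAt t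
        (hc.differentiable one_ne_zero t).hasDerivAt)
      (((M.gL q e).continuous.comp hcd).intervalIntegrable _ _)
    rw [← map_sub, ← he] at this
    simpa only [gL_apply] using this
  have h2 : ∫ t in a..b, M.g q (deriv c t) e ≤ ∫ t in a..b, M.nrm q (deriv c t) * M.nrm q e :=
    intervalIntegral.integral_mono_on hab
      (((M.gL q e).continuous.comp hcd).intervalIntegrable _ _)
      (((M.continuous_nrm_comp continuous_const hcd).mul continuous_const).intervalIntegrable _ _)
      fun t _ => M.cauchy_schwarz _ _ _
  rw [h1, intervalIntegral.integral_mul_const, ← nrm_sq, sq] at h2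
  rcases (M.nrm_nonneg q e).eq_or_lt with h | h
  · rw [← h]
    exact intervalIntegral.integral_nonneg hab fun _ _ => M.nrm_nonneg _ _
  · exact le_of_mul_le_mul_right h2 h

/-- Comparison of the distance with the norm of frozen coefficients, up to a quadratic error. -/
theorem exists_dist_sub_nrm : ∃ C > 0, ∀ (q x y : ℝ × ℝ) (h : ℝ), ‖x - q‖ ≤ h → ‖y - q‖ ≤ h →
    |M.dist x y - M.nrm q (y - x)| ≤ C * h ^ 2 := by
  have hlo := M.lo_pos
  have hhi := M.hi_pos
  have hK := M.lipK_pos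
  set R := 3 * M.hi / M.lo with hR
  have hR0 : 0 < R := by positivity
  refine ⟨2 * M.lipK + M.lipK * (1 + R) * R, by positivity, fun q x y h hx hy => ?_⟩
  have hh : 0 ≤ h := (norm_nonneg _).trans hx
  have hxy : ‖y - x‖ ≤ 2 * h := by
    calc ‖y - x‖ = ‖(y - q) - (x - q)‖ := by congr 1; abel
      _ ≤ ‖y - q‖ + ‖x - q‖ := norm_sub_le _ _
      _ ≤ _ := by linarith
  rw [abs_le]
  constructor
  · rw [neg_le_sub_iff_le_add']
    have : ∀ L ∈ {L | ∃ c : ℝ → ℝ × ℝ, ContDiff ℝ 1 c ∧ c 0 = x ∧ c 1 = y ∧ L = M.length c 0 1},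
        M.nrm q (y - x) - (2 * M.lipK + M.lipK * (1 + R) * R) * h ^ 2 ≤ L := by
      rintro L ⟨c, hc, rfl, rfl, rfl⟩
      have hcd := hc.continuous_deriv le_rfl
      by_cases hl : M.length c 0 1 ≤ 3 * M.hi * h
      · have hpt : ∀ t ∈ Icc (0 : ℝ) 1, ‖c t - q‖ ≤ (1 + R) * h := by
          intro t ht
          have h1 := M.lo_mul_le_length hc ht.1
          have h2 : M.length c 0 t ≤ M.length c 0 1 := by
            have hI := M.continuous_nrm_comp hc.continuous hcd
            have h3 := intervalIntegral.integral_add_adjacent_intervals (a := 0) (b := t) (c := 1)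
              (hI.intervalIntegrable (μ := MeasureTheory.volume) _ _) (hI.intervalIntegrable _ _)
            have h4 : 0 ≤ M.length c t 1 := M.length_nonneg ht.2
            rw [length_eq_integral] at *
            rw [length_eq_integral]
            linarith
          have h3 : ‖c t - c 0‖ ≤ R * h := by
            rw [hR, div_mul_eq_mul_div, le_div_iff₀ hlo]
            linarith
          calc ‖c t - q‖ = ‖(c t - c 0) + (c 0 - q)‖ := by congr 1; abel
            _ ≤ ‖c t - c 0‖ + ‖c 0 - q‖ := norm_add_le _ _
            _ ≤ _ := by linarith
        have hn : M.lo * ∫ t in (0 : ℝ)..1, ‖deriv c t‖ ≤ 3 * M.hi * h := by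
          refine le_trans ?_ hl
          rw [← intervalIntegral.integral_const_mul]
          exact intervalIntegral.integral_mono_on zero_le_one
            ((continuous_const.mul hcd.norm).intervalIntegrable _ _)
            ((M.continuous_nrm_comp hc.continuous hcd).intervalIntegrable _ _)
            fun t _ => M.lo_le_nrm _ _
        have hn' : ∫ t in (0 : ℝ)..1, ‖deriv c t‖ ≤ R * h := by
          rw [hR, div_mul_eq_mul_div, le_div_iff₀ hlo]
          linarith
        have h5 := M.nrm_sub_le_integral (q := q) hc zero_le_one
        have h6 : ∫ t in (0 : ℝ)..1, M.nrm q (deriv c t) ≤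
            ∫ t in (0 : ℝ)..1, (M.nrm (c t) (deriv c t) + M.lipK * ((1 + R) * h) * ‖deriv c t‖) := by
          refine intervalIntegral.integral_mono_on zero_le_one
            ((M.continuous_nrm_comp continuous_const hcd).intervalIntegrable _ _)
            (((M.continuous_nrm_comp hc.continuous hcd).add
              (continuous_const.mul hcd.norm)).intervalIntegrable _ _) fun t ht => ?_
          have h7 := (abs_le.1 (M.nrm_lip (c t) q (deriv c t))).1
          have h8 : M.lipK * ‖c t - q‖ * ‖deriv c t‖ ≤ M.lipK * ((1 + R) * h) * ‖deriv c t‖ := by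
            gcongr
            exact hpt t ht
          linarith
        have hI2 : IntervalIntegrable (fun t => M.lipK * ((1 + R) * h) * ‖deriv c t‖)
            MeasureTheory.volume 0 1 := (by fun_prop : Continuous fun t =>
              M.lipK * ((1 + R) * h) * ‖deriv c t‖).intervalIntegrable _ _
        rw [intervalIntegral.integral_add
          ((M.continuous_nrm_comp hc.continuous hcd).intervalIntegrable _ _) hI2,
          intervalIntegral.integral_const_mul, ← length_eq_integral] at h6
        have h9 : M.lipK * ((1 + R) * h) * ∫ t in (0 : ℝ)..1, ‖deriv c t‖ ≤
            M.lipK * ((1 + R) * h) * (R * h) := by gcongr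
        nlinarith [sq_nonneg h]
      · have h1 := M.nrm_le_hi q (c 1 - c 0)
        have h2 : M.hi * ‖c 1 - c 0‖ ≤ M.hi * (2 * h) := by gcongr
        have h3 : 0 ≤ (2 * M.lipK + M.lipK * (1 + R) * R) * h ^ 2 := by positivity
        nlinarith
    have := le_csInf (M.nonempty_lengths x y) this
    rw [← dist] at this
    linarith
  · have h1 := M.dist_le_length (contDiff_line x y)
    simp only [zero_smul, add_zero, one_smul, add_sub_cancel] at h1
    have h2 : M.length (fun t : ℝ => x + t • (y - x)) 0 1 ≤
        ∫ t in (0 : ℝ)..1, (M.nrm q (y - x) + M.lipK * h * (2 * h)) := by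
      refine intervalIntegral.integral_mono_on zero_le_one ?_ (by simp) fun t ht => ?_
      · refine (M.continuous_nrm_comp (contDiff_line x y).continuous
          ((contDiff_line x y).continuous_deriv le_rfl)).intervalIntegrable _ _
      · rw [(hasDerivAt_line x y t).deriv, ← nrm]
        have h3 := (abs_le.1 (M.nrm_lip (x + t • (y - x)) q (y - x))).2
        have h4 : ‖x + t • (y - x) - q‖ ≤ h := by
          have : x + t • (y - x) - q = (1 - t) • (x - q) + t • (y - q) := by
            simp only [smul_sub, sub_smul, one_smul]; abel
          rw [this]
          refine (norm_add_le _ _).trans ?_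
          rw [norm_smul, norm_smul, Real.norm_of_nonneg ht.1,
            Real.norm_of_nonneg (sub_nonneg.2 ht.2)]
          nlinarith [ht.1, ht.2]
        have h5 : M.lipK * ‖x + t • (y - x) - q‖ * ‖y - x‖ ≤ M.lipK * h * (2 * h) := by
          gcongr
        linarith
    simp only [intervalIntegral.integral_const, sub_zero, one_smul] at h2
    have h3 : 0 ≤ (M.lipK * (1 + R) * R) * h ^ 2 := by positivity
    nlinarith

theorem continuous_dist : Continuous fun p : (ℝ × ℝ) × (ℝ × ℝ) => M.dist p.1 p.2 := by
  refine continuous_iff_continuousAt.2 fun p => ?_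
  have h : ∀ q : (ℝ × ℝ) × (ℝ × ℝ), Dist.dist (M.dist q.1 q.2) (M.dist p.1 p.2) ≤
      M.hi * ‖q.1 - p.1‖ + M.hi * ‖q.2 - p.2‖ := by
    intro q
    rw [Real.dist_eq, abs_le]
    have h1 := M.dist_triangle p.1 q.1 p.2
    have h2 := M.dist_triangle q.1 q.2 p.2
    have h3 := M.dist_triangle q.1 p.1 q.2
    have h4 := M.dist_triangle p.1 p.2 q.2
    have h5 := M.dist_le_hi_mul q.1 p.1
    have h6 := M.dist_le_hi_mul q.2 p.2
    rw [M.dist_comm q.1 p.1] at *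
    rw [M.dist_comm q.2 p.2] at *
    constructor <;> linarith
  refine tendsto_iff_dist_tendsto_zero.2
    (squeeze_zero (fun _ => _root_.dist_nonneg) h ?_)
  have hc : Continuous fun q : (ℝ × ℝ) × (ℝ × ℝ) => M.hi * ‖q.1 - p.1‖ + M.hi * ‖q.2 - p.2‖ := by
    fun_prop
  have := hc.tendsto p
  simpa using this

end TorusMetric

namespace TorusMetric

variable (M : TorusMetric)

theorem dist_eq_zero_iff {x y : ℝ × ℝ} : M.dist x y = 0 ↔ x = y :=
  ⟨M.eq_of_dist_eq_zero, fun h => h ▸ M.dist_self x⟩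

theorem continuous_dist_comp {X : Type*} [TopologicalSpace X] {f h : X → ℝ × ℝ}
    (hf : Continuous f) (hh : Continuous h) : Continuous fun t => M.dist (f t) (h t) :=
  M.continuous_dist.comp (hf.prodMk hh)

/-- `f` is `D`-Lipschitz for the Riemannian distance. -/
def LipD (f : ℝ → ℝ × ℝ) (D : ℝ) : Prop := ∀ s t, M.dist (f s) (f t) ≤ D * |s - t|

theorem norm_sub_le_dist (x y : ℝ × ℝ) : ‖x - y‖ ≤ M.dist x y / M.lo := by
  rw [le_div_iff₀ M.lo_pos, mul_comm]; exact M.lo_mul_le_dist x y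

theorem LipD.norm_sub_le {f : ℝ → ℝ × ℝ} {D : ℝ} (h : M.LipD f D) (s t : ℝ) :
    ‖f s - f t‖ ≤ D / M.lo * |s - t| := by
  have h1 := M.norm_sub_le_dist (f s) (f t)
  have h2 := h s t
  have h3 := M.lo_pos
  refine h1.trans ?_
  rw [div_mul_eq_mul_div]
  gcongr

theorem continuous_of_norm_sub_le {f : ℝ → ℝ × ℝ} {D : ℝ}
    (h : ∀ s t, ‖f s - f t‖ ≤ D * |s - t|) : Continuous f := by
  refine continuous_iff_continuousAt.2 fun t => ?_
  refine tendsto_iff_norm_sub_tendsto_zero.2 (squeeze_zero (fun _ => norm_nonneg _)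
    (fun s => h s t) ?_)
  have : Continuous fun s => D * |s - t| := by fun_prop
  simpa using this.tendsto t

theorem LipD.continuous {f : ℝ → ℝ × ℝ} {D : ℝ} (h : M.LipD f D) : Continuous f :=
  continuous_of_norm_sub_le h.norm_sub_le

theorem isCompact_lipD {K : Set (ℝ × ℝ)} (hK : IsCompact K) (D : ℝ) :
    IsCompact {f : ℝ → ℝ × ℝ | f 0 ∈ K ∧ M.LipD f D} := by
  obtain ⟨R, hR⟩ := hK.isBounded.exists_norm_le
  have h1 : IsCompact (Set.pi univ fun t : ℝ =>
      Metric.closedBall (0 : ℝ × ℝ) (R + D / M.lo * |t|)) :=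
    isCompact_univ_pi fun t => isCompact_closedBall _ _
  refine h1.of_isClosed_subset ?_ ?_
  · have h2 : IsClosed {f : ℝ → ℝ × ℝ | f 0 ∈ K} := hK.isClosed.preimage (continuous_apply 0)
    refine h2.inter ?_
    have : {f : ℝ → ℝ × ℝ | M.LipD f D} =
        ⋂ (s : ℝ) (t : ℝ), {f | M.dist (f s) (f t) ≤ D * |s - t|} := by
      ext f; simp [LipD]
    change IsClosed {f : ℝ → ℝ × ℝ | M.LipD f D}
    rw [this]
    exact isClosed_iInter fun s => isClosed_iInter fun t => isClosed_le
      (M.continuous_dist_comp (continuous_apply s) (continuous_apply t)) continuous_const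
  · rintro f ⟨h0, hf⟩ t -
    rw [mem_closedBall_zero_iff]
    have h3 := LipD.norm_sub_le M hf t 0
    have h4 := hR _ h0
    calc ‖f t‖ = ‖(f t - f 0) + f 0‖ := by congr 1; abel
      _ ≤ ‖f t - f 0‖ + ‖f 0‖ := norm_add_le _ _
      _ ≤ _ := by rw [sub_zero] at h3; linarith

/-- Compactness: Lipschitz constants in a closed class of curves attain their infimum. -/
theorem exists_lipD_of_forall_lt {K : Set (ℝ × ℝ)} (hK : IsCompact K) {S : Set (ℝ → ℝ × ℝ)}
    (hS : IsClosed S) {D : ℝ}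
    (h : ∀ D' > D, ∃ f ∈ S, f 0 ∈ K ∧ M.LipD f D') : ∃ f ∈ S, f 0 ∈ K ∧ M.LipD f D := by
  set F : ℕ → Set (ℝ → ℝ × ℝ) := fun n =>
    S ∩ {f : ℝ → ℝ × ℝ | f 0 ∈ K ∧ M.LipD f (D + 1 / ((n : ℝ) + 1))} with hF
  have hc : ∀ n, IsCompact (F n) := fun n => (M.isCompact_lipD hK _).inter_left hS
  have hpos : ∀ n : ℕ, (0 : ℝ) < 1 / ((n : ℝ) + 1) := fun n => Nat.one_div_pos_of_nat
  have hne : (⋂ n, F n).Nonempty := by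
    refine IsCompact.nonempty_iInter_of_sequence_nonempty_isCompact_isClosed F ?_ ?_ (hc 0)
      fun n => (hc n).isClosed
    · rintro n f ⟨h1, h2, h3⟩
      refine ⟨h1, h2, fun s t => (h3 s t).trans ?_⟩
      have := Nat.one_div_le_one_div (α := ℝ) (Nat.le_succ n)
      gcongr
    · intro n
      obtain ⟨f, h1, h2, h3⟩ := h (D + 1 / ((n : ℝ) + 1)) (by linarith [hpos n])
      exact ⟨f, h1, h2, h3⟩
  obtain ⟨f, hf⟩ := hne
  rw [mem_iInter] at hf
  refine ⟨f, (hf 0).1, (hf 0).2.1, fun s t => ?_⟩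
  have h1 : Tendsto (fun n : ℕ => (D + 1 / ((n : ℝ) + 1)) * |s - t|) atTop
      (𝓝 ((D + 0) * |s - t|)) :=
    (tendsto_one_div_add_atTop_nhds_zero_nat.const_add D).mul_const _
  rw [add_zero] at h1
  exact ge_of_tendsto' h1 fun n => (hf n).2.2 s t

/-- Reparametrization of an arc proportionally to arclength. -/
theorem exists_lipD_of_contDiff {c : ℝ → ℝ × ℝ} (hc : ContDiff ℝ 1 c) :
    ∃ f : ℝ → ℝ × ℝ, f 0 = c 0 ∧ f 1 = c 1 ∧ M.LipD f (M.length c 0 1) ∧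
      ∀ s, f s ∈ c '' Icc 0 1 := by
  have hcd := hc.continuous_deriv le_rfl
  have hI := M.continuous_nrm_comp hc.continuous hcd
  set Λ := M.length c 0 1 with hΛ
  have hΛ0 : 0 ≤ Λ := M.length_nonneg zero_le_one
  have hadd : ∀ a b, M.length c 0 a + M.length c a b = M.length c 0 b := fun a b =>
    intervalIntegral.integral_add_adjacent_intervals
      (hI.intervalIntegrable _ _) (hI.intervalIntegrable _ _)
  have hlc : Continuous fun t => M.length c 0 t :=
    intervalIntegral.continuous_primitive (fun a b => hI.intervalIntegrable _ _) 0
  have h00 : M.length c 0 0 = 0 := by simp [length]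
  have hd : ∀ a b, M.dist (c a) (c b) ≤ |M.length c 0 a - M.length c 0 b| := by
    have key : ∀ a b, a ≤ b → M.dist (c a) (c b) ≤ |M.length c 0 a - M.length c 0 b| := by
      intro a b hab
      rw [abs_sub_comm]
      refine (M.dist_le_length_of_contDiff hc hab).trans (le_trans ?_ (le_abs_self _))
      linarith [hadd a b]
    intro a b
    rcases le_total a b with h | h
    · exact key a b h
    · rw [M.dist_comm, abs_sub_comm]; exact key b a h
  have hex : ∀ s : Icc (0 : ℝ) 1, ∃ t ∈ Icc (0 : ℝ) 1, M.length c 0 t = Λ * s := by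
    intro s
    have h1 : Λ * (s : ℝ) ∈ Icc (M.length c 0 0) (M.length c 0 1) := by
      rw [h00]
      exact ⟨mul_nonneg hΛ0 s.2.1, by nlinarith [s.2.2]⟩
    obtain ⟨t, ht, h⟩ := intermediate_value_Icc zero_le_one hlc.continuousOn h1
    exact ⟨t, ht, h⟩
  choose T hT0 hT using hex
  have hlip : ∀ s t, M.dist (c (T s)) (c (T t)) ≤ Λ * |(s : ℝ) - t| := by
    intro s t
    refine (hd _ _).trans ?_
    rw [hT, hT, ← mul_sub, abs_mul, abs_of_nonneg hΛ0]
  refine ⟨fun s => c (T (projIcc 0 1 zero_le_one s)), ?_, ?_, ?_, fun s => ⟨_, hT0 _, rfl⟩⟩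
  · refine M.eq_of_dist_eq_zero (le_antisymm ((hd _ _).trans ?_) (M.dist_nonneg _ _))
    rw [hT, h00, projIcc_left]; simp
  · refine M.eq_of_dist_eq_zero (le_antisymm ((hd _ _).trans ?_) (M.dist_nonneg _ _))
    rw [hT, ← hΛ, projIcc_right]; simp
  · intro s t
    refine (hlip _ _).trans (mul_le_mul_of_nonneg_left ?_ hΛ0)
    have := (LipschitzWith.projIcc (a := (0:ℝ)) (b := 1) zero_le_one).dist_le_mul s t
    simpa only [Subtype.dist_eq, Real.dist_eq, NNReal.coe_one, one_mul] using this

/-- `c` is a minimal arc parametrized by arclength on `[a, b]`. -/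
def IsoOn (c : ℝ → ℝ × ℝ) (a b : ℝ) : Prop :=
  ∀ s ∈ Icc a b, ∀ t ∈ Icc a b, s ≤ t → M.dist (c s) (c t) = t - s

theorem exists_isoOn (x y : ℝ × ℝ) : ∃ c : ℝ → ℝ × ℝ, c 0 = x ∧ c (M.dist x y) = y ∧
    M.IsoOn c 0 (M.dist x y) := by
  set D := M.dist x y with hD
  rcases (M.dist_nonneg x y).eq_or_lt with h0 | h0
  · have hxy := M.eq_of_dist_eq_zero h0.symm
    refine ⟨fun _ => x, rfl, hxy, fun s hs t ht hst => ?_⟩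
    rw [hD, ← h0] at hs ht
    rw [M.dist_self]; linarith [hs.1, hs.2, ht.1, ht.2]
  have hS : IsClosed {f : ℝ → ℝ × ℝ | f 1 = y} := isClosed_singleton.preimage (continuous_apply 1)
  obtain ⟨f, h1, h2, h3⟩ := M.exists_lipD_of_forall_lt (K := {x}) isCompact_singleton hS
    (D := D) (fun D' hD' => by
      obtain ⟨c, hc, e0, e1, hl⟩ := M.exists_length_lt hD'
      obtain ⟨f, f0, f1, hf, -⟩ := M.exists_lipD_of_contDiff hc
      refine ⟨f, f1.trans e1, f0.trans e0, fun s t => (hf s t).trans ?_⟩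
      gcongr)
  rw [mem_singleton_iff] at h2
  have h1' : f 1 = y := h1
  refine ⟨fun s => f (s / D), by simpa using h2, by simp only [hD]; rw [div_self (hD ▸ h0.ne'), h1'], ?_⟩
  have hl : ∀ s t, s ≤ t → M.dist (f (s / D)) (f (t / D)) ≤ t - s := by
    intro s t hst
    refine (h3 _ _).trans (le_of_eq ?_)
    rw [abs_sub_comm, ← sub_div, abs_of_nonneg (div_nonneg (sub_nonneg.2 hst) h0.le)]
    rw [hD] at *
    field_simp
  intro s hs t ht hst
  refine le_antisymm (hl s t hst) ?_
  have a1 := hl 0 s hs.1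
  have a2 := hl t D ht.2
  rw [zero_div, h2] at a1
  rw [div_self h0.ne', h1'] at a2
  have a3 := M.dist_triangle x (f (s / D)) y
  have a4 := M.dist_triangle (f (s / D)) (f (t / D)) y
  simp only
  linarith

variable {M} {c : ℝ → ℝ × ℝ} {a b : ℝ}

theorem IsoOn.mono (h : M.IsoOn c a b) {a' b' : ℝ} (ha : a ≤ a') (hb : b' ≤ b) :
    M.IsoOn c a' b' := fun s hs t ht =>
  h s ⟨ha.trans hs.1, hs.2.trans hb⟩ t ⟨ha.trans ht.1, ht.2.trans hb⟩

theorem IsoOn.dist_eq (h : M.IsoOn c a b) {s t : ℝ} (hs : s ∈ Icc a b) (ht : t ∈ Icc a b) :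
    M.dist (c s) (c t) = |s - t| := by
  rcases le_total s t with hst | hst
  · rw [h s hs t ht hst, abs_sub_comm, abs_of_nonneg (sub_nonneg.2 hst)]
  · rw [M.dist_comm, h t ht s hs hst, abs_of_nonneg (sub_nonneg.2 hst)]

theorem IsoOn.congr (h : M.IsoOn c a b) {c' : ℝ → ℝ × ℝ} (hc : ∀ t ∈ Icc a b, c' t = c t) :
    M.IsoOn c' a b := fun s hs t ht hst => by rw [hc s hs, hc t ht, h s hs t ht hst]

theorem IsoOn.shift (h : M.IsoOn c a b) (r : ℝ) : M.IsoOn (fun t => c (t + r)) (a - r) (b - r) :=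
  fun s hs t ht hst => by
    rw [h (s + r) ⟨by linarith [hs.1], by linarith [hs.2]⟩ (t + r)
      ⟨by linarith [ht.1], by linarith [ht.2]⟩ (by linarith)]; ring

theorem IsoOn.reverse (h : M.IsoOn c a b) : M.IsoOn (fun t => c (-t)) (-b) (-a) :=
  fun s hs t ht hst => by
    rw [h.dist_eq (s := -s) (t := -t) ⟨by linarith [hs.2], by linarith [hs.1]⟩
      ⟨by linarith [ht.2], by linarith [ht.1]⟩, abs_of_nonneg (by linarith)]; ring

theorem IsoOn.add_lat (h : M.IsoOn c a b) (k : ℤ × ℤ) : M.IsoOn (fun t => c t + lat k) a b :=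
  fun s hs t ht hst => by rw [M.dist_add_lat, h s hs t ht hst]

theorem IsoOn.norm_sub_le (h : M.IsoOn c a b) {s t : ℝ} (hs : s ∈ Icc a b) (ht : t ∈ Icc a b) :
    ‖c s - c t‖ ≤ |s - t| / M.lo := by
  rw [← h.dist_eq hs ht]; exact M.norm_sub_le_dist _ _

theorem IsoOn.continuousOn (h : M.IsoOn c a b) : ContinuousOn c (Icc a b) := by
  refine LipschitzOnWith.continuousOn (K := Real.toNNReal (1 / M.lo)) ?_
  refine LipschitzOnWith.of_dist_le_mul fun s hs t ht => ?_
  have := M.lo_pos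
  rw [dist_eq_norm, Real.dist_eq, Real.coe_toNNReal _ (by positivity), one_div_mul_eq_div]
  exact h.norm_sub_le hs ht

/-- A curve made of two minimal arcs whose endpoints are at the right distance is minimal. -/
theorem IsoOn.of_dist {e : ℝ} (h1 : M.IsoOn c a b) (h2 : M.IsoOn c b e) (hab : a ≤ b)
    (hbe : b ≤ e) (hd : e - a ≤ M.dist (c a) (c e)) : M.IsoOn c a e := by
  have key : ∀ s ∈ Icc a b, ∀ t ∈ Icc b e, M.dist (c s) (c t) = t - s := by
    intro s hs t ht
    have a1 := h1 s hs b ⟨hab, le_rfl⟩ hs.2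
    have a2 := h2 b ⟨le_rfl, hbe⟩ t ht ht.1
    have a3 := h1 a ⟨le_rfl, hab⟩ s hs hs.1
    have a4 := h2 t ht e ⟨hbe, le_rfl⟩ ht.2
    have t1 := M.dist_triangle (c s) (c b) (c t)
    have t2 := M.dist_triangle (c a) (c s) (c e)
    have t3 := M.dist_triangle (c s) (c t) (c e)
    linarith
  intro s hs t ht hst
  rcases le_total s b with hsb | hsb
  · rcases le_total t b with htb | htb
    · exact h1 s ⟨hs.1, hsb⟩ t ⟨ht.1, htb⟩ hst
    · exact key s ⟨hs.1, hsb⟩ t ⟨htb, ht.2⟩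
  · exact h2 s ⟨hsb, hs.2⟩ t ⟨hsb.trans hst, ht.2⟩ hst

/-- Gluing of two minimal arcs. -/
theorem IsoOn.glue {c₁ c₂ : ℝ → ℝ × ℝ} {e : ℝ} (h1 : M.IsoOn c₁ a b) (h2 : M.IsoOn c₂ b e)
    (hab : a ≤ b) (hbe : b ≤ e) (hb : c₁ b = c₂ b) (hd : e - a ≤ M.dist (c₁ a) (c₂ e)) :
    M.IsoOn (fun t => if t ≤ b then c₁ t else c₂ t) a e := by
  have e1 : ∀ t ∈ Icc a b, (fun t => if t ≤ b then c₁ t else c₂ t) t = c₁ t :=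
    fun t ht => if_pos ht.2
  have e2 : ∀ t ∈ Icc b e, (fun t => if t ≤ b then c₁ t else c₂ t) t = c₂ t := fun t ht => by
    rcases ht.1.eq_or_lt with h | h
    · subst h; simp [hb]
    · simp [not_le.2 h]
  refine (h1.congr e1).of_dist (h2.congr e2) hab hbe ?_
  have g1 := e1 a ⟨le_rfl, hab⟩
  have g2 := e2 e ⟨hbe, le_rfl⟩
  simp only at g1 g2
  rw [g1, g2]
  exact hd

end TorusMetric

theorem exists_hasDerivAt_of_second_difference {f : ℝ → ℝ × ℝ} (hf : Continuous f) {C h₀ a b : ℝ}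
    (hh₀ : 0 < h₀)
    (h : ∀ t h, 0 ≤ h → h ≤ h₀ → a ≤ t - h → t + h ≤ b →
      ‖f (t + h) - (2 : ℝ) • f t + f (t - h)‖ ≤ C * h * √h) {b' : ℝ} (hb : b' < b) :
    ∃ v : ℝ → ℝ × ℝ, ContinuousOn v (Ioo a b') ∧ ∀ t ∈ Ioo a b', HasDerivAt f (v t) t := by
  set η := min h₀ (min 1 (b - b')) with hη
  have hη0 : 0 < η := lt_min hh₀ (lt_min one_pos (sub_pos.2 hb))
  have hη1 : η ≤ h₀ := min_le_left _ _
  have hη2 : η ≤ 1 := (min_le_right _ _).trans (min_le_left _ _)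
  have hη3 : η ≤ b - b' := (min_le_right _ _).trans (min_le_right _ _)
  set r : ℝ := √(1 / 2) with hr
  have hr2 : r ^ 2 = 1 / 2 := Real.sq_sqrt (by norm_num)
  have hr0 : 0 < r := Real.sqrt_pos.2 (by norm_num)
  have hr1 : r < 1 := by nlinarith
  set k : ℕ → ℝ := fun n => η * (r ^ n) ^ 2 with hk
  have hk0 : ∀ n, 0 < k n := fun n => by positivity
  have hks : ∀ n, k n = 2 * k (n + 1) := fun n => by
    simp only [hk]; rw [pow_succ r n, mul_pow, hr2]; ring
  have hrn : ∀ n, r ^ n ≤ 1 := fun n => pow_le_one₀ hr0.le hr1.le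
  have hkη : ∀ n, k n ≤ η := fun n => by
    have h1 : (r ^ n) ^ 2 ≤ 1 := pow_le_one₀ (by positivity) (hrn n)
    simp only [hk]; nlinarith
  have hC0 : ∀ n, √(k n) ≤ r ^ n := fun n => by
    refine Real.sqrt_le_iff.2 ⟨by positivity, ?_⟩
    simp only [hk]
    have : 0 < (r ^ n) ^ 2 := by positivity
    nlinarith
  set F : ℝ → ℝ × ℝ := fun x => ∫ s in (0 : ℝ)..x, f s with hF
  have hFd : ∀ t, HasDerivAt F (f t) t := fun t =>
    intervalIntegral.integral_hasDerivAt_right (hf.intervalIntegrable _ _)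
      (hf.stronglyMeasurableAtFilter _ _) hf.continuousAt
  set D : ℕ → ℝ → ℝ × ℝ := fun n t => (k n)⁻¹ • (f (t + k n) - f t) with hD
  have hcau : ∀ t ∈ Ioo a b', ∀ n, Dist.dist (D n t) (D (n + 1) t) ≤ |C| * r ^ n := by
    intro t ht n
    have h1 := h (t + k (n + 1)) (k (n + 1)) (hk0 _).le ((hkη _).trans hη1)
      (by linarith [ht.1]) (by linarith [ht.2, hks n, hkη n])
    have e1 : t + k (n + 1) + k (n + 1) = t + k n := by rw [hks n]; ring
    rw [e1, add_sub_cancel_right] at h1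
    have e2 : D n t - D (n + 1) t =
        (k n)⁻¹ • (f (t + k n) - (2 : ℝ) • f (t + k (n + 1)) + f t) := by
      have e3 : (k (n + 1))⁻¹ = (k n)⁻¹ * 2 := by
        rw [hks n]; have := hk0 (n + 1); field_simp
      simp only [hD]
      rw [e3, mul_smul, ← smul_sub]
      congr 1
      rw [smul_sub, two_smul ℝ (f t)]; abel
    rw [dist_eq_norm, e2, norm_smul, Real.norm_of_nonneg (inv_pos.2 (hk0 n)).le]
    have h2 : C * k (n + 1) * √(k (n + 1)) ≤ |C| * k n * r ^ n := by
      have a1 : C * k (n + 1) ≤ |C| * k n := by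
        have := le_abs_self C
        have := hk0 (n + 1)
        have := abs_nonneg C
        nlinarith [hks n]
      have a2 : √(k (n + 1)) ≤ r ^ n :=
        (hC0 _).trans (pow_le_pow_of_le_one hr0.le hr1.le (Nat.le_succ n))
      have a3 : 0 ≤ |C| * k n := mul_nonneg (abs_nonneg _) (hk0 n).le
      calc C * k (n + 1) * √(k (n + 1)) ≤ |C| * k n * √(k (n + 1)) := by gcongr
        _ ≤ _ := by gcongr
    calc _ ≤ (k n)⁻¹ * (|C| * k n * r ^ n) :=
        mul_le_mul_of_nonneg_left (h1.trans h2) (inv_pos.2 (hk0 n)).le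
      _ = _ := by have := hk0 n; field_simp
  have hlim : ∀ t : ℝ, ∃ v, t ∈ Ioo a b' → Tendsto (fun n => D n t) atTop (𝓝 v) := by
    intro t
    by_cases ht : t ∈ Ioo a b'
    · obtain ⟨v, hv⟩ := cauchySeq_tendsto_of_complete
        (cauchySeq_of_le_geometric r |C| hr1 (hcau t ht))
      exact ⟨v, fun _ => hv⟩
    · exact ⟨0, fun h => absurd h ht⟩
  choose v hv using hlim
  have hkt : Tendsto k atTop (𝓝 0) := by
    have h1 : Tendsto (fun n : ℕ => r ^ n) atTop (𝓝 0) :=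
      tendsto_pow_atTop_nhds_zero_of_lt_one hr0.le hr1
    simpa using (h1.pow 2).const_mul η
  have hunif : TendstoUniformlyOn D v atTop (Ioo a b') := by
    rw [Metric.tendstoUniformlyOn_iff]
    intro ε hε
    have h1 : Tendsto (fun n : ℕ => |C| * r ^ n / (1 - r)) atTop (𝓝 0) := by
      simpa using ((tendsto_pow_atTop_nhds_zero_of_lt_one hr0.le hr1).const_mul |C|).div_const
        (1 - r)
    filter_upwards [h1.eventually (gt_mem_nhds hε)] with n hn t ht
    rw [_root_.dist_comm]
    exact (dist_le_of_le_geometric_of_tendsto r |C| hr1 (hcau t ht) (hv t ht) n).trans_lt hn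
  refine ⟨v, ?_, fun t ht => ?_⟩
  · refine hunif.continuousOn (Eventually.frequently (Eventually.of_forall fun n => ?_))
    have : Continuous (D n) := by simp only [hD]; fun_prop
    exact this.continuousOn
  · refine hasDerivAt_of_tendstoUniformlyOn (f := fun n t => (k n)⁻¹ • (F (t + k n) - F t))
      isOpen_Ioo hunif (Eventually.of_forall fun n x _ => ?_) (fun x _ => ?_) ht
    · have h1 : HasDerivAt (fun x => F (x + k n)) (f (x + k n)) x :=
        HasDerivAt.comp_add_const x (k n) (hFd _)
      exact (h1.sub (hFd x)).const_smul (k n)⁻¹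
    · have h1 := (hFd x).tendsto_slope_zero
      refine h1.comp (tendsto_nhdsWithin_iff.2 ⟨hkt, Eventually.of_forall fun n => ?_⟩)
      exact (hk0 n).ne'

namespace TorusMetric

variable (M : TorusMetric)

theorem parallelogram (q u w : ℝ × ℝ) :
    M.nrm q (u + w) ^ 2 + M.nrm q (u - w) ^ 2 = 2 * M.nrm q u ^ 2 + 2 * M.nrm q w ^ 2 := by
  have hw : u - w = u + (-1 : ℝ) • w := by simp [sub_eq_add_neg]
  rw [hw]
  simp only [nrm_sq, g_add_left, g_add_right, g_smul_left, g_smul_right, M.symm q w u]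
  ring

theorem exists_midpoint_bound : ∃ C h₀ : ℝ, 0 < h₀ ∧ ∀ (c : ℝ → ℝ × ℝ) (a b : ℝ), M.IsoOn c a b →
    ∀ t h, 0 ≤ h → h ≤ h₀ → a ≤ t - h → t + h ≤ b →
      ‖c (t + h) - (2 : ℝ) • c t + c (t - h)‖ ≤ C * h * √h := by
  obtain ⟨C, hC, hd⟩ := M.exists_dist_sub_nrm
  have hlo := M.lo_pos
  set K := C / M.lo ^ 2 with hK
  have hK0 : 0 < K := by positivity
  refine ⟨√(15 * K) / M.lo, 1 / K, by positivity, fun c a b hc t h h0 h1 ha hb => ?_⟩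
  have m1 : t - h ∈ Icc a b := ⟨ha, by linarith⟩
  have m2 : t ∈ Icc a b := ⟨by linarith, by linarith⟩
  have m3 : t + h ∈ Icc a b := ⟨by linarith, hb⟩
  have d1 := hc _ m1 _ m2 (by linarith)
  have d2 := hc _ m2 _ m3 (by linarith)
  have d3 := hc _ m1 _ m3 (by linarith)
  have n1 : ‖c (t - h) - c t‖ ≤ h / M.lo := by
    have := hc.norm_sub_le m1 m2
    rwa [show t - h - t = -h by ring, abs_neg, abs_of_nonneg h0] at this
  have n3 : ‖c (t + h) - c t‖ ≤ h / M.lo := by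
    have := hc.norm_sub_le m3 m2
    rwa [show t + h - t = h by ring, abs_of_nonneg h0] at this
  have n2 : ‖c t - c t‖ ≤ h / M.lo := by rw [sub_self, norm_zero]; positivity
  have e : C * (h / M.lo) ^ 2 = K * h ^ 2 := by rw [hK]; field_simp
  have k1 := hd (c t) _ _ _ n1 n2
  have k2 := hd (c t) _ _ _ n2 n3
  have k3 := hd (c t) _ _ _ n1 n3
  rw [e, abs_le] at k1 k2 k3
  rw [d1] at k1
  rw [d2] at k2
  rw [d3] at k3
  set u := c (t + h) - c t with hu
  set w := c t - c (t - h) with hw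
  have s1 : c (t + h) - c (t - h) = u + w := by rw [hu, hw]; abel
  have s2 : c (t + h) - (2 : ℝ) • c t + c (t - h) = u - w := by rw [hu, hw, two_smul]; abel
  rw [s1] at k3
  rw [s2]
  have p := M.parallelogram (c t) u w
  have hKh : K * h ≤ 1 := by rw [le_div_iff₀ hK0] at h1; linarith
  have q1 : M.nrm (c t) u ≤ h + K * h ^ 2 := by linarith [k2.1]
  have q2 : M.nrm (c t) w ≤ h + K * h ^ 2 := by linarith [k1.1]
  have q3 : 2 * h - K * h ^ 2 ≤ M.nrm (c t) (u + w) := by linarith [k3.2]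
  have q4 : 0 ≤ 2 * h - K * h ^ 2 := by
    have : K * h * h ≤ 1 * h := by gcongr
    linarith
  have r1 := pow_le_pow_left₀ (M.nrm_nonneg _ _) q1 2
  have r2 := pow_le_pow_left₀ (M.nrm_nonneg _ _) q2 2
  have r3 := pow_le_pow_left₀ q4 q3 2
  have r4 : M.nrm (c t) (u - w) ^ 2 ≤ 15 * K * h ^ 3 := by
    have : K ^ 2 * h ^ 4 ≤ K * h ^ 3 := by
      calc K ^ 2 * h ^ 4 = K * h * (K * h ^ 3) := by ring
        _ ≤ 1 * (K * h ^ 3) := by gcongr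
        _ = _ := one_mul _
    linarith
  have r5 : M.nrm (c t) (u - w) ≤ √(15 * K) * (h * √h) := by
    have : 15 * K * h ^ 3 = (√(15 * K) * (h * √h)) ^ 2 := by
      rw [mul_pow, mul_pow, Real.sq_sqrt (by positivity), Real.sq_sqrt h0]; ring
    rw [this] at r4
    exact le_of_sq_le_sq r4 (by positivity)
  have r6 := M.lo_le_nrm (c t) (u - w)
  have : √(15 * K) / M.lo * h * √h = √(15 * K) * (h * √h) / M.lo := by field_simp
  rw [this, le_div_iff₀ hlo]
  linarith

variable {M} {c : ℝ → ℝ × ℝ} {a b : ℝ}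

theorem IsoOn.exists_continuous (h : M.IsoOn c a b) (hab : a ≤ b) :
    ∃ e : ℝ → ℝ × ℝ, Continuous e ∧ (∀ t ∈ Icc a b, e t = c t) ∧ M.IsoOn e a b := by
  have h1 : ∀ t ∈ Icc a b, c (projIcc a b hab t) = c t := fun t ht => by
    rw [projIcc_of_mem hab ht]
  exact ⟨fun t => c (projIcc a b hab t),
    (continuousOn_iff_continuous_domRestrict.1 h.continuousOn).comp continuous_projIcc, h1,
    h.congr h1⟩

theorem IsoOn.eventuallyEq {e : ℝ → ℝ × ℝ} (h : ∀ t ∈ Icc a b, e t = c t) {t : ℝ}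
    (ht : t ∈ Ioo a b) : e =ᶠ[𝓝 t] c := by
  filter_upwards [isOpen_Ioo.mem_nhds ht] with s hs using h s ⟨hs.1.le, hs.2.le⟩

theorem IsoOn.differentiable (h : M.IsoOn c a b) :
    (∀ t ∈ Ioo a b, HasDerivAt c (deriv c t) t) ∧ ContinuousOn (deriv c) (Ioo a b) := by
  have key : ∀ t ∈ Ioo a b, HasDerivAt c (deriv c t) t ∧ ContinuousAt (deriv c) t := by
    intro t ht
    obtain ⟨e, hec, hee, hei⟩ := h.exists_continuous (ht.1.trans ht.2).le
    obtain ⟨C, h₀, hh₀, hm⟩ := M.exists_midpoint_bound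
    obtain ⟨b', hb', hb''⟩ := exists_between ht.2
    obtain ⟨v, hvc, hv⟩ := exists_hasDerivAt_of_second_difference hec hh₀ (hm e a b hei) hb''
    have hd : ∀ s ∈ Ioo a b', HasDerivAt c (v s) s := fun s hs =>
      (hv s hs).congr_of_eventuallyEq (eventuallyEq hee ⟨hs.1, hs.2.trans hb''⟩).symm
    have ht' : t ∈ Ioo a b' := ⟨ht.1, hb'⟩
    refine ⟨(hd t ht').differentiableAt.hasDerivAt, ?_⟩
    refine (hvc.continuousAt (isOpen_Ioo.mem_nhds ht')).congr ?_
    filter_upwards [isOpen_Ioo.mem_nhds ht'] with s hs using (hd s hs).deriv.symm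
  exact ⟨fun t ht => (key t ht).1, fun t ht => (key t ht).2.continuousWithinAt⟩

theorem IsoOn.nrm_deriv (h : M.IsoOn c a b) {t : ℝ} (ht : t ∈ Ioo a b) :
    M.nrm (c t) (deriv c t) = 1 := by
  obtain ⟨C, hC, hd⟩ := M.exists_dist_sub_nrm
  have hlo := M.lo_pos
  have h1 := ((h.differentiable.1 t ht).tendsto_slope_zero_right)
  have h2 : Tendsto (fun s : ℝ => M.nrm (c t) (s⁻¹ • (c (t + s) - c t))) (𝓝[>] 0)
      (𝓝 (M.nrm (c t) (deriv c t))) := by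
    have := (M.continuous_nrm_comp (continuous_const (y := c t)) continuous_id).tendsto (deriv c t)
    exact this.comp h1
  refine tendsto_nhds_unique h2 ?_
  refine tendsto_iff_dist_tendsto_zero.2 ?_
  have hz : Tendsto (fun s : ℝ => C / M.lo ^ 2 * s) (𝓝[>] 0) (𝓝 0) := by
    have : Continuous fun s : ℝ => C / M.lo ^ 2 * s := by fun_prop
    simpa using (this.tendsto 0).mono_left nhdsWithin_le_nhds
  refine squeeze_zero' (Eventually.of_forall fun _ => _root_.dist_nonneg) ?_ hz
  have hb : Iio (b - t) ∈ 𝓝 (0 : ℝ) := Iio_mem_nhds (by linarith [ht.2])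
  filter_upwards [self_mem_nhdsWithin, mem_nhdsWithin_of_mem_nhds hb] with s hs hsb
  rw [mem_Ioi] at hs
  rw [mem_Iio] at hsb
  have m1 : t ∈ Icc a b := ⟨ht.1.le, ht.2.le⟩
  have m2 : t + s ∈ Icc a b := ⟨by linarith [ht.1], by linarith⟩
  have n1 : ‖c t - c t‖ ≤ s / M.lo := by rw [sub_self, norm_zero]; positivity
  have n2 : ‖c (t + s) - c t‖ ≤ s / M.lo := by
    have := h.norm_sub_le m2 m1
    rwa [show t + s - t = s by ring, abs_of_nonneg hs.le] at this
  have k := hd (c t) _ _ _ n1 n2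
  rw [h _ m1 _ m2 (by linarith), add_sub_cancel_left] at k
  rw [Real.dist_eq, nrm_smul, abs_of_pos (inv_pos.2 hs), abs_sub_comm]
  have e : 1 - s⁻¹ * M.nrm (c t) (c (t + s) - c t) =
      s⁻¹ * (s - M.nrm (c t) (c (t + s) - c t)) := by field_simp
  rw [e, abs_mul, abs_of_pos (inv_pos.2 hs)]
  calc _ ≤ s⁻¹ * (C * (s / M.lo) ^ 2) := by gcongr
    _ = _ := by field_simp

end TorusMetric

theorem hasDerivAt_integral_line {V : Type*} [NormedAddCommGroup V] [NormedSpace ℝ V]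
    {Φ : V → ℝ} (hΦ : ContDiff ℝ 1 Φ) {z ζ : ℝ → V} (hz : Continuous z) (hζ : Continuous ζ)
    (a b : ℝ) : HasDerivAt (fun ε : ℝ => ∫ s in a..b, Φ (z s + ε • ζ s))
      (∫ s in a..b, fderiv ℝ Φ (z s) (ζ s)) 0 := by
  have hdc : Continuous fun p : ℝ × ℝ => fderiv ℝ Φ (z p.2 + p.1 • ζ p.2) (ζ p.2) := by
    have h1 := hΦ.continuous_fderiv one_ne_zero
    exact (h1.comp (by fun_prop)).clm_apply (by fun_prop)
  have hpc : Continuous fun p : ℝ × ℝ => Φ (z p.2 + p.1 • ζ p.2) :=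
    hΦ.continuous.comp (by fun_prop)
  obtain ⟨K, hK⟩ := ((isCompact_closedBall (0 : ℝ) 1).prod
    (isCompact_uIcc (a := a) (b := b))).exists_bound_of_continuousOn hdc.continuousOn
  have h := intervalIntegral.hasDerivAt_integral_of_dominated_loc_of_deriv_le (𝕜 := ℝ)
    (μ := MeasureTheory.volume) (a := a) (b := b)
    (F := fun ε s => Φ (z s + ε • ζ s))
    (F' := fun ε s => fderiv ℝ Φ (z s + ε • ζ s) (ζ s)) (x₀ := 0) (bound := fun _ => K)
    (Metric.closedBall_mem_nhds 0 one_pos)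
    (Eventually.of_forall fun ε => (hpc.comp (Continuous.prodMk_right ε)).aestronglyMeasurable)
    ((hpc.comp (Continuous.prodMk_right 0)).intervalIntegrable _ _)
    (hdc.comp (Continuous.prodMk_right 0)).aestronglyMeasurable
    (Eventually.of_forall fun s hs ε hε => hK (ε, s) ⟨hε, uIoc_subset_uIcc hs⟩)
    intervalIntegrable_const
    (Eventually.of_forall fun s hs ε hε => by
      have h1 : HasDerivAt (fun ε : ℝ => z s + ε • ζ s) (ζ s) ε := by
        simpa using ((hasDerivAt_id ε).smul_const (ζ s)).const_add (z s)
      exact ((hΦ.differentiable one_ne_zero _).hasFDerivAt).comp_hasDerivAt ε h1)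
  simpa using h.2

theorem eq_zero_of_integral_sq_eq_zero {χ : ℝ → ℝ} (hχ : Continuous χ) {a b : ℝ}
    (h : ∫ s in a..b, χ s * χ s = 0) {t : ℝ} (ht : t ∈ Ioo a b) : χ t = 0 := by
  have hc : Continuous fun s => χ s * χ s := hχ.mul hχ
  have hI : ∀ p q, IntervalIntegrable (fun s => χ s * χ s) MeasureTheory.volume p q :=
    fun p q => hc.intervalIntegrable _ _
  have hz : ∀ s ∈ Ioo a b, ∫ r in a..s, χ r * χ r = 0 := by
    intro s hs
    have h1 := intervalIntegral.integral_add_adjacent_intervals (hI a s) (hI s b)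
    have h2 : 0 ≤ ∫ r in a..s, χ r * χ r :=
      intervalIntegral.integral_nonneg hs.1.le fun _ _ => mul_self_nonneg _
    have h3 : 0 ≤ ∫ r in s..b, χ r * χ r :=
      intervalIntegral.integral_nonneg hs.2.le fun _ _ => mul_self_nonneg _
    linarith
  have h1 : HasDerivAt (fun s => ∫ r in a..s, χ r * χ r) (χ t * χ t) t :=
    intervalIntegral.integral_hasDerivAt_right (hI _ _) (hc.stronglyMeasurableAtFilter _ _)
      hc.continuousAt
  have h2 : HasDerivAt (fun s => ∫ r in a..s, χ r * χ r) 0 t :=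
    (hasDerivAt_const t 0).congr_of_eventuallyEq
      (by filter_upwards [isOpen_Ioo.mem_nhds ht] with s hs using hz s hs)
  exact mul_self_eq_zero.1 (h1.unique h2)

/-- The lemma of du Bois-Reymond. -/
theorem hasDerivAt_of_integral_eq_zero {A B : ℝ → ℝ} (hA : Continuous A) (hB : Continuous B)
    {a b : ℝ} (hab : a < b)
    (h : ∀ χ ψ : ℝ → ℝ, Continuous χ → (∀ s, HasDerivAt ψ (χ s) s) → ψ a = 0 → ψ b = 0 →
      ∫ s in a..b, (A s * ψ s + B s * χ s) = 0) {t : ℝ} (ht : t ∈ Ioo a b) :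
    HasDerivAt B (A t) t := by
  have prim : ∀ f : ℝ → ℝ, Continuous f → ∀ s, HasDerivAt (fun s => ∫ r in a..s, f r) (f s) s :=
    fun f hf s => intervalIntegral.integral_hasDerivAt_right (hf.intervalIntegrable _ _)
      (hf.stronglyMeasurableAtFilter _ _) hf.continuousAt
  set G : ℝ → ℝ := fun s => ∫ r in a..s, A r with hG
  have hGd := prim A hA
  have hGc : Continuous G := continuous_iff_continuousAt.2 fun s => (hGd s).continuousAt
  set m : ℝ := (∫ s in a..b, (B s - G s)) / (b - a) with hm
  set χ : ℝ → ℝ := fun s => B s - G s - m with hχ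
  have hχc : Continuous χ := by fun_prop
  set ψ : ℝ → ℝ := fun s => ∫ r in a..s, χ r with hψ
  have hψd := prim χ hχc
  have hψc : Continuous ψ := continuous_iff_continuousAt.2 fun s => (hψd s).continuousAt
  have hψa : ψ a = 0 := by simp [hψ]
  have hψb : ψ b = 0 := by
    simp only [hψ, hχ]
    have hBG : Continuous fun s => B s - G s := hB.sub hGc
    rw [intervalIntegral.integral_sub (hBG.intervalIntegrable _ _)
      intervalIntegrable_const, intervalIntegral.integral_const, hm, smul_eq_mul]
    have : b - a ≠ 0 := (sub_pos.2 hab).ne'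
    field_simp
    ring
  have h0 := h χ ψ hχc hψd hψa hψb
  have h1 := intervalIntegral.integral_mul_deriv_eq_deriv_mul_of_hasDerivAt (a := a) (b := b)
    (u := ψ) (v := G) (u' := χ) (v' := A) hψc.continuousOn hGc.continuousOn
    (fun s _ => hψd s) (fun s _ => hGd s) (hχc.intervalIntegrable _ _) (hA.intervalIntegrable _ _)
  rw [hψa, hψb] at h1
  have h2 : ∫ s in a..b, χ s * χ s = 0 := by
    have e : ∀ s, χ s * χ s = (A s * ψ s + B s * χ s) - ψ s * A s - χ s * G s - m * χ s := by
      intro s; simp only [hχ]; ring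
    simp_rw [e]
    have hmχ : ∫ s in a..b, m * χ s = 0 := by
      rw [intervalIntegral.integral_const_mul]
      change m * ψ b = 0
      rw [hψb, mul_zero]
    rw [intervalIntegral.integral_sub, intervalIntegral.integral_sub,
      intervalIntegral.integral_sub, h0, h1, hmχ]
    · ring
    all_goals exact Continuous.intervalIntegrable (by fun_prop) _ _
  have h3 : ∀ s ∈ Ioo a b, B s = G s + m := fun s hs => by
    have := eq_zero_of_integral_sq_eq_zero hχc h2 hs
    simp only [hχ] at this
    linarith
  refine ((hGd t).add_const m).congr_of_eventuallyEq ?_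
  filter_upwards [isOpen_Ioo.mem_nhds ht] with s hs using h3 s hs

namespace TorusMetric

variable (M : TorusMetric)

theorem contDiff_one_quad : ContDiff ℝ 1 M.quad := M.contDiff_quad.of_le (by exact_mod_cast le_top)

theorem nrm_le_quad (x v : ℝ × ℝ) : M.nrm x v ≤ (1 + M.quad (x, v)) / 2 := by
  have h := M.nrm_sq x v
  have : M.quad (x, v) = M.g x v v := rfl
  nlinarith [sq_nonneg (M.nrm x v - 1)]

variable {M} {c : ℝ → ℝ × ℝ} {a b : ℝ}

/-- The Euler-Lagrange equation of minimal arcs. -/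
theorem IsoOn.euler_lagrange (h : M.IsoOn c a b) (e : ℝ × ℝ) {t : ℝ} (ht : t ∈ Ioo a b) :
    HasDerivAt (fun s => fderiv ℝ M.quad (c s, deriv c s) (0, e))
      (fderiv ℝ M.quad (c t, deriv c t) (e, 0)) t := by
  obtain ⟨a', ha', hat⟩ := exists_between ht.1
  obtain ⟨b', hbt, hb'⟩ := exists_between ht.2
  have hab : a' ≤ b' := (hat.trans hbt).le
  have hsub : Icc a' b' ⊆ Ioo a b := fun s hs => ⟨ha'.trans_le hs.1, hs.2.trans_lt hb'⟩
  have hcc : ContinuousOn c (Icc a' b') :=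
    h.continuousOn.mono (hsub.trans Ioo_subset_Icc_self)
  have hvc : ContinuousOn (deriv c) (Icc a' b') := h.differentiable.2.mono hsub
  set z : ℝ → (ℝ × ℝ) × (ℝ × ℝ) := fun s =>
    (c (projIcc a' b' hab s), deriv c (projIcc a' b' hab s)) with hz
  have hzc : Continuous z :=
    ((continuousOn_iff_continuous_domRestrict.1 hcc).comp continuous_projIcc).prodMk
      ((continuousOn_iff_continuous_domRestrict.1 hvc).comp continuous_projIcc)
  have hze : ∀ s ∈ Icc a' b', z s = (c s, deriv c s) := fun s hs => by
    simp only [hz]; rw [projIcc_of_mem hab hs]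
  have hfc := M.contDiff_one_quad.continuous_fderiv one_ne_zero
  have key : HasDerivAt (fun s => fderiv ℝ M.quad (z s) (0, e)) (fderiv ℝ M.quad (z t) (e, 0)) t := by
    refine hasDerivAt_of_integral_eq_zero
      (A := fun s => fderiv ℝ M.quad (z s) (e, 0)) (B := fun s => fderiv ℝ M.quad (z s) (0, e))
      ((hfc.comp hzc).clm_apply continuous_const) ((hfc.comp hzc).clm_apply continuous_const)
      (hat.trans hbt) (fun χ ψ hχ hψ hψa hψb => ?_) ⟨hat, hbt⟩
    have hψc : Continuous ψ := continuous_iff_continuousAt.2 fun s => (hψ s).continuousAt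
    set ζ : ℝ → (ℝ × ℝ) × (ℝ × ℝ) := fun s => (ψ s • e, χ s • e) with hζ
    have hζc : Continuous ζ := by fun_prop
    have hJ := hasDerivAt_integral_line M.contDiff_one_quad hzc hζc a' b'
    have hlow : ∀ ε : ℝ, b' - a' ≤ ∫ s in a'..b', M.quad (z s + ε • ζ s) := by
      intro ε
      have h1 := M.dist_le_integral (γ := fun s => c s + ε • ψ s • e)
        (v := fun s => deriv c s + ε • χ s • e) hab
        (hvc.add (by fun_prop)) (hcc.add (by fun_prop))
        (fun s hs => (h.differentiable.1 s (hsub ⟨hs.1.le, hs.2.le⟩)).add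
          (((hψ s).smul_const e).const_smul ε))
      simp only [hψa, hψb, zero_smul, smul_zero, add_zero] at h1
      rw [h a' ⟨ha'.le, hab.trans hb'.le⟩ b' ⟨ha'.le.trans hab, hb'.le⟩ hab] at h1
      have hqc : Continuous fun s => M.quad (z s + ε • ζ s) :=
        M.contDiff_quad.continuous.comp (by fun_prop)
      have h2 : ∫ s in a'..b', M.nrm (c s + ε • ψ s • e) (deriv c s + ε • χ s • e) ≤
          ∫ s in a'..b', (1 + M.quad (z s + ε • ζ s)) / 2 := by
        refine intervalIntegral.integral_mono_on hab ?_
          (Continuous.intervalIntegrable (by fun_prop) _ _) fun s hs => ?_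
        · refine ContinuousOn.intervalIntegrable ?_
          rw [uIcc_of_le hab]
          exact M.continuousOn_nrm_comp (hcc.add (by fun_prop)) (hvc.add (by fun_prop))
        · refine (M.nrm_le_quad _ _).trans (le_of_eq ?_)
          rw [hze s hs]; rfl
      have h3 : ∫ s in a'..b', (1 + M.quad (z s + ε • ζ s)) / 2 =
          ((b' - a') + ∫ s in a'..b', M.quad (z s + ε • ζ s)) / 2 := by
        rw [intervalIntegral.integral_div, intervalIntegral.integral_add
          intervalIntegrable_const (hqc.intervalIntegrable _ _)]
        simp
      linarith
    have h0 : ∫ s in a'..b', M.quad (z s + (0 : ℝ) • ζ s) = b' - a' := by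
      have : ∫ s in a'..b', M.quad (z s + (0 : ℝ) • ζ s) = ∫ s in a'..b', (1 : ℝ) := by
        refine intervalIntegral.integral_congr fun s hs => ?_
        rw [uIcc_of_le hab] at hs
        simp only [zero_smul, add_zero]
        rw [hze s hs]
        change M.g (c s) (deriv c s) (deriv c s) = 1
        rw [← nrm_sq, h.nrm_deriv (hsub hs), one_pow]
      simpa using this
    have hmin : IsLocalMin (fun ε : ℝ => ∫ s in a'..b', M.quad (z s + ε • ζ s)) 0 :=
      Eventually.of_forall fun ε => by simp only [h0]; exact hlow ε
    rw [← hmin.hasDerivAt_eq_zero hJ]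
    refine intervalIntegral.integral_congr fun s _ => ?_
    have : ζ s = ψ s • ((e, 0) : (ℝ × ℝ) × (ℝ × ℝ)) + χ s • ((0, e) : (ℝ × ℝ) × (ℝ × ℝ)) := by
      simp [hζ]
    rw [this, map_add, map_smul, map_smul, smul_eq_mul, smul_eq_mul]; ring
  rw [hze t ⟨hat.le, hbt.le⟩] at key
  refine key.congr_of_eventuallyEq ?_
  filter_upwards [isOpen_Ioo.mem_nhds (⟨hat, hbt⟩ : t ∈ Ioo a' b')] with s hs
  rw [hze s ⟨hs.1.le, hs.2.le⟩]

end TorusMetric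

theorem fderiv_periodic {F : Type*} [NormedAddCommGroup F] [NormedSpace ℝ F]
    {φ : (ℝ × ℝ) × (ℝ × ℝ) → F} {k : ℤ × ℤ} (hp : ∀ x v, φ (x + lat k, v) = φ (x, v))
    (x v : ℝ × ℝ) : fderiv ℝ φ (x + lat k, v) = fderiv ℝ φ (x, v) := by
  have h : (fun z : (ℝ × ℝ) × (ℝ × ℝ) => φ (z + (lat k, 0))) = φ := by
    funext z
    have e : z + (lat k, 0) = (z.1 + lat k, z.2) := Prod.ext rfl (add_zero _)
    rw [e, hp]
  have h2 := fderiv_comp_add_right (𝕜 := ℝ) (f := φ) (x := (x, v)) (lat k, (0 : ℝ × ℝ))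
  rw [h] at h2
  simpa using h2.symm

namespace TorusMetric

variable (M : TorusMetric)

theorem contDiff_g_const (e f : ℝ × ℝ) : ContDiff ℝ (⊤ : ℕ∞) fun x => M.g x e f :=
  M.smooth.comp ((contDiff_id (E := ℝ × ℝ)).prodMk (contDiff_const (c := (e, f))))

theorem g_eq (x v w : ℝ × ℝ) : M.g x v w = v.1 * w.1 * M.g x (1, 0) (1, 0) +
    (v.1 * w.2 + v.2 * w.1) * M.g x (1, 0) (0, 1) + v.2 * w.2 * M.g x (0, 1) (0, 1) := by
  have e : ∀ v : ℝ × ℝ, v = v.1 • ((1, 0) : ℝ × ℝ) + v.2 • ((0, 1) : ℝ × ℝ) := fun v => by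
    ext <;> simp
  rw [e v, e w]
  simp only [g_add_left, g_add_right, g_smul_left, g_smul_right, M.symm x (0, 1) (1, 0)]
  simp
  ring

/-- The Gram determinant. -/
def gram (x : ℝ × ℝ) : ℝ :=
  M.g x (1, 0) (1, 0) * M.g x (0, 1) (0, 1) - M.g x (1, 0) (0, 1) ^ 2

theorem gram_pos (x : ℝ × ℝ) : 0 < M.gram x := by
  have h1 : 0 < M.g x (1, 0) (1, 0) := M.posdef x _ (by simp)
  have h2 : 0 < M.g x (-M.g x (1, 0) (0, 1), M.g x (1, 0) (1, 0))
      (-M.g x (1, 0) (0, 1), M.g x (1, 0) (1, 0)) :=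
    M.posdef x _ (fun h => h1.ne' (by simpa using congrArg Prod.snd h))
  rw [g_eq] at h2
  simp only at h2
  have : 0 < M.g x (1, 0) (1, 0) * M.gram x := by
    rw [gram]; linarith
  exact pos_of_mul_pos_right this h1.le

/-- The inverse Legendre transformation. -/
def legInv (z : (ℝ × ℝ) × (ℝ × ℝ)) : ℝ × ℝ :=
  (2 * M.gram z.1)⁻¹ • (M.g z.1 (0, 1) (0, 1) * z.2.1 - M.g z.1 (1, 0) (0, 1) * z.2.2,
    M.g z.1 (1, 0) (1, 0) * z.2.2 - M.g z.1 (1, 0) (0, 1) * z.2.1)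

/-- The Legendre transformation. -/
def leg (z : (ℝ × ℝ) × (ℝ × ℝ)) : ℝ × ℝ :=
  (fderiv ℝ M.quad z (0, (1, 0)), fderiv ℝ M.quad z (0, (0, 1)))

/-- The derivative of the energy density in the base point. -/
def frc (z : (ℝ × ℝ) × (ℝ × ℝ)) : ℝ × ℝ :=
  (fderiv ℝ M.quad z ((1, 0), 0), fderiv ℝ M.quad z ((0, 1), 0))

theorem contDiff_legInv : ContDiff ℝ (⊤ : ℕ∞) M.legInv := by
  have h : ∀ e f, ContDiff ℝ (⊤ : ℕ∞) fun z : (ℝ × ℝ) × (ℝ × ℝ) => M.g z.1 e f := fun e f =>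
    (M.contDiff_g_const e f).comp contDiff_fst
  have h1 := h (1, 0) (1, 0)
  have h2 := h (1, 0) (0, 1)
  have h3 := h (0, 1) (0, 1)
  have hg : ContDiff ℝ (⊤ : ℕ∞) fun z : (ℝ × ℝ) × (ℝ × ℝ) => 2 * M.gram z.1 := by
    simp only [gram]; fun_prop
  refine (hg.inv fun z => (mul_pos two_pos (M.gram_pos _)).ne').smul (ContDiff.prodMk ?_ ?_)
  · fun_prop
  · fun_prop

theorem contDiff_fderiv_quad (e : (ℝ × ℝ) × (ℝ × ℝ)) :
    ContDiff ℝ (⊤ : ℕ∞) fun z => fderiv ℝ M.quad z e :=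
  (M.contDiff_quad.fderiv_right (m := (⊤ : ℕ∞)) (by exact_mod_cast le_top)).clm_apply contDiff_const

theorem contDiff_leg : ContDiff ℝ (⊤ : ℕ∞) M.leg :=
  (M.contDiff_fderiv_quad _).prodMk (M.contDiff_fderiv_quad _)

theorem contDiff_frc : ContDiff ℝ (⊤ : ℕ∞) M.frc :=
  (M.contDiff_fderiv_quad _).prodMk (M.contDiff_fderiv_quad _)

theorem fderiv_quad_snd (x w e : ℝ × ℝ) : fderiv ℝ M.quad (x, w) (0, e) = 2 * M.g x w e := by
  have h1 : HasDerivAt (fun t : ℝ => ((x, w) + t • (0, e) : (ℝ × ℝ) × (ℝ × ℝ))) (0, e) 0 := by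
    simpa using ((hasDerivAt_id (0 : ℝ)).smul_const ((0, e) : (ℝ × ℝ) × (ℝ × ℝ))).const_add (x, w)
  have h2 : HasDerivAt (fun t : ℝ => M.quad ((x, w) + t • (0, e))) (fderiv ℝ M.quad (x, w) (0, e))
      0 := by
    have hf : HasFDerivAt M.quad (fderiv ℝ M.quad (x, w))
        ((x, w) + (0 : ℝ) • ((0, e) : (ℝ × ℝ) × (ℝ × ℝ))) := by
      simpa using (M.contDiff_one_quad.differentiable one_ne_zero (x, w)).hasFDerivAt
    exact hf.comp_hasDerivAt 0 h1
  have h3 : (fun t : ℝ => M.quad ((x, w) + t • (0, e))) =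
      fun t => M.g x w w + t * (2 * M.g x w e) + t ^ 2 * M.g x e e := by
    funext t
    simp only [quad, Prod.smul_mk, smul_zero, Prod.mk_add_mk, add_zero, g_add_left, g_add_right,
      g_smul_left, g_smul_right, M.symm x e w]
    ring
  rw [h3] at h2
  have h4 : HasDerivAt (fun t : ℝ => M.g x w w + t * (2 * M.g x w e) + t ^ 2 * M.g x e e)
      (2 * M.g x w e) 0 := by
    have a1 := ((hasDerivAt_id (0 : ℝ)).mul_const (2 * M.g x w e)).const_add (M.g x w w)
    have a2 := ((hasDerivAt_id (0 : ℝ)).pow 2).mul_const (M.g x e e)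
    exact (a1.add a2).congr_deriv (by simp)
  exact h2.unique h4

theorem legInv_leg (x w : ℝ × ℝ) : M.legInv (x, M.leg (x, w)) = w := by
  have h := M.gram_pos x
  have h1 := M.g_eq x w (1, 0)
  have h2 := M.g_eq x w (0, 1)
  simp only [legInv, leg, fderiv_quad_snd]
  rw [h1, h2]
  ext
  · simp only [Prod.smul_fst, smul_eq_mul]
    rw [inv_mul_eq_iff_eq_mul₀ (by positivity), gram]; ring
  · simp only [Prod.smul_snd, smul_eq_mul]
    rw [inv_mul_eq_iff_eq_mul₀ (by positivity), gram]; ring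

/-- The right hand side of the geodesic equation. -/
def geo (z : (ℝ × ℝ) × (ℝ × ℝ)) : ℝ × ℝ := fderiv ℝ M.legInv (z.1, M.leg z) (z.2, M.frc z)

theorem contDiff_geo : ContDiff ℝ (⊤ : ℕ∞) M.geo := by
  have h1 : ContDiff ℝ (⊤ : ℕ∞) (fderiv ℝ M.legInv) :=
    M.contDiff_legInv.fderiv_right (m := (⊤ : ℕ∞)) (by exact_mod_cast le_top)
  exact (h1.comp (contDiff_fst.prodMk M.contDiff_leg)).clm_apply
    (contDiff_snd.prodMk M.contDiff_frc)

theorem geo_periodic (k : ℤ × ℤ) (x v : ℝ × ℝ) : M.geo (x + lat k, v) = M.geo (x, v) := by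
  have hq : ∀ x v, M.quad (x + lat k, v) = M.quad (x, v) := fun x v => M.periodic k x v v
  have hl : ∀ x v, M.legInv (x + lat k, v) = M.legInv (x, v) := fun x v => by
    simp only [legInv, gram, M.periodic]
  simp only [geo, leg, frc, fderiv_periodic hq, fderiv_periodic hl]

/-- A bound for the velocities of unit speed curves. -/
theorem norm_le_of_nrm_eq_one {x v : ℝ × ℝ} (h : M.nrm x v = 1) : ‖v‖ ≤ 1 / M.lo := by
  rw [le_div_iff₀ M.lo_pos, ← h, mul_comm]; exact M.lo_le_nrm x v

theorem exists_geo_lip : ∃ K : NNReal, LipschitzOnWith K M.geo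
    (univ ×ˢ Metric.closedBall (0 : ℝ × ℝ) (1 / M.lo)) :=
  periodic_lip M.geo (M.contDiff_geo.of_le (by exact_mod_cast le_top)) M.geo_periodic _

variable {M} {c : ℝ → ℝ × ℝ} {a b : ℝ}

theorem IsoOn.geodesic_eq (h : M.IsoOn c a b) {t : ℝ} (ht : t ∈ Ioo a b) :
    HasDerivAt (deriv c) (M.geo (c t, deriv c t)) t := by
  have h1 : HasDerivAt (fun s => (c s, M.leg (c s, deriv c s)))
      (deriv c t, M.frc (c t, deriv c t)) t :=
    (h.differentiable.1 t ht).prodMk ((h.euler_lagrange (1, 0) ht).prodMk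
      (h.euler_lagrange (0, 1) ht))
  have h2 := ((M.contDiff_legInv.differentiable (by simp)
    (c t, M.leg (c t, deriv c t))).hasFDerivAt).comp_hasDerivAt t h1
  refine h2.congr_of_eventuallyEq (Eventually.of_forall fun s => ?_)
  exact (M.legInv_leg (c s) (deriv c s)).symm

theorem IsoOn.deriv_mem (h : M.IsoOn c a b) {t : ℝ} (ht : t ∈ Ioo a b) :
    (c t, deriv c t) ∈ (univ : Set (ℝ × ℝ)) ×ˢ Metric.closedBall (0 : ℝ × ℝ) (1 / M.lo) :=
  ⟨mem_univ _, mem_closedBall_zero_iff.2 (M.norm_le_of_nrm_eq_one (h.nrm_deriv ht))⟩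

theorem IsoOn.eq_of_deriv_eq (h : M.IsoOn c a b) {e : ℝ → ℝ × ℝ} (he : M.IsoOn e a b) {t : ℝ}
    (ht : t ∈ Ioo a b) (h0 : c t = e t) (h1 : deriv c t = deriv e t) :
    ∀ s ∈ Icc a b, c s = e s := by
  obtain ⟨K, hK⟩ := M.exists_geo_lip
  have hv : LipschitzOnWith (max 1 K) (fun z : (ℝ × ℝ) × (ℝ × ℝ) => (z.2, M.geo z))
      (univ ×ˢ Metric.closedBall (0 : ℝ × ℝ) (1 / M.lo)) :=
    (LipschitzWith.prod_snd.lipschitzOnWith).prodMk hK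
  have hu := ODE_solution_unique_of_mem_Ioo (v := fun _ z => (z.2, M.geo z)) (K := max 1 K)
    (s := fun _ => univ ×ˢ Metric.closedBall (0 : ℝ × ℝ) (1 / M.lo))
    (f := fun s => (c s, deriv c s)) (g := fun s => (e s, deriv e s))
    (fun _ _ => hv) ht
    (fun s hs => ⟨(h.differentiable.1 s hs).prodMk (h.geodesic_eq hs), h.deriv_mem hs⟩)
    (fun s hs => ⟨(he.differentiable.1 s hs).prodMk (he.geodesic_eq hs), he.deriv_mem hs⟩)
    (by simp only [h0, h1])
  have hab : a < b := ht.1.trans ht.2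
  have hcl : EqOn c e (closure (Ioo a b)) := by
    refine Set.EqOn.of_subset_closure (s := Ioo a b) (fun s hs => congrArg Prod.fst (hu hs)) ?_ ?_
      subset_closure subset_rfl
    · rw [closure_Ioo hab.ne]; exact h.continuousOn
    · rw [closure_Ioo hab.ne]; exact he.continuousOn
  rw [closure_Ioo hab.ne] at hcl
  exact hcl

theorem IsoOn.exists_deriv_comp_eq_zero {f f' : ℝ → ℝ} {l : ℝ} (hl : 0 < l)
    (hc : ContinuousOn f (Icc 0 l)) (hd : ∀ t ∈ Ioo 0 l, HasDerivAt f (f' t) t) (h0 : f 0 = 0)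
    (h1 : f l = 0) : ∃ ξ ∈ Ioo 0 l, f' ξ = 0 := by
  obtain ⟨ξ, hξ, h⟩ := exists_hasDerivAt_eq_slope f f' hl hc hd
  exact ⟨ξ, hξ, by rw [h, h0, h1]; simp⟩

variable (M) in
/-- Short minimal arcs are determined by their endpoints. -/
theorem exists_unique_radius : ∃ ρ > 0, ∀ (c e : ℝ → ℝ × ℝ) (l : ℝ), l ≤ ρ → M.IsoOn c 0 l →
    M.IsoOn e 0 l → c 0 = e 0 → c l = e l → ∀ t ∈ Icc 0 l, c t = e t := by
  obtain ⟨K, hK⟩ := M.exists_geo_lip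
  have hlo := M.lo_pos
  refine ⟨min 1 (1 / (2 * (K + 1))), by positivity, fun c e l hl hc he h0 h1 t ht => ?_⟩
  rcases ht.1.eq_or_lt with ht0 | ht0
  · rw [← ht0, h0]
  have hl0 : 0 < l := ht0.trans_le ht.2
  have hl1 : l ≤ 1 := hl.trans (min_le_left _ _)
  have hlK : K * l ≤ 1 / 2 := by
    have := hl.trans (min_le_right _ _)
    rw [le_div_iff₀ (by positivity)] at this
    nlinarith [K.2]
  set Δ : ℝ → ℝ × ℝ := fun t => c t - e t with hΔ
  set Δ' : ℝ → ℝ × ℝ := fun t => deriv c t - deriv e t with hΔ'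
  set Δ'' : ℝ → ℝ × ℝ := fun t => M.geo (c t, deriv c t) - M.geo (e t, deriv e t) with hΔ''
  have hΔc : ContinuousOn Δ (Icc 0 l) := hc.continuousOn.sub he.continuousOn
  have hd1 : ∀ t ∈ Ioo 0 l, HasDerivAt Δ (Δ' t) t := fun t ht =>
    (hc.differentiable.1 t ht).sub (he.differentiable.1 t ht)
  have hd2 : ∀ t ∈ Ioo 0 l, HasDerivAt Δ' (Δ'' t) t := fun t ht =>
    (hc.geodesic_eq ht).sub (he.geodesic_eq ht)
  have hb : ∀ t ∈ Ioo 0 l, ‖Δ'' t‖ ≤ K * max ‖Δ t‖ ‖Δ' t‖ := fun t ht => by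
    have := hK.norm_sub_le (hc.deriv_mem ht) (he.deriv_mem ht)
    exact this
  have z0 : Δ 0 = 0 := sub_eq_zero.2 h0
  have zl : Δ l = 0 := sub_eq_zero.2 h1
  have comp : ∀ (L : (ℝ × ℝ) →L[ℝ] ℝ), (∀ v, ‖L v‖ ≤ ‖v‖) → ∀ S : ℝ,
      (∀ t ∈ Ioo 0 l, ‖Δ' t‖ ≤ S) → ∀ t ∈ Ioo 0 l, ‖L (Δ t)‖ ≤ S := by
    intro L hL S hS t ht
    have hsub : Icc 0 t ⊆ Icc 0 l := Icc_subset_Icc_right ht.2.le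
    obtain ⟨ξ, hξ, h⟩ := exists_hasDerivAt_eq_slope (fun t => L (Δ t)) (fun t => L (Δ' t)) ht.1
      (L.continuous.comp_continuousOn (hΔc.mono hsub))
      (fun s hs => L.hasFDerivAt.comp_hasDerivAt s (hd1 s ⟨hs.1, hs.2.trans ht.2⟩))
    rw [z0, map_zero, sub_zero, sub_zero, eq_div_iff ht.1.ne'] at h
    rw [← h, norm_mul, Real.norm_of_nonneg ht.1.le]
    have h5 := (hL _).trans (hS ξ ⟨hξ.1, hξ.2.trans ht.2⟩)
    have h6 : t ≤ 1 := ht.2.le.trans hl1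
    nlinarith [norm_nonneg (L (Δ' ξ)), ht.1]
  have comp' : ∀ (L : (ℝ × ℝ) →L[ℝ] ℝ), (∀ v, ‖L v‖ ≤ ‖v‖) → ∀ S : ℝ,
      (∀ t ∈ Ioo 0 l, ‖Δ'' t‖ ≤ S) → ∀ t ∈ Ioo 0 l, ‖L (Δ' t)‖ ≤ S * l := by
    intro L hL S hS t ht
    obtain ⟨ξ, hξ, h⟩ := IsoOn.exists_deriv_comp_eq_zero (f := fun t => L (Δ t))
      (f' := fun t => L (Δ' t)) hl0 (L.continuous.comp_continuousOn hΔc)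
      (fun s hs => L.hasFDerivAt.comp_hasDerivAt s (hd1 s hs)) (by simp [z0]) (by simp [zl])
    have h5 := (convex_Ioo 0 l).norm_image_sub_le_of_norm_hasDerivWithin_le
      (f := fun t => L (Δ' t)) (f' := fun t => L (Δ'' t)) (C := S)
      (fun s hs => (L.hasFDerivAt.comp_hasDerivAt s (hd2 s hs)).hasDerivWithinAt)
      (fun s hs => (hL _).trans (hS s hs)) hξ ht
    simp only [h, sub_zero] at h5
    refine h5.trans ?_
    have hS0 : 0 ≤ S := (norm_nonneg _).trans (hS t ht)
    gcongr
    rw [Real.norm_eq_abs, abs_le]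
    constructor <;> linarith [ht.1, ht.2, hξ.1, hξ.2]
  have hfst : ∀ v : ℝ × ℝ, ‖ContinuousLinearMap.fst ℝ ℝ ℝ v‖ ≤ ‖v‖ := fun v => norm_fst_le v
  have hsnd : ∀ v : ℝ × ℝ, ‖ContinuousLinearMap.snd ℝ ℝ ℝ v‖ ≤ ‖v‖ := fun v => norm_snd_le v
  have hΔS : ∀ S : ℝ, (∀ t ∈ Ioo 0 l, ‖Δ' t‖ ≤ S) → ∀ t ∈ Ioo 0 l, ‖Δ t‖ ≤ S := fun S hS t ht =>
    max_le (comp _ hfst S hS t ht) (comp _ hsnd S hS t ht)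
  have half : ∀ S : ℝ, (∀ t ∈ Ioo 0 l, ‖Δ' t‖ ≤ S) → ∀ t ∈ Ioo 0 l, ‖Δ' t‖ ≤ S / 2 := by
    intro S hS t ht
    have hS0 : 0 ≤ S := (norm_nonneg _).trans (hS t ht)
    have h2 : ∀ t ∈ Ioo 0 l, ‖Δ'' t‖ ≤ K * S := fun s hs => (hb s hs).trans
      (mul_le_mul_of_nonneg_left (max_le (hΔS S hS s hs) (hS s hs)) K.2)
    have h3 : K * S * l ≤ S / 2 := by nlinarith
    exact (max_le (comp' _ hfst _ h2 t ht) (comp' _ hsnd _ h2 t ht)).trans h3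
  have iter : ∀ n : ℕ, ∀ t ∈ Ioo 0 l, ‖Δ' t‖ ≤ 2 / M.lo * (1 / 2) ^ n := by
    intro n
    induction n with
    | zero =>
      intro t ht
      have a1 := M.norm_le_of_nrm_eq_one (hc.nrm_deriv ht)
      have a2 := M.norm_le_of_nrm_eq_one (he.nrm_deriv ht)
      refine (norm_sub_le _ _).trans ?_
      rw [pow_zero, mul_one]
      have : 2 / M.lo = 1 / M.lo + 1 / M.lo := by ring
      linarith
    | succ n ih =>
      intro t ht
      have := half _ ih t ht
      rw [pow_succ]
      linarith
  rcases ht.2.eq_or_lt with htl | htl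
  · rw [htl, h1]
  have hlim : Tendsto (fun n : ℕ => 2 / M.lo * (1 / 2 : ℝ) ^ n) atTop (𝓝 0) := by
    simpa using (tendsto_pow_atTop_nhds_zero_of_lt_one (r := (1 / 2 : ℝ)) (by norm_num)
      (by norm_num)).const_mul (2 / M.lo)
  have hz : ‖Δ t‖ ≤ 0 := ge_of_tendsto' hlim fun n => hΔS _ (iter n) t ⟨ht0, htl⟩
  exact sub_eq_zero.1 (norm_le_zero_iff.1 hz)

end TorusMetric

/-- The height of a point above the line spanned by `τ`. -/
def ht (τ : ℤ × ℤ) (q : ℝ × ℝ) : ℝ := τ.1 * q.2 - τ.2 * q.1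

/-- The progress of a point in the direction of `τ`. -/
def prog (τ : ℤ × ℤ) (q : ℝ × ℝ) : ℝ := τ.1 * q.1 + τ.2 * q.2

theorem ht_add (τ : ℤ × ℤ) (p q : ℝ × ℝ) : ht τ (p + q) = ht τ p + ht τ q := by
  simp only [ht, Prod.fst_add, Prod.snd_add]; ring

theorem ht_smul (τ : ℤ × ℤ) (r : ℝ) (q : ℝ × ℝ) : ht τ (r • q) = r * ht τ q := by
  simp only [ht, Prod.smul_fst, Prod.smul_snd, smul_eq_mul]; ring

theorem ht_lat_self (τ : ℤ × ℤ) : ht τ (lat τ) = 0 := by simp only [ht, lat]; ring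

theorem ht_neg (τ : ℤ × ℤ) (q : ℝ × ℝ) : ht (-τ) q = -ht τ q := by
  simp only [ht, Prod.fst_neg, Prod.snd_neg, Int.cast_neg]; ring

theorem continuous_ht (τ : ℤ × ℤ) : Continuous (ht τ) := by unfold ht; fun_prop

theorem continuous_prog (τ : ℤ × ℤ) : Continuous (prog τ) := by unfold prog; fun_prop

theorem prog_add (τ : ℤ × ℤ) (p q : ℝ × ℝ) : prog τ (p + q) = prog τ p + prog τ q := by
  simp only [prog, Prod.fst_add, Prod.snd_add]; ring

theorem prog_smul (τ : ℤ × ℤ) (r : ℝ) (q : ℝ × ℝ) : prog τ (r • q) = r * prog τ q := by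
  simp only [prog, Prod.smul_fst, Prod.smul_snd, smul_eq_mul]; ring

theorem prog_lat_self_pos {τ : ℤ × ℤ} (hτ : τ ≠ 0) : 0 < prog τ (lat τ) := by
  simp only [prog, lat]
  rcases eq_or_ne τ.1 0 with h | h
  · have h2 : τ.2 ≠ 0 := fun h2 => hτ (Prod.ext h h2)
    have : (0 : ℝ) < (τ.2 : ℝ) ^ 2 := by positivity
    nlinarith [sq_nonneg (τ.1 : ℝ)]
  · have : (0 : ℝ) < (τ.1 : ℝ) ^ 2 := by positivity
    nlinarith [sq_nonneg (τ.2 : ℝ)]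

theorem add_int_mul_period {f : ℝ → ℝ × ℝ} {T : ℝ} {v : ℝ × ℝ} (h : ∀ t, f (t + T) = f t + v)
    (n : ℤ) (t : ℝ) : f (t + n * T) = f t + (n : ℝ) • v := by
  induction n using Int.induction_on with
  | zero => simp
  | succ n ih =>
    have e : t + ((n : ℤ) + 1 : ℤ) * T = t + (n : ℤ) * T + T := by push_cast; ring
    rw [e, h, ih]
    push_cast
    rw [add_smul, one_smul, add_assoc]
  | pred n ih =>
    have e : t + (-(n : ℤ) : ℤ) * T = t + (-(n : ℤ) - 1 : ℤ) * T + T := by push_cast; ring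
    rw [e, h] at ih
    rw [eq_sub_of_add_eq ih]
    push_cast
    rw [sub_smul, one_smul, add_sub_assoc]

theorem exists_int_of_cos_pos {A : ℝ → ℝ} (hA : Continuous A) (h : ∀ t, 0 < Real.cos (A t)) :
    ∃ m : ℤ, ∀ t, |A t - m * (2 * Real.pi)| < Real.pi / 2 := by
  have hpi := Real.pi_pos
  obtain ⟨m, hm⟩ : ∃ m : ℤ, |A 0 - m * (2 * Real.pi)| < Real.pi / 2 := by
    refine ⟨round (A 0 / (2 * Real.pi)), ?_⟩
    set m := round (A 0 / (2 * Real.pi)) with hmd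
    have h1 : |A 0 / (2 * Real.pi) - m| ≤ 1 / 2 := abs_sub_round _
    have h2 : |A 0 - m * (2 * Real.pi)| ≤ Real.pi := by
      have : A 0 - m * (2 * Real.pi) = (A 0 / (2 * Real.pi) - m) * (2 * Real.pi) := by field_simp
      rw [this, abs_mul, abs_of_pos (by positivity : 0 < 2 * Real.pi)]
      nlinarith
    by_contra! h3
    have h4 : Real.cos |A 0 - m * (2 * Real.pi)| ≤ 0 :=
      Real.cos_nonpos_of_pi_div_two_le_of_le h3 (by linarith)
    rw [Real.cos_abs, Real.cos_sub_int_mul_two_pi] at h4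
    exact absurd (h 0) (not_lt.2 h4)
  refine ⟨m, fun t => ?_⟩
  set B : ℝ → ℝ := fun t => |A t - m * (2 * Real.pi)| with hB
  have hBc : Continuous B := (hA.sub continuous_const).abs
  by_contra! h3
  have h5 : Real.pi / 2 ∈ uIcc (B 0) (B t) := mem_uIcc.2 (Or.inl ⟨hm.le, h3⟩)
  obtain ⟨s, -, hs⟩ := intermediate_value_uIcc hBc.continuousOn h5
  have h6 : Real.cos (A s) = 0 := by
    rw [← Real.cos_sub_int_mul_two_pi _ m, ← Real.cos_abs]
    exact (congrArg Real.cos hs).trans Real.cos_pi_div_two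
  exact (h s).ne' h6

/-- A nonvanishing function on the plane cannot wind once around the boundary of a rectangle. -/
theorem exists_zero_of_boundary_signs {G : ℝ × ℝ → ℂ} (hG : Continuous G) {N : ℝ}
    (h0 : ∀ t, (G (0, t)).im < 0) (h1 : ∀ t, 0 < (G (1, t)).im)
    (hN : ∀ s, (G (s, N)).re < 0) (hN' : ∀ s, 0 < (G (s, -N)).re) : ∃ z, G z = 0 := by
  by_contra! hz
  have hz0 : G 0 ≠ 0 := hz 0
  obtain ⟨g, ⟨-, hg⟩, -⟩ := Complex.isCoveringMapOn_exp.existsUnique_continuousMap_lifts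
    ⟨G, hG⟩ (a₀ := (0 : ℝ × ℝ)) (Complex.exp_log hz0) hz
  have hg' : ∀ z, Complex.exp (g z) = G z := fun z => congrFun hg z
  have him : ∀ z, (G z).im = Real.exp (g z).re * Real.sin (g z).im := fun z => by
    rw [← hg' z, Complex.exp_im]
  have hre : ∀ z, (G z).re = Real.exp (g z).re * Real.cos (g z).im := fun z => by
    rw [← hg' z, Complex.exp_re]
  have hgc : Continuous fun z => (g z).im := Complex.continuous_im.comp g.continuous
  obtain ⟨m1, a1⟩ := exists_int_of_cos_pos (A := fun t => (g (0, t)).im + Real.pi / 2)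
    ((hgc.comp (by fun_prop : Continuous fun t : ℝ => ((0 : ℝ), t))).add_const _) fun t => by
      have := h0 t
      rw [him] at this
      simp only [Real.cos_add_pi_div_two]
      have := neg_of_mul_neg_right this (Real.exp_pos _).le
      linarith
  obtain ⟨m2, a2⟩ := exists_int_of_cos_pos (A := fun t => (g (1, t)).im - Real.pi / 2)
    ((hgc.comp (by fun_prop : Continuous fun t : ℝ => ((1 : ℝ), t))).sub continuous_const)
    fun t => by
      have := h1 t
      rw [him] at this
      simp only [Real.cos_sub_pi_div_two]
      exact pos_of_mul_pos_right this (Real.exp_pos _).le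
  obtain ⟨m3, a3⟩ := exists_int_of_cos_pos (A := fun s => (g (s, N)).im - Real.pi)
    ((hgc.comp (by fun_prop : Continuous fun s : ℝ => (s, N))).sub continuous_const)
    fun s => by
      have := hN s
      rw [hre] at this
      simp only [Real.cos_sub_pi]
      have := neg_of_mul_neg_right this (Real.exp_pos _).le
      linarith
  obtain ⟨m4, a4⟩ := exists_int_of_cos_pos (A := fun s => (g (s, -N)).im)
    (hgc.comp (by fun_prop : Continuous fun s : ℝ => (s, -N)))
    fun s => by
      have := hN' s
      rw [hre] at this
      exact pos_of_mul_pos_right this (Real.exp_pos _).le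
  have hpi := Real.pi_pos
  have key : ∀ (x : ℤ) (y : ℝ), |y| < Real.pi → (x : ℝ) * (2 * Real.pi) = y + Real.pi / 2 ∨
      (x : ℝ) * (2 * Real.pi) = y - Real.pi / 2 → x = 0 := by
    intro x y hy hxy
    rw [abs_lt] at hy
    have u1 : (x : ℝ) < 1 := by
      rcases hxy with h | h <;> nlinarith
    have u2 : (-1 : ℝ) < x := by
      rcases hxy with h | h <;> nlinarith
    have u3 : x < 1 := by exact_mod_cast u1
    have u4 : -1 < x := by exact_mod_cast u2
    omega
  have tri : ∀ a b : ℝ, |a| < Real.pi / 2 → |b| < Real.pi / 2 → |a - b| < Real.pi :=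
    fun a b ha hb => by linarith [abs_sub a b]
  have b1 := a1 N
  have b2 := a1 (-N)
  have b3 := a2 N
  have b4 := a2 (-N)
  have c1 := a3 0
  have c2 := a3 1
  have c3 := a4 0
  have c4 := a4 1
  have e1 := key (m1 - m4) _ (tri _ _ c3 b2) (Or.inl (by push_cast; ring))
  have e2 := key (m2 - m4) _ (tri _ _ c4 b4) (Or.inr (by push_cast; ring))
  have e3 := key (m1 - m3 - 1) _ (tri _ _ c1 b1) (Or.inr (by push_cast; ring))
  have e4 := key (m2 - m3) _ (tri _ _ c2 b3) (Or.inl (by push_cast; ring))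
  omega

/-- The image of a continuous curve which is periodic modulo a positive power of `τ`. -/
def IsWave (τ : ℤ × ℤ) (C : Set (ℝ × ℝ)) : Prop :=
  ∃ (f : ℝ → ℝ × ℝ) (T : ℝ) (k : ℕ), Continuous f ∧ 0 < T ∧ 0 < k ∧
    (∀ t, f (t + T) = f t + (k : ℝ) • lat τ) ∧ C = range f

theorem lat_neg' (τ : ℤ × ℤ) : lat (-τ) = -lat τ := lat_neg τ

namespace IsWave

variable {τ : ℤ × ℤ} {C C' : Set (ℝ × ℝ)}

theorem neg (h : IsWave τ C) : IsWave (-τ) C := by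
  obtain ⟨f, T, k, hf, hT, hk, hp, rfl⟩ := h
  refine ⟨fun t => f (-t), T, k, hf.comp continuous_neg, hT, hk, fun t => ?_, ?_⟩
  · have := hp (-(t + T))
    rw [show -(t + T) + T = -t by ring] at this
    simp only [lat_neg, smul_neg, this]
    simp
  · exact (neg_surjective.range_comp f).symm

theorem isPreconnected (h : IsWave τ C) : IsPreconnected C := by
  obtain ⟨f, T, k, hf, hT, hk, hp, rfl⟩ := h
  exact isPreconnected_range hf

theorem nonempty (h : IsWave τ C) : C.Nonempty := by
  obtain ⟨f, T, k, hf, hT, hk, hp, rfl⟩ := h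
  exact range_nonempty f

theorem exists_max (h : IsWave τ C) : ∃ c ∈ C, ∀ c' ∈ C, ht τ c' ≤ ht τ c := by
  obtain ⟨f, T, k, hf, hT, hk, hp, rfl⟩ := h
  have hper : Function.Periodic (fun t => ht τ (f t)) T := fun t => by
    simp only [hp, ht_add, ht_smul, ht_lat_self]; ring
  obtain ⟨t, -, ht'⟩ := isCompact_Icc.exists_isMaxOn (nonempty_Icc.2 hT.le)
    ((continuous_ht τ).comp hf).continuousOn
  refine ⟨f t, mem_range_self t, ?_⟩
  rintro _ ⟨s, rfl⟩
  obtain ⟨y, hy, hs⟩ := hper.exists_mem_Ico₀ hT s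
  exact hs.le.trans (ht' ⟨hy.1, hy.2.le⟩)

theorem exists_min (h : IsWave τ C) : ∃ c ∈ C, ∀ c' ∈ C, ht τ c ≤ ht τ c' := by
  obtain ⟨c, hc, h'⟩ := h.neg.exists_max
  refine ⟨c, hc, fun c' hc' => ?_⟩
  have := h' c' hc'
  rw [ht_neg, ht_neg] at this
  linarith

theorem isClosed (hτ : τ ≠ 0) (h : IsWave τ C) : IsClosed C := by
  obtain ⟨f, T, k, hf, hT, hk, hp, rfl⟩ := h
  have h0 := prog_lat_self_pos hτ
  have hk' : (0 : ℝ) < k := by exact_mod_cast hk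
  rw [← isSeqClosed_iff_isClosed]
  intro x p hx hxp
  choose t ht' using hx
  set g : ℝ → ℝ := fun t => prog τ (f t) with hg
  have hgc : Continuous g := (continuous_prog τ).comp hf
  set ω := (k : ℝ) * prog τ (lat τ) / T with hω
  have hωpos : 0 < ω := by positivity
  have hper : Function.Periodic (fun t => g t - ω * t) T := fun t => by
    simp only [hg, hp, prog_add, prog_smul, hω]; field_simp; ring
  obtain ⟨B, hB⟩ : ∃ B, ∀ t, |g t - ω * t| ≤ B := by
    obtain ⟨B, hB⟩ := (isCompact_Icc (a := (0 : ℝ)) (b := T)).exists_bound_of_continuousOn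
      (f := fun t => g t - ω * t) (by fun_prop)
    refine ⟨B, fun t => ?_⟩
    obtain ⟨y, hy, hs⟩ := hper.exists_mem_Ico₀ hT t
    have := hB y ⟨hy.1, hy.2.le⟩
    rw [Real.norm_eq_abs] at this
    exact hs ▸ this
  have hgt : Tendsto (fun n => g (t n)) atTop (𝓝 (prog τ p)) := by
    have := ((continuous_prog τ).tendsto p).comp hxp
    refine this.congr fun n => ?_
    simp only [hg, Function.comp, ht']
  obtain ⟨B', hB'⟩ := hgt.norm.bddAbove_range
  have hbd : ∀ n, t n ∈ Icc (-((B + B') / ω)) ((B + B') / ω) := fun n => by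
    have h1 : |g (t n)| ≤ B' := hB' ⟨n, rfl⟩
    have h2 := hB (t n)
    rw [abs_le] at h1 h2
    constructor
    · rw [neg_le, le_div_iff₀ hωpos]; nlinarith
    · rw [le_div_iff₀ hωpos]; nlinarith
  obtain ⟨s, -, φ, hφ, hs⟩ := isCompact_Icc.tendsto_subseq hbd
  refine ⟨s, ?_⟩
  refine tendsto_nhds_unique ((hf.tendsto s).comp hs) ?_
  refine (hxp.comp hφ.tendsto_atTop).congr fun n => ?_
  simp only [Function.comp, ht']

/-- A wave separates the points above it from the points below it. -/
theorem not_joinedIn (hτ : τ ≠ 0) (h : IsWave τ C) {a b : ℝ × ℝ} (ha : ∀ c ∈ C, ht τ a < ht τ c)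
    (hb : ∀ c ∈ C, ht τ c < ht τ b) : ¬ JoinedIn Cᶜ a b := by
  rintro ⟨σ, hσ⟩
  obtain ⟨f, T, k, hf, hT, hk, hp, rfl⟩ := h
  have h0 := prog_lat_self_pos hτ
  have hk' : (0 : ℝ) < k := by exact_mod_cast hk
  have hσc : Continuous fun s => σ.extend s := σ.continuous_extend
  obtain ⟨B, hB⟩ : ∃ B, ∀ s, |prog τ (σ.extend s) - prog τ (f 0)| ≤ B := by
    obtain ⟨B, hB⟩ := (isCompact_univ (X := unitInterval)).exists_bound_of_continuousOn
      (f := fun s => prog τ (σ s) - prog τ (f 0))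
      (((continuous_prog τ).comp σ.continuous).sub continuous_const).continuousOn
    exact ⟨B, fun s => hB _ (mem_univ (projIcc (0 : ℝ) 1 zero_le_one s))⟩
  obtain ⟨n, hn⟩ := exists_nat_gt (B / (k * prog τ (lat τ)))
  rw [div_lt_iff₀ (by positivity)] at hn
  have hfn : ∀ n : ℤ, prog τ (f (n * T)) = prog τ (f 0) + n * (k * prog τ (lat τ)) := fun n => by
    have := add_int_mul_period hp n 0
    rw [zero_add] at this
    rw [this, prog_add, prog_smul, prog_smul]
  set G : ℝ × ℝ → ℂ := fun z => ⟨prog τ (σ.extend z.1) - prog τ (f z.2),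
    ht τ (σ.extend z.1) - ht τ (f z.2)⟩ with hGd
  have hG : Continuous G := by
    have h1 : Continuous fun z : ℝ × ℝ => σ.extend z.1 := hσc.comp continuous_fst
    have h2 : Continuous fun z : ℝ × ℝ => f z.2 := hf.comp continuous_snd
    exact Complex.equivRealProdCLM.symm.continuous.comp
      ((((continuous_prog τ).comp h1).sub ((continuous_prog τ).comp h2)).prodMk
      (((continuous_ht τ).comp h1).sub ((continuous_ht τ).comp h2)))
  obtain ⟨z, hz⟩ := exists_zero_of_boundary_signs hG (N := n * T)
    (fun t => by simpa [hGd] using ha _ (mem_range_self t))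
    (fun t => by simpa [hGd] using hb _ (mem_range_self t))
    (fun s => by
      have h1 := hfn n
      have h2 := (abs_le.1 (hB s)).2
      simp only [hGd]
      push_cast at h1
      rw [h1]; linarith)
    (fun s => by
      have h1 := hfn (-n)
      have h2 := (abs_le.1 (hB s)).1
      simp only [hGd]
      push_cast at h1
      rw [← neg_mul, h1]; linarith)
  have h1 : prog τ (σ.extend z.1) = prog τ (f z.2) := by
    have := congrArg Complex.re hz
    simpa [hGd, sub_eq_zero] using this
  have h2 : ht τ (σ.extend z.1) = ht τ (f z.2) := by
    have := congrArg Complex.im hz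
    simpa [hGd, sub_eq_zero] using this
  have h3 : σ.extend z.1 = f z.2 := by
    simp only [prog, lat] at h0
    simp only [prog] at h1
    simp only [ht] at h2
    ext
    · refine mul_left_cancel₀ h0.ne' ?_
      linear_combination (τ.1 : ℝ) * h1 - (τ.2 : ℝ) * h2
    · refine mul_left_cancel₀ h0.ne' ?_
      linear_combination (τ.2 : ℝ) * h1 + (τ.1 : ℝ) * h2
  exact hσ (projIcc (0 : ℝ) 1 zero_le_one z.1) ⟨z.2, h3.symm⟩

end IsWave

/-- The points which can be joined to points above `C` in the complement of `C`. -/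
def Up (τ : ℤ × ℤ) (C : Set (ℝ × ℝ)) : Set (ℝ × ℝ) :=
  {q | ∃ q₁, (∀ c ∈ C, ht τ c < ht τ q₁) ∧ JoinedIn Cᶜ q q₁}

/-- The points which can be joined to points below `C` in the complement of `C`. -/
def Low (τ : ℤ × ℤ) (C : Set (ℝ × ℝ)) : Set (ℝ × ℝ) := Up (-τ) C

section UpLow

variable {τ : ℤ × ℤ} {C C' S : Set (ℝ × ℝ)}

theorem Low_neg : Low (-τ) C = Up τ C := by rw [Low, neg_neg]

theorem Up_subset_compl : Up τ C ⊆ Cᶜ := fun _ ⟨_, _, h⟩ => h.source_mem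

theorem Low_subset_compl : Low τ C ⊆ Cᶜ := Up_subset_compl

theorem mem_Up_of_joinedIn {p q : ℝ × ℝ} (hq : q ∈ Up τ C) (h : JoinedIn Cᶜ p q) : p ∈ Up τ C := by
  obtain ⟨q', h1, h2⟩ := hq
  exact ⟨q', h1, h.trans h2⟩

theorem joinedIn_of_convex {D : Set (ℝ × ℝ)} (hD : Convex ℝ D) (h : D ⊆ S) {p q : ℝ × ℝ}
    (hp : p ∈ D) (hq : q ∈ D) : JoinedIn S p q :=
  (JoinedIn.of_segment_subset (hD.segment_subset hp hq)).mono h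

theorem isOpen_Up (hC : IsClosed C) : IsOpen (Up τ C) := by
  rw [Metric.isOpen_iff]
  intro q hq
  obtain ⟨ε, hε, hb⟩ := Metric.isOpen_iff.1 hC.isOpen_compl q (Up_subset_compl hq)
  exact ⟨ε, hε, fun p hp => mem_Up_of_joinedIn hq
    (joinedIn_of_convex (convex_ball q ε) hb hp (Metric.mem_ball_self hε))⟩

theorem isOpen_compl_diff_Up (hC : IsClosed C) : IsOpen (Cᶜ \ Up τ C) := by
  rw [Metric.isOpen_iff]
  intro q hq
  obtain ⟨ε, hε, hb⟩ := Metric.isOpen_iff.1 hC.isOpen_compl q hq.1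
  exact ⟨ε, hε, fun p hp => ⟨hb hp, fun h => hq.2 (mem_Up_of_joinedIn h
    (joinedIn_of_convex (convex_ball q ε) hb (Metric.mem_ball_self hε) hp))⟩⟩

theorem IsPreconnected.subset_Up (hS : IsPreconnected S) (hC : IsClosed C) (hd : Disjoint S C)
    {q : ℝ × ℝ} (hq : q ∈ S) (hq' : q ∈ Up τ C) : S ⊆ Up τ C := by
  refine hS.subset_left_of_subset_union (isOpen_Up hC) (isOpen_compl_diff_Up (τ := τ) hC)
    disjoint_sdiff_right (fun x hx => ?_) ⟨q, hq, hq'⟩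
  by_cases h : x ∈ Up τ C
  · exact Or.inl h
  · exact Or.inr ⟨fun hC' => disjoint_left.1 hd hx hC', h⟩

theorem mem_Up_of_forall_lt {q : ℝ × ℝ} (h : ∀ c ∈ C, ht τ c < ht τ q) : q ∈ Up τ C :=
  ⟨q, h, JoinedIn.refl fun hq => (h q hq).false⟩

theorem ht_rot (τ : ℤ × ℤ) : ht τ (-(τ.2 : ℝ), (τ.1 : ℝ)) = prog τ (lat τ) := by
  simp only [ht, prog, lat]; ring

theorem mem_Up_of_forall_le (hτ : τ ≠ 0) {q : ℝ × ℝ} (hq : q ∉ C)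
    (h : ∀ c ∈ C, ht τ c ≤ ht τ q) : q ∈ Up τ C := by
  set w : ℝ × ℝ := (-(τ.2 : ℝ), (τ.1 : ℝ)) with hw
  have hpos : 0 < ht τ w := ht_rot τ ▸ prog_lat_self_pos hτ
  refine mem_Up_of_joinedIn (mem_Up_of_forall_lt (q := q + w) fun c hc => ?_)
    (JoinedIn.of_segment_subset ?_)
  · rw [ht_add]; linarith [h c hc]
  · rw [segment_eq_image']
    rintro _ ⟨θ, hθ, rfl⟩ hc
    rcases hθ.1.eq_or_lt with h0 | h0
    · simp only [← h0, zero_smul, add_zero] at hc; exact hq hc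
    · have := h _ hc
      simp only [add_sub_cancel_left, ht_add, ht_smul] at this
      have := mul_pos h0 hpos
      linarith

theorem mem_Low_of_forall_le (hτ : τ ≠ 0) {q : ℝ × ℝ} (hq : q ∉ C)
    (h : ∀ c ∈ C, ht τ q ≤ ht τ c) : q ∈ Low τ C :=
  mem_Up_of_forall_le (neg_ne_zero.2 hτ) hq fun c hc => by
    rw [ht_neg, ht_neg]; exact neg_le_neg (h c hc)

theorem IsWave.disjoint_Up_Low (hτ : τ ≠ 0) (hC : IsWave τ C) : Disjoint (Up τ C) (Low τ C) := by
  rw [disjoint_left]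
  rintro q ⟨b, hb, h1⟩ ⟨a, ha, h2⟩
  exact hC.not_joinedIn hτ (fun c hc => by have := ha c hc; rwa [ht_neg, ht_neg, neg_lt_neg_iff]
    at this) hb (h2.symm.trans h1)

/-- Two disjoint waves are ordered. -/
theorem IsWave.trichotomy (hτ : τ ≠ 0) (hC : IsWave τ C) (hC' : IsWave τ C')
    (hd : Disjoint C C') : (C' ⊆ Up τ C ∧ C ⊆ Low τ C') ∨ (C' ⊆ Low τ C ∧ C ⊆ Up τ C') := by
  have main : ∀ {τ : ℤ × ℤ} {C C' : Set (ℝ × ℝ)}, τ ≠ 0 → IsWave τ C → IsWave τ C' →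
      Disjoint C C' → C ⊆ Up τ C' ∨ C' ⊆ Up τ C := by
    intro τ C C' hτ hC hC' hd
    obtain ⟨c, hc, hm⟩ := hC.exists_max
    obtain ⟨c', hc', hm'⟩ := hC'.exists_max
    rcases le_total (ht τ c) (ht τ c') with h | h
    · exact Or.inr (hC'.isPreconnected.subset_Up (hC.isClosed hτ) hd.symm hc'
        (mem_Up_of_forall_le hτ (disjoint_right.1 hd hc') fun x hx => (hm x hx).trans h))
    · exact Or.inl (hC.isPreconnected.subset_Up (hC'.isClosed hτ) hd hc
        (mem_Up_of_forall_le hτ (disjoint_left.1 hd hc) fun x hx => (hm' x hx).trans h))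
  have h1 := main hτ hC hC' hd
  have h2 := main (neg_ne_zero.2 hτ) hC.neg hC'.neg hd
  obtain ⟨c, hc⟩ := hC.nonempty
  obtain ⟨c', hc'⟩ := hC'.nonempty
  rcases h1 with h1 | h1 <;> rcases h2 with h2 | h2
  · exact absurd (h2 hc) (disjoint_left.1 (hC'.disjoint_Up_Low hτ) (h1 hc))
  · exact Or.inr ⟨h2, h1⟩
  · exact Or.inl ⟨h1, h2⟩
  · exact absurd (h2 hc') (disjoint_left.1 (hC.disjoint_Up_Low hτ) (h1 hc'))

end UpLow

/-- A function on `[0, D]` extended to be periodic up to translation by `v`. -/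
def perExt (c : ℝ → ℝ × ℝ) (D : ℝ) (v : ℝ × ℝ) (t : ℝ) : ℝ × ℝ :=
  c (t - ⌊t / D⌋ * D) + (⌊t / D⌋ : ℝ) • v

theorem perExt_add {c : ℝ → ℝ × ℝ} {D : ℝ} (hD : 0 < D) (v : ℝ × ℝ) (t : ℝ) :
    perExt c D v (t + D) = perExt c D v t + v := by
  have : (t + D) / D = t / D + 1 := by field_simp
  simp only [perExt, this, Int.floor_add_one]
  push_cast
  rw [add_smul, one_smul, add_assoc]
  congr 2
  ring

theorem perExt_eq {c : ℝ → ℝ × ℝ} {D : ℝ} (hD : 0 < D) {v : ℝ × ℝ} (hv : c D = c 0 + v) (n : ℤ)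
    {t : ℝ} (h1 : n * D ≤ t) (h2 : t ≤ (n + 1) * D) :
    perExt c D v t = c (t - n * D) + (n : ℝ) • v := by
  rcases h2.eq_or_lt with h | h
  · have : t / D = (n + 1 : ℤ) := by rw [h]; push_cast; field_simp
    rw [perExt, this, Int.floor_intCast]
    have e1 : t - ((n + 1 : ℤ) : ℝ) * D = 0 := by rw [h]; push_cast; ring
    have e2 : t - n * D = D := by rw [h]; ring
    rw [e1, e2, hv]
    push_cast
    rw [add_smul, one_smul]
    abel
  · have : ⌊t / D⌋ = n := by
      rw [Int.floor_eq_iff]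
      exact ⟨(le_div_iff₀ hD).2 h1, (div_lt_iff₀ hD).2 h⟩
    rw [perExt, this]

theorem perExt_eq_self {c : ℝ → ℝ × ℝ} {D : ℝ} (hD : 0 < D) {v : ℝ × ℝ} (hv : c D = c 0 + v)
    {t : ℝ} (h : t ∈ Icc 0 D) : perExt c D v t = c t := by
  simpa using perExt_eq hD hv 0 (t := t) (by simpa using h.1) (by simpa using h.2)

namespace TorusMetric

variable {M : TorusMetric}

variable (M) in
/-- Curves which minimize locally. -/
def LocalGeod (c : ℝ → ℝ × ℝ) : Prop := ∀ t, ∃ ε > 0, M.IsoOn c (t - ε) (t + ε)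

theorem LocalGeod.hasDerivAt {c : ℝ → ℝ × ℝ} (h : M.LocalGeod c) (t : ℝ) :
    HasDerivAt (fun s => (c s, deriv c s)) (deriv c t, M.geo (c t, deriv c t)) t := by
  obtain ⟨ε, hε, hi⟩ := h t
  have ht : t ∈ Ioo (t - ε) (t + ε) := ⟨by linarith, by linarith⟩
  exact (hi.differentiable.1 t ht).prodMk (hi.geodesic_eq ht)

theorem LocalGeod.nrm_deriv {c : ℝ → ℝ × ℝ} (h : M.LocalGeod c) (t : ℝ) :
    M.nrm (c t) (deriv c t) = 1 := by
  obtain ⟨ε, hε, hi⟩ := h t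
  exact hi.nrm_deriv ⟨by linarith, by linarith⟩

theorem LocalGeod.length_eq {c : ℝ → ℝ × ℝ} (h : M.LocalGeod c) (s t : ℝ) :
    M.length c s t = t - s := by
  simp only [length_eq_integral, h.nrm_deriv, intervalIntegral.integral_const, smul_eq_mul, mul_one]

theorem LocalGeod.contDiff {c : ℝ → ℝ × ℝ} (h : M.LocalGeod c) : ContDiff ℝ (⊤ : ℕ∞) c := by
  have key : ∀ n : ℕ, ContDiff ℝ n fun s => (c s, deriv c s) := by
    intro n
    induction n with
    | zero =>
      refine contDiff_zero.2 (continuous_iff_continuousAt.2 fun t => (h.hasDerivAt t).continuousAt)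
    | succ n ih =>
      push_cast
      refine contDiff_succ_iff_deriv.2 ⟨fun t => (h.hasDerivAt t).differentiableAt, by simp, ?_⟩
      have : deriv (fun s => (c s, deriv c s)) =
          fun t => ((c t, deriv c t).2, M.geo (c t, deriv c t)) :=
        funext fun t => (h.hasDerivAt t).deriv
      rw [this]
      exact (contDiff_snd.comp ih).prodMk
        ((M.contDiff_geo.of_le (by exact_mod_cast le_top)).comp ih)
  exact contDiff_infty.2 fun n => contDiff_fst.comp (key n)

theorem LocalGeod.isGeodesic {c : ℝ → ℝ × ℝ} (h : M.LocalGeod c) : M.IsGeodesic c := by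
  refine ⟨h.contDiff, fun t => ?_, fun t => ?_⟩
  · rw [← M.nrm_sq, h.nrm_deriv, one_pow]
  · obtain ⟨ε, hε, hi⟩ := h t
    refine ⟨ε, hε, fun s₁ s₂ h1 h2 h3 => ?_⟩
    rw [h.length_eq, hi s₁ ⟨h1, h2.trans h3⟩ s₂ ⟨h1.trans h2, h3⟩ h2]

theorem lipD_of_cells {f : ℝ → ℝ × ℝ} {D C : ℝ} (hD : 0 < D)
    (h : ∀ (n : ℤ) (s t : ℝ), n * D ≤ s → s ≤ t → t ≤ (n + 1) * D →
      M.dist (f s) (f t) ≤ C * (t - s)) : M.LipD f C := by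
  have key : ∀ (n : ℕ) (s t : ℝ), s ≤ t → ⌊t / D⌋ ≤ ⌊s / D⌋ + n →
      M.dist (f s) (f t) ≤ C * (t - s) := by
    intro n
    induction n with
    | zero =>
      intro s t hst hn
      refine h ⌊s / D⌋ s t ((le_div_iff₀ hD).1 (Int.floor_le _)) hst ?_
      have h1 : (⌊t / D⌋ : ℝ) ≤ ⌊s / D⌋ := by exact_mod_cast (by simpa using hn)
      have h2 := Int.lt_floor_add_one (t / D)
      rw [div_lt_iff₀ hD] at h2
      nlinarith
    | succ n ih =>
      intro s t hst hn
      by_cases hlt : ⌊t / D⌋ ≤ ⌊s / D⌋ + n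
      · exact ih s t hst hlt
      have hm : ⌊t / D⌋ = ⌊s / D⌋ + n + 1 := by push_cast at hn; omega
      set m := ⌊t / D⌋ with hmd
      have h1 : (m : ℝ) * D ≤ t := (le_div_iff₀ hD).1 (Int.floor_le _)
      have h2 : t ≤ (m + 1) * D := ((div_lt_iff₀ hD).1 (Int.lt_floor_add_one (t / D))).le
      have h3 : s ≤ m * D := by
        have := (div_lt_iff₀ hD).1 (Int.lt_floor_add_one (s / D))
        have h4 : (⌊s / D⌋ : ℝ) + 1 ≤ m := by exact_mod_cast (by omega)
        nlinarith
      rcases n.eq_zero_or_pos with hn0 | hn0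
      · subst hn0
        have e1 := h m (m * D) t le_rfl h1 h2
        have h5 : (⌊s / D⌋ : ℝ) + 1 = m := by rw [hm]; push_cast; ring
        have e2 := h ⌊s / D⌋ s (m * D) ((le_div_iff₀ hD).1 (Int.floor_le _)) h3 (by rw [h5])
        have := M.dist_triangle (f s) (f (m * D)) (f t)
        linarith
      · have e1 := h m (m * D) t le_rfl h1 h2
        have e0 : ((m - 1 : ℤ) : ℝ) = m - 1 := by push_cast; ring
        have e3 := h (m - 1) ((m - 1 : ℤ) * D) (m * D) le_rfl (by rw [e0]; nlinarith)
          (by rw [e0]; simp)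
        have e2 := ih s ((m - 1 : ℤ) * D) (by
            have := (div_lt_iff₀ hD).1 (Int.lt_floor_add_one (s / D))
            have h4 : (⌊s / D⌋ : ℝ) + 1 ≤ (m - 1 : ℤ) := by exact_mod_cast (by omega)
            nlinarith) (by rw [mul_div_assoc, div_self hD.ne', mul_one, Int.floor_intCast]; omega)
        have t1 := M.dist_triangle (f s) (f (m * D)) (f t)
        have t2 := M.dist_triangle (f s) (f ((m - 1 : ℤ) * D)) (f (m * D))
        linarith
  intro s t
  have key' : ∀ s t : ℝ, s ≤ t → M.dist (f s) (f t) ≤ C * (t - s) := fun s t hst => by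
    refine key (⌊t / D⌋ - ⌊s / D⌋).toNat s t hst ?_
    have := Int.self_le_toNat (⌊t / D⌋ - ⌊s / D⌋)
    omega
  rcases le_total s t with hst | hst
  · rw [abs_sub_comm, abs_of_nonneg (sub_nonneg.2 hst)]; exact key' s t hst
  · rw [abs_of_nonneg (sub_nonneg.2 hst), M.dist_comm]; exact key' t s hst

theorem lipD_perExt {c : ℝ → ℝ × ℝ} {D C : ℝ} (hD : 0 < D) {κ : ℤ × ℤ} (hv : c D = c 0 + lat κ)
    (h : ∀ s t : ℝ, 0 ≤ s → s ≤ t → t ≤ D → M.dist (c s) (c t) ≤ C * (t - s)) :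
    M.LipD (perExt c D (lat κ)) C := by
  refine lipD_of_cells hD fun n s t h1 h2 h3 => ?_
  rw [perExt_eq hD hv n h1 (h2.trans h3), perExt_eq hD hv n (h1.trans h2) h3, ← lat_zsmul,
    M.dist_add_lat]
  have := h (s - n * D) (t - n * D) (by linarith) (by linarith) (by linarith)
  linarith

theorem IsoOn.lipD_perExt {c : ℝ → ℝ × ℝ} {D : ℝ} (hc : M.IsoOn c 0 D) (hD : 0 < D) {κ : ℤ × ℤ}
    (hv : c D = c 0 + lat κ) : M.LipD (perExt c D (lat κ)) 1 :=
  TorusMetric.lipD_perExt hD hv fun s t h1 h2 h3 => by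
    rw [hc s ⟨h1, h2.trans h3⟩ t ⟨h1.trans h2, h3⟩ h2, one_mul]

end TorusMetric

theorem isWave_of_lipD {M : TorusMetric} {f : ℝ → ℝ × ℝ} {D T : ℝ} {τ : ℤ × ℤ} {k : ℕ}
    (hf : M.LipD f D) (hT : 0 < T) (hk : 0 < k)
    (hp : ∀ t, f (t + T) = f t + (k : ℝ) • lat τ) : IsWave τ (range f) :=
  ⟨f, T, k, TorusMetric.LipD.continuous M hf, hT, hk, hp, rfl⟩

theorem IsWave.add_vec {τ : ℤ × ℤ} {C : Set (ℝ × ℝ)} (h : IsWave τ C) (v : ℝ × ℝ) :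
    IsWave τ ((fun x => x + v) '' C) := by
  obtain ⟨f, T, k, hf, hT, hk, hp, rfl⟩ := h
  refine ⟨fun t => f t + v, T, k, by fun_prop, hT, hk, fun t => ?_, ?_⟩
  · simp only [hp]; abel
  · rw [← range_comp]; rfl

theorem IsWave.not_disjoint_add {τ : ℤ × ℤ} (hτ : τ ≠ 0) {C : Set (ℝ × ℝ)} (h : IsWave τ C) :
    ¬ Disjoint C ((fun x => x + lat τ) '' C) := by
  intro hd
  have h' := h.add_vec (lat τ)
  have hh : ∀ x, ht τ (x + lat τ) = ht τ x := fun x => by rw [ht_add, ht_lat_self, add_zero]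
  rcases h.trichotomy hτ h' hd with ⟨-, h1⟩ | ⟨-, h1⟩
  · obtain ⟨c, hc, hm⟩ := h.exists_max
    refine disjoint_left.1 (h'.disjoint_Up_Low hτ)
      (mem_Up_of_forall_le hτ (disjoint_left.1 hd hc) ?_) (h1 hc)
    rintro _ ⟨x, hx, rfl⟩
    exact (hh x).trans_le (hm x hx)
  · obtain ⟨c, hc, hm⟩ := h.exists_min
    refine disjoint_left.1 (h'.disjoint_Up_Low hτ) (h1 hc)
      (mem_Low_of_forall_le hτ (disjoint_left.1 hd hc) ?_)
    rintro _ ⟨x, hx, rfl⟩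
    exact (hm x hx).trans_eq (hh x).symm

namespace TorusMetric

variable {M : TorusMetric} {τ : ℤ × ℤ} {L : ℝ}

theorem dist_lat_ge (hτ : τ ≠ 0) (hL0 : 0 ≤ L) (hL : ∀ x, L ≤ M.dist x (x + lat τ)) (j : ℤ)
    (x : ℝ × ℝ) : |(j : ℝ)| * L ≤ M.dist x (x + lat (j • τ)) := by
  have hlat : lat τ ≠ 0 := fun h => (prog_lat_self_pos hτ).ne' (by rw [h]; simp [prog])
  set ι := M.lo * ‖lat τ‖ with hι
  have hιpos : 0 < ι := mul_pos M.lo_pos (norm_pos_iff.2 hlat)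
  have hlow : ∀ (j : ℤ) (x : ℝ × ℝ), j ≠ 0 → ι ≤ M.dist x (x + lat (j • τ)) := by
    intro j x hj
    refine le_trans ?_ (M.lo_mul_le_dist _ _)
    rw [sub_add_cancel_left, norm_neg, lat_zsmul, norm_smul, hι, Real.norm_eq_abs]
    have : (1 : ℝ) ≤ |(j : ℝ)| := by exact_mod_cast Int.one_le_abs hj
    have h2 : ‖lat τ‖ ≤ |(j : ℝ)| * ‖lat τ‖ := le_mul_of_one_le_left (norm_nonneg _) this
    exact mul_le_mul_of_nonneg_left h2 M.lo_pos.le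
  have key : ∀ (n : ℕ) (j : ℤ) (x : ℝ × ℝ), M.dist x (x + lat (j • τ)) ≤ n * ι →
      |(j : ℝ)| * L ≤ M.dist x (x + lat (j • τ)) := by
    intro n
    induction n with
    | zero =>
      intro j x h
      rcases eq_or_ne j 0 with rfl | hj
      · simp [M.dist_nonneg]
      · have := hlow j x hj
        simp only [Nat.cast_zero, zero_mul] at h
        linarith
    | succ n ih =>
      have pos : ∀ (j : ℤ) (x : ℝ × ℝ), 0 ≤ j → M.dist x (x + lat (j • τ)) ≤ (n + 1 : ℕ) * ι →
          |(j : ℝ)| * L ≤ M.dist x (x + lat (j • τ)) := by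
        intro j x hj0 h
        rcases hj0.eq_or_lt with rfl | hj0
        · simp [M.dist_nonneg]
        rcases (show j = 1 ∨ 2 ≤ j by omega) with rfl | hj2
        · simpa using hL x
        obtain ⟨c, hc0, hc1, hc⟩ := M.exists_isoOn x (x + lat (j • τ))
        set D := M.dist x (x + lat (j • τ)) with hDd
        have hD : 0 < D := hιpos.trans_le (hlow j x (by omega))
        have hv : c D = c 0 + lat (j • τ) := by rw [hc0, hc1]
        set f := perExt c D (lat (j • τ)) with hf
        have hfl : M.LipD f 1 := hc.lipD_perExt hD hv
        have hfp : ∀ t, f (t + D) = f t + lat (j • τ) := perExt_add hD _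
        have hw : IsWave τ (range f) := by
          refine isWave_of_lipD hfl hD (k := j.toNat) (by omega) fun t => ?_
          rw [hfp, lat_zsmul]
          congr 2
          exact_mod_cast (Int.toNat_of_nonneg hj0.le).symm
        obtain ⟨y, ⟨t1, rfl⟩, z, ⟨t2, rfl⟩, hz⟩ := not_disjoint_iff.1 (hw.not_disjoint_add hτ)
        simp only at hz
        set r := ⌊(t1 - t2) / D⌋ with hr
        have r1 : r * D ≤ t1 - t2 := (le_div_iff₀ hD).1 (Int.floor_le _)
        have r2 : t1 - t2 < (r + 1) * D := (div_lt_iff₀ hD).1 (Int.lt_floor_add_one _)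
        set e : ℤ := 1 - r * j with he
        have he0 : e ≠ 0 := fun h0 => by
          have : j ∣ 1 := ⟨r, by linarith⟩
          have := Int.le_of_dvd one_pos this
          omega
        have hje0 : j - e ≠ 0 := fun h0 => by
          have : j ∣ 1 := ⟨1 + r, by linarith⟩
          have := Int.le_of_dvd one_pos this
          omega
        have ey : f (t1 - r * D) = f t2 + lat (e • τ) := by
          have := add_int_mul_period hfp r (t1 - r * D)
          rw [sub_add_cancel, ← hz] at this
          rw [← sub_eq_iff_eq_add.2 this, lat_zsmul, lat_zsmul, he]
          push_cast
          rw [sub_smul, one_smul, smul_smul, add_sub_assoc]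
        have ez : f (t2 + D) = f (t1 - r * D) + lat ((j - e) • τ) := by
          rw [hfp, ey, add_assoc, ← lat_add, ← add_smul]
          congr 3; ring
        have d1 := hfl t2 (t1 - r * D)
        have d2 := hfl (t1 - r * D) (t2 + D)
        rw [ey, one_mul, abs_sub_comm, abs_of_nonneg (by linarith)] at d1
        rw [ez, one_mul, abs_sub_comm, abs_of_nonneg (by linarith)] at d2
        have l1 := hlow e (f t2) he0
        have l2 := hlow (j - e) (f (t1 - r * D)) hje0
        push_cast at h
        have i1 := ih e (f t2) (by linarith)
        have i2 := ih (j - e) (f (t1 - r * D)) (by linarith)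
        have hab : |(j : ℝ)| ≤ |(e : ℝ)| + |((j - e : ℤ) : ℝ)| := by
          refine le_trans (le_of_eq ?_) (abs_add_le _ _)
          push_cast; congr 1; ring
        have := mul_le_mul_of_nonneg_right hab hL0
        linarith
      intro j x h
      rcases le_total 0 j with hj | hj
      · exact pos j x hj h
      · have e1 : M.dist x (x + lat (j • τ)) =
            M.dist (x + lat (j • τ)) (x + lat (j • τ) + lat ((-j) • τ)) := by
          rw [M.dist_comm, neg_smul, lat_neg, add_neg_cancel_right]
        rw [e1] at h ⊢
        have := pos (-j) _ (by omega) h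
        simpa using this
  obtain ⟨n, hn⟩ := exists_nat_ge (M.dist x (x + lat (j • τ)) / ι)
  exact key n j x ((div_le_iff₀ hιpos).1 hn)

variable (M τ L) in
/-- A line which minimizes and is periodic with period `L` up to `τ`. -/
structure MinLine (α : ℝ → ℝ × ℝ) : Prop where
  iso : ∀ a b, M.IsoOn α a b
  per : ∀ t, α (t + L) = α t + lat τ

theorem exists_minLine (hτ : τ ≠ 0) (hL0 : 0 < L) (hL : ∀ x, L ≤ M.dist x (x + lat τ))
    {q : ℝ × ℝ} (hq : M.dist q (q + lat τ) = L) : ∃ α, MinLine M τ L α ∧ α 0 = q := by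
  obtain ⟨c, hc0, hc1, hc⟩ := M.exists_isoOn q (q + lat τ)
  rw [hq] at hc hc1
  have hv : c L = c 0 + lat τ := by rw [hc0, hc1]
  set f := perExt c L (lat τ) with hf
  have hfl : M.LipD f 1 := hc.lipD_perExt hL0 hv
  have hfp : ∀ t, f (t + L) = f t + lat τ := perExt_add hL0 _
  refine ⟨f, ⟨fun a b s _ t _ hst => le_antisymm ?_ ?_, hfp⟩, ?_⟩
  · have := hfl s t
    rwa [one_mul, abs_sub_comm, abs_of_nonneg (sub_nonneg.2 hst)] at this
  · obtain ⟨n, hn⟩ := exists_nat_ge ((|s| + |t|) / L)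
    rw [div_le_iff₀ hL0] at hn
    have e1 : f (-(n * L) + ((2 * n : ℕ) : ℤ) * L) = f (-(n * L)) + lat (((2 * n : ℕ) : ℤ) • τ) := by
      rw [add_int_mul_period hfp, lat_zsmul]
    have e2 := M.dist_lat_ge hτ hL0.le hL ((2 * n : ℕ) : ℤ) (f (-(n * L)))
    rw [← e1] at e2
    push_cast at e2
    rw [abs_of_nonneg (by positivity)] at e2
    have b1 := neg_abs_le s
    have b2 := le_abs_self t
    have b3 := abs_nonneg s
    have b4 := abs_nonneg t
    have t1 := M.dist_triangle (f (-(n * L))) (f s) (f (-(n * L) + 2 * n * L))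
    have t2 := M.dist_triangle (f s) (f t) (f (-(n * L) + 2 * n * L))
    have d1 := hfl (-(n * L)) s
    have d2 := hfl t (-(n * L) + 2 * n * L)
    rw [one_mul, abs_sub_comm, abs_of_nonneg (by linarith)] at d1
    rw [one_mul, abs_sub_comm, abs_of_nonneg (by linarith)] at d2
    linarith
  · rw [hf, perExt_eq_self hL0 hv ⟨le_rfl, hL0.le⟩, hc0]

namespace MinLine

variable {α β : ℝ → ℝ × ℝ}

theorem dist_eq (h : MinLine M τ L α) (s t : ℝ) : M.dist (α s) (α t) = |s - t| :=
  (h.iso (min s t) (max s t)).dist_eq ⟨min_le_left _ _, le_max_left _ _⟩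
    ⟨min_le_right _ _, le_max_right _ _⟩

theorem lipD (h : MinLine M τ L α) : M.LipD α 1 := fun s t => by rw [h.dist_eq, one_mul]

theorem continuous (h : MinLine M τ L α) : Continuous α := LipD.continuous M h.lipD

theorem localGeod (h : MinLine M τ L α) : M.LocalGeod α := fun _ => ⟨1, one_pos, h.iso _ _⟩

theorem isWave (h : MinLine M τ L α) (hL0 : 0 < L) : IsWave τ (range α) :=
  isWave_of_lipD h.lipD hL0 one_pos fun t => by rw [h.per, Nat.cast_one, one_smul]

theorem shift (h : MinLine M τ L α) (r : ℝ) : MinLine M τ L fun t => α (t + r) where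
  iso a b := by simpa using (h.iso (a + r) (b + r)).shift r
  per t := by rw [add_right_comm, h.per]

theorem add_lat (h : MinLine M τ L α) (k : ℤ × ℤ) : MinLine M τ L fun t => α t + lat k where
  iso a b := (h.iso a b).add_lat k
  per t := by rw [h.per]; abel

theorem neg (h : MinLine M τ L α) : MinLine M (-τ) L fun t => α (-t) where
  iso a b := by simpa using (h.iso (-b) (-a)).reverse
  per t := by
    have := h.per (-(t + L))
    rw [show -(t + L) + L = -t by ring] at this
    rw [this, lat_neg, add_neg_cancel_right]

theorem dist_lat (h : MinLine M τ L α) (hL0 : 0 < L) (t : ℝ) :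
    M.dist (α t) (α t + lat τ) = L := by
  rw [← h.per, h.dist_eq, sub_add_cancel_left, abs_neg, abs_of_pos hL0]

theorem isAxisOf (h : MinLine M τ L α) (hτ : τ ≠ 0) : IsAxisOf M α τ :=
  ⟨h.localGeod.isGeodesic, hτ, L, h.per⟩

theorem isMinimal (h : MinLine M τ L α) : IsMinimal M α := fun s t hst => by
  rw [h.localGeod.length_eq, h.iso s t s ⟨le_rfl, hst⟩ t ⟨hst, le_rfl⟩ hst]

theorem eq_of_eq (hτ : τ ≠ 0) (hL0 : 0 < L) (hL : ∀ x, L ≤ M.dist x (x + lat τ))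
    (hα : MinLine M τ L α) (hβ : MinLine M τ L β) (h0 : α 0 = β 0) : α = β := by
  have hg : M.IsoOn (fun t => if t ≤ 0 then α t else β t) (-L) L := by
    refine (hα.iso (-L) 0).glue (hβ.iso 0 L) (by linarith) hL0.le h0 ?_
    have e1 := hα.per (-L)
    have e2 := hβ.per 0
    rw [neg_add_cancel] at e1
    rw [zero_add, ← h0, e1] at e2
    have := M.dist_lat_ge hτ hL0.le hL 2 (α (-L))
    rw [e2, add_assoc, ← lat_add, ← two_zsmul]
    rw [show |((2 : ℤ) : ℝ)| = 2 by norm_num] at this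
    linarith
  have hm : -L / 2 ∈ Ioo (-L) L := ⟨by linarith, by linarith⟩
  have hev : (fun t => if t ≤ 0 then α t else β t) =ᶠ[𝓝 (-L / 2)] α := by
    filter_upwards [Iio_mem_nhds (show -L / 2 < 0 by linarith)] with t ht
    exact if_pos (le_of_lt ht)
  have h1 := hg.eq_of_deriv_eq (hα.iso (-L) L) hm hev.eq_of_nhds hev.deriv_eq
  have h2 : ∀ t ∈ Icc 0 L, α t = β t := fun t ht => by
    have := h1 t ⟨by linarith [ht.1], ht.2⟩
    rw [← this]
    split_ifs with h
    · rw [le_antisymm h ht.1, h0]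
    · rfl
  funext t
  have a1 := add_int_mul_period hα.per ⌊t / L⌋ (t - ⌊t / L⌋ * L)
  have a2 := add_int_mul_period hβ.per ⌊t / L⌋ (t - ⌊t / L⌋ * L)
  rw [sub_add_cancel] at a1 a2
  rw [a1, a2, h2]
  have b1 := (le_div_iff₀ hL0).1 (Int.floor_le (t / L))
  have b2 := (div_lt_iff₀ hL0).1 (Int.lt_floor_add_one (t / L))
  exact ⟨by linarith, by linarith⟩

theorem range_eq_of_mem (hτ : τ ≠ 0) (hL0 : 0 < L) (hL : ∀ x, L ≤ M.dist x (x + lat τ))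
    (hα : MinLine M τ L α) (hβ : MinLine M τ L β) {x : ℝ × ℝ} (h1 : x ∈ range α)
    (h2 : x ∈ range β) : range α = range β := by
  obtain ⟨s, rfl⟩ := h1
  obtain ⟨t, ht⟩ := h2
  have := eq_of_eq hτ hL0 hL (hα.shift s) (hβ.shift t) (by simp [ht])
  have e1 : ∀ (f : ℝ → ℝ × ℝ) r, range (fun t => f (t + r)) = range f := fun f r =>
    (Equiv.addRight r).surjective.range_comp f
  rw [← e1 α s, this, e1]

theorem disjoint_or_eq (hτ : τ ≠ 0) (hL0 : 0 < L) (hL : ∀ x, L ≤ M.dist x (x + lat τ))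
    (hα : MinLine M τ L α) (hβ : MinLine M τ L β) :
    Disjoint (range α) (range β) ∨ range α = range β := by
  by_cases h : Disjoint (range α) (range β)
  · exact Or.inl h
  · obtain ⟨x, h1, h2⟩ := not_disjoint_iff.1 h
    exact Or.inr (range_eq_of_mem hτ hL0 hL hα hβ h1 h2)

end MinLine

end TorusMetric

theorem isCompact_strip {τ : ℤ × ℤ} (hτ : τ ≠ 0) (P H : ℝ) :
    IsCompact {x : ℝ × ℝ | 0 ≤ prog τ x ∧ prog τ x ≤ P ∧ |ht τ x| ≤ H} := by
  have hc : IsClosed {x : ℝ × ℝ | 0 ≤ prog τ x ∧ prog τ x ≤ P ∧ |ht τ x| ≤ H} :=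
    ((isClosed_le continuous_const (continuous_prog τ)).inter
      ((isClosed_le (continuous_prog τ) continuous_const).inter
        (isClosed_le (continuous_ht τ).abs continuous_const)))
  have hp := prog_lat_self_pos hτ
  set Q := prog τ (lat τ) with hQ
  have hQ' : Q = τ.1 * τ.1 + τ.2 * τ.2 := by simp [hQ, prog, lat]
  set R := ((|(τ.1 : ℝ)| + |(τ.2 : ℝ)|) * (|P| + |H|)) / Q
  refine (isCompact_closedBall (0 : ℝ × ℝ) R).of_isClosed_subset hc ?_
  rintro x ⟨h1, h2, h3⟩
  have e1 : x.1 = (τ.1 * prog τ x - τ.2 * ht τ x) / Q := by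
    rw [eq_div_iff hp.ne', hQ']; simp only [prog, ht]; ring
  have e2 : x.2 = (τ.2 * prog τ x + τ.1 * ht τ x) / Q := by
    rw [eq_div_iff hp.ne', hQ']; simp only [prog, ht]; ring
  have b1 : |prog τ x| ≤ |P| + |H| := by
    rw [abs_of_nonneg h1]; linarith [le_abs_self P, abs_nonneg H]
  have b2 : |ht τ x| ≤ |P| + |H| := by linarith [le_abs_self H, abs_nonneg P]
  have key : ∀ a b u v : ℝ, |u| ≤ |P| + |H| → |v| ≤ |P| + |H| →
      |a * u + b * v| ≤ (|a| + |b|) * (|P| + |H|) := fun a b u v hu hv => by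
    calc |a * u + b * v| ≤ |a| * |u| + |b| * |v| := by
          rw [← abs_mul, ← abs_mul]; exact abs_add_le _ _
      _ ≤ |a| * (|P| + |H|) + |b| * (|P| + |H|) := by gcongr
      _ = _ := by ring
  rw [mem_closedBall_zero_iff, Prod.norm_def, max_le_iff, Real.norm_eq_abs, Real.norm_eq_abs]
  constructor
  · rw [e1, abs_div, abs_of_pos hp, sub_eq_add_neg, ← neg_mul]
    have := key τ.1 (-τ.2) _ _ b1 b2
    rw [abs_neg] at this
    exact div_le_div_of_nonneg_right this hp.le
  · rw [e2, abs_div, abs_of_pos hp]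
    have := key τ.2 τ.1 _ _ b1 b2
    rw [add_comm |(τ.2 : ℝ)|] at this
    exact div_le_div_of_nonneg_right this hp.le

theorem prog_lat_zsmul (τ : ℤ × ℤ) (n : ℤ) (x : ℝ × ℝ) :
    prog τ (x + lat (n • τ)) = prog τ x + n * prog τ (lat τ) := by
  rw [prog_add, lat_zsmul, prog_smul]

theorem ht_lat_zsmul (τ : ℤ × ℤ) (n : ℤ) (x : ℝ × ℝ) : ht τ (x + lat (n • τ)) = ht τ x := by
  rw [ht_add, lat_zsmul, ht_smul, ht_lat_self, mul_zero, add_zero]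

theorem exists_zsmul_prog_mem {τ : ℤ × ℤ} (hτ : τ ≠ 0) (x : ℝ × ℝ) : ∃ n : ℤ,
    0 ≤ prog τ (x + lat (n • τ)) ∧ prog τ (x + lat (n • τ)) ≤ prog τ (lat τ) := by
  have hp := prog_lat_self_pos hτ
  refine ⟨-⌊prog τ x / prog τ (lat τ)⌋, ?_⟩
  rw [prog_lat_zsmul]
  have b1 := (le_div_iff₀ hp).1 (Int.floor_le (prog τ x / prog τ (lat τ)))
  have b2 := (div_lt_iff₀ hp).1 (Int.lt_floor_add_one (prog τ x / prog τ (lat τ)))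
  push_cast
  exact ⟨by linarith, by linarith⟩

/-- A positive continuous function which is invariant under `τ` is bounded away from zero on
invariant closed sets of bounded height. -/
theorem exists_pos_le_of_periodic {τ : ℤ × ℤ} (hτ : τ ≠ 0) {Q : Set (ℝ × ℝ)} (hQ : IsClosed Q)
    (hper : ∀ x ∈ Q, ∀ n : ℤ, x + lat (n • τ) ∈ Q) {H : ℝ} (hH : ∀ x ∈ Q, |ht τ x| ≤ H)
    {φ : ℝ × ℝ → ℝ} (hφ : Continuous φ) (hφp : ∀ x (n : ℤ), φ (x + lat (n • τ)) = φ x)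
    (hpos : ∀ x ∈ Q, 0 < φ x) : ∃ ε > 0, ∀ x ∈ Q, ε ≤ φ x := by
  have hK := (isCompact_strip hτ (prog τ (lat τ)) H).inter_right hQ
  rcases ({x : ℝ × ℝ | 0 ≤ prog τ x ∧ prog τ x ≤ prog τ (lat τ) ∧ |ht τ x| ≤ H} ∩
    Q).eq_empty_or_nonempty with h | h
  · refine ⟨1, one_pos, fun x hx => ?_⟩
    obtain ⟨n, h1, h2⟩ := exists_zsmul_prog_mem hτ x
    have : x + lat (n • τ) ∈ (∅ : Set (ℝ × ℝ)) :=
      h ▸ ⟨⟨h1, h2, hH _ (hper x hx n)⟩, hper x hx n⟩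
    exact this.elim
  · obtain ⟨y, hy, hmin⟩ := hK.exists_isMinOn h hφ.continuousOn
    refine ⟨φ y, hpos y hy.2, fun x hx => ?_⟩
    obtain ⟨n, h1, h2⟩ := exists_zsmul_prog_mem hτ x
    rw [← hφp x n]
    exact hmin ⟨⟨h1, h2, hH _ (hper x hx n)⟩, hper x hx n⟩

section UpLow

variable {τ : ℤ × ℤ} {C C' S : Set (ℝ × ℝ)}

theorem IsWave.exists_abs_ht_le (h : IsWave τ C) : ∃ H, ∀ c ∈ C, |ht τ c| ≤ H := by
  obtain ⟨a, -, ha⟩ := h.exists_max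
  obtain ⟨b, -, hb⟩ := h.exists_min
  refine ⟨|ht τ a| + |ht τ b|, fun c hc => abs_le.2 ⟨?_, ?_⟩⟩
  · linarith [hb c hc, neg_abs_le (ht τ b), abs_nonneg (ht τ a)]
  · linarith [ha c hc, le_abs_self (ht τ a), abs_nonneg (ht τ b)]

/-- The rotation of `τ` by a right angle. -/
def rot (τ : ℤ × ℤ) : ℝ × ℝ := (-(τ.2 : ℝ), (τ.1 : ℝ))

theorem ht_rot_pos (hτ : τ ≠ 0) : 0 < ht τ (rot τ) := by
  rw [rot, ht_rot]; exact prog_lat_self_pos hτ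

/-- Points above `C` can be joined to arbitrarily high points. -/
theorem exists_joinedIn_high (hτ : τ ≠ 0) {p : ℝ × ℝ} (hp : p ∈ Up τ C) (H : ℝ) :
    ∃ q, H < ht τ q ∧ (∀ c ∈ C, ht τ c < ht τ q) ∧ JoinedIn Cᶜ p q := by
  obtain ⟨q, hq, hj⟩ := hp
  have hw := ht_rot_pos hτ
  obtain ⟨n, hn⟩ := exists_nat_gt ((H - ht τ q) / ht τ (rot τ))
  rw [div_lt_iff₀ hw] at hn
  have hn0 : (0 : ℝ) ≤ n := n.cast_nonneg
  refine ⟨q + (n : ℝ) • rot τ, ?_, fun c hc => ?_, hj.trans (JoinedIn.of_segment_subset ?_)⟩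
  · rw [ht_add, ht_smul]; linarith
  · rw [ht_add, ht_smul]; nlinarith [hq c hc, mul_nonneg hn0 hw.le]
  · rw [segment_eq_image']
    rintro _ ⟨θ, hθ, rfl⟩ hc
    have := hq _ hc
    simp only [add_sub_cancel_left, ht_add, ht_smul] at this
    nlinarith [mul_nonneg hθ.1 (mul_nonneg hn0 hw.le)]

theorem Up_subset_Up (hτ : τ ≠ 0) (hC' : IsWave τ C') (hd : Disjoint (Up τ C) C') :
    Up τ C ⊆ Up τ C' := fun p hp => by
  obtain ⟨c, -, hc⟩ := hC'.exists_max
  obtain ⟨q, hq, hq', γ, hγ⟩ := exists_joinedIn_high hτ hp (ht τ c)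
  refine ⟨q, fun c' h => (hc c' h).trans_lt hq, γ, fun t ht => disjoint_left.1 hd ?_ ht⟩
  exact ⟨q, hq', ⟨(γ.truncateOfLE (t₀ := t) (t₁ := 1) t.2.2).cast (by simp) (by simp),
    fun s => hγ _⟩⟩

theorem Low_subset_Low (hτ : τ ≠ 0) (hC' : IsWave τ C') (hd : Disjoint (Low τ C) C') :
    Low τ C ⊆ Low τ C' := Up_subset_Up (neg_ne_zero.2 hτ) hC'.neg hd

theorem add_lat_mem_Up (hC : ∀ x ∈ C, ∀ n : ℤ, x + lat (n • τ) ∈ C) {p : ℝ × ℝ}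
    (hp : p ∈ Up τ C) (n : ℤ) : p + lat (n • τ) ∈ Up τ C := by
  obtain ⟨q, hq, hj⟩ := hp
  refine ⟨q + lat (n • τ), fun c hc => by rw [ht_lat_zsmul]; exact hq c hc, ?_⟩
  obtain ⟨γ, hγ⟩ := hj
  refine ⟨γ.map (f := fun x => x + lat (n • τ)) (by fun_prop), fun t ht => hγ t ?_⟩
  have := hC _ ht (-n)
  rw [neg_smul, lat_neg] at this
  simpa using this

/-- Segments which avoid `C` do not leave the upper side. -/
theorem mem_Up_of_segment {p q : ℝ × ℝ} (hq : q ∈ Up τ C) (h : Disjoint (segment ℝ p q) C) :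
    p ∈ Up τ C :=
  mem_Up_of_joinedIn hq (JoinedIn.of_segment_subset fun _ hx hc => disjoint_left.1 h hx hc)

end UpLow

/-- Periodicity of the displacement function. -/
theorem TorusMetric.psi_periodic (M : TorusMetric) (τ κ : ℤ × ℤ) (x : ℝ × ℝ) :
    M.dist (x + lat κ) (x + lat κ + lat τ) = M.dist x (x + lat τ) := by
  rw [add_right_comm, M.dist_add_lat]

/-- The minimal displacement exists. -/
theorem TorusMetric.exists_min_displacement (M : TorusMetric) {τ : ℤ × ℤ} (hτ : τ ≠ 0) :
    ∃ q, 0 < M.dist q (q + lat τ) ∧ ∀ x, M.dist q (q + lat τ) ≤ M.dist x (x + lat τ) := by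
  have hc : Continuous fun x : ℝ × ℝ => M.dist x (x + lat τ) :=
    M.continuous_dist_comp continuous_id (by fun_prop)
  obtain ⟨q, -, hq⟩ := isCompact_Icc.exists_isMinOn (s := Icc (0 : ℝ × ℝ) 1)
    ⟨0, left_mem_Icc.2 zero_le_one⟩ hc.continuousOn
  refine ⟨q, (M.dist_nonneg _ _).lt_of_ne' fun h => ?_, fun x => ?_⟩
  · have := M.eq_of_dist_eq_zero h
    have h0 : lat τ = 0 := by simpa using this.symm
    exact (prog_lat_self_pos hτ).ne' (by rw [h0]; simp [prog])
  · obtain ⟨k, hk⟩ := exists_lat_sub_mem x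
    rw [← M.psi_periodic τ k x]
    exact hq hk

theorem TorusMetric.le_psi_neg {M : TorusMetric} {τ : ℤ × ℤ} {L : ℝ}
    (hL : ∀ x, L ≤ M.dist x (x + lat τ)) (x : ℝ × ℝ) : L ≤ M.dist x (x + lat (-τ)) := by
  rw [M.dist_comm, ← M.dist_add_lat τ, lat_neg, neg_add_cancel_right]; exact hL x

namespace TorusMetric.MinLine

variable {M : TorusMetric} {τ : ℤ × ℤ} {L : ℝ} {α : ℝ → ℝ × ℝ}

theorem range_add (h : MinLine M τ L α) (x : ℝ × ℝ) (hx : x ∈ range α) (n : ℤ) :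
    x + lat (n • τ) ∈ range α := by
  obtain ⟨t, rfl⟩ := hx
  exact ⟨t + n * L, by rw [add_int_mul_period h.per, lat_zsmul]⟩

end TorusMetric.MinLine

theorem sq_add_sq_pos {v : ℝ × ℝ} (hv : v ≠ 0) : 0 < v.1 ^ 2 + v.2 ^ 2 := by
  rcases eq_or_ne v.1 0 with h | h
  · have : v.2 ≠ 0 := fun h2 => hv (Prod.ext h h2)
    positivity
  · positivity

/-- The linear map `(a, b) ↦ a v + b J v`, where `J` is the rotation by a right angle. -/
def frame (v : ℝ × ℝ) (hv : v ≠ 0) : (ℝ × ℝ) ≃L[ℝ] (ℝ × ℝ) :=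
  ContinuousLinearEquiv.equivOfInverse
    ((ContinuousLinearMap.fst ℝ ℝ ℝ).smulRight v +
      (ContinuousLinearMap.snd ℝ ℝ ℝ).smulRight (-v.2, v.1))
    ((v.1 ^ 2 + v.2 ^ 2)⁻¹ • ((ContinuousLinearMap.fst ℝ ℝ ℝ).smulRight (v.1, -v.2) +
      (ContinuousLinearMap.snd ℝ ℝ ℝ).smulRight (v.2, v.1)))
    (fun x => by have := (sq_add_sq_pos hv).ne'; ext <;> simp <;> field_simp <;> ring)
    (fun x => by have := (sq_add_sq_pos hv).ne'; ext <;> simp <;> field_simp <;> ring)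

theorem frame_apply {v : ℝ × ℝ} (hv : v ≠ 0) (z : ℝ × ℝ) :
    frame v hv z = z.1 • v + z.2 • ((-v.2, v.1) : ℝ × ℝ) := rfl

theorem norm_rot_eq (v : ℝ × ℝ) : ‖((-v.2, v.1) : ℝ × ℝ)‖ = ‖v‖ := by
  simp [Prod.norm_def, max_comm]

namespace TorusMetric.MinLine

variable {M : TorusMetric} {τ : ℤ × ℤ} {L : ℝ} {α : ℝ → ℝ × ℝ}

/-- The normal field along a curve. -/
def nor (α : ℝ → ℝ × ℝ) (s : ℝ) : ℝ × ℝ := (-(deriv α s).2, (deriv α s).1)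

/-- Pushing a curve along its normal field. -/
def push (α : ℝ → ℝ × ℝ) (y s : ℝ) : ℝ × ℝ := α s + y • nor α s

theorem contDiff_deriv (h : MinLine M τ L α) : ContDiff ℝ (⊤ : ℕ∞) (deriv α) :=
  (contDiff_infty_iff_deriv.1 h.localGeod.contDiff).2

theorem contDiff_nor (h : MinLine M τ L α) : ContDiff ℝ (⊤ : ℕ∞) (nor α) :=
  (h.contDiff_deriv.snd.neg).prodMk h.contDiff_deriv.fst

theorem deriv_ne_zero (h : MinLine M τ L α) (s : ℝ) : deriv α s ≠ 0 := fun h0 => by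
  have := h.localGeod.nrm_deriv s
  have h2 := M.nrm_le_hi (α s) (deriv α s)
  rw [this, h0, norm_zero, mul_zero] at h2
  linarith

theorem deriv_per (h : MinLine M τ L α) (s : ℝ) : deriv α (s + L) = deriv α s := by
  rw [← deriv_comp_add_const, show (fun t => α (t + L)) = fun t => α t + lat τ from funext h.per,
    deriv_add_const]

theorem nor_per (h : MinLine M τ L α) (s : ℝ) : nor α (s + L) = nor α s := by
  rw [nor, nor, h.deriv_per]

theorem push_per (h : MinLine M τ L α) (y s : ℝ) : push α y (s + L) = push α y s + lat τ := by
  rw [push, push, h.nor_per, h.per]; abel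

theorem continuous_push (h : MinLine M τ L α) :
    Continuous fun z : ℝ × ℝ => push α z.2 z.1 := by
  have h1 := h.continuous
  have h2 := h.contDiff_nor.continuous
  unfold push
  fun_prop

theorem hasStrictFDerivAt_push (h : MinLine M τ L α) (s : ℝ) :
    HasStrictFDerivAt (fun z : ℝ × ℝ => push α z.2 z.1)
      (frame (deriv α s) (h.deriv_ne_zero s) : (ℝ × ℝ) →L[ℝ] (ℝ × ℝ)) (s, 0) := by
  have h1 : HasStrictDerivAt α (deriv α s) s :=
    (h.localGeod.contDiff.contDiffAt).hasStrictDerivAt (by simp)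
  have h2 : HasStrictDerivAt (nor α) (deriv (nor α) s) s :=
    (h.contDiff_nor.contDiffAt).hasStrictDerivAt (by simp)
  have e1 := HasStrictFDerivAt.comp (g := α) ((s, 0) : ℝ × ℝ) h1.hasStrictFDerivAt
    (hasStrictFDerivAt_fst (𝕜 := ℝ))
  have e2 := HasStrictFDerivAt.comp (g := nor α) ((s, 0) : ℝ × ℝ) h2.hasStrictFDerivAt
    (hasStrictFDerivAt_fst (𝕜 := ℝ))
  have e3 := e1.add ((hasStrictFDerivAt_snd (𝕜 := ℝ)).smul e2)
  refine e3.congr_fderiv ?_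
  ext <;> simp [frame_apply, nor]

theorem exists_bound (h : MinLine M τ L α) (hL0 : 0 < L) : ∃ K > 0,
    (∀ s, ‖deriv α s‖ ≤ K) ∧ (∀ s, ‖nor α s‖ ≤ K) ∧ ∀ s, ‖deriv (nor α) s‖ ≤ K := by
  have c2 : Continuous (deriv (nor α)) := h.contDiff_nor.continuous_deriv (by simp)
  have p2 : Function.Periodic (deriv (nor α)) L := fun s => by
    rw [← deriv_comp_add_const, show (fun t => nor α (t + L)) = nor α from funext h.nor_per]
  have p1 : Function.Periodic (deriv α) L := h.deriv_per
  obtain ⟨K1, h1⟩ := (p1.isBounded_of_continuous hL0.ne' h.contDiff_deriv.continuous).exists_norm_le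
  obtain ⟨K2, h2⟩ := (p2.isBounded_of_continuous hL0.ne' c2).exists_norm_le
  refine ⟨|K1| + |K2| + 1, by positivity, fun s => ?_, fun s => ?_, fun s => ?_⟩
  · linarith [h1 _ ⟨s, rfl⟩, le_abs_self K1, abs_nonneg K2]
  · rw [nor, norm_rot_eq]
    linarith [h1 _ ⟨s, rfl⟩, le_abs_self K1, abs_nonneg K2]
  · linarith [h2 _ ⟨s, rfl⟩, le_abs_self K2, abs_nonneg K1]

/-- The pushed curves are close to the line and almost as short. -/
theorem exists_push_bound (h : MinLine M τ L α) (hL0 : 0 < L) : ∃ K > 0,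
    (∀ y s, ‖push α y s - α s‖ ≤ K * |y|) ∧ ∀ y, M.LipD (push α y) (1 + K * |y|) := by
  obtain ⟨K, hK, k1, k2, k3⟩ := h.exists_bound hL0
  have hp : ∀ y s, ‖push α y s - α s‖ ≤ K * |y| := fun y s => by
    rw [push, add_sub_cancel_left, norm_smul, Real.norm_eq_abs, mul_comm]
    exact mul_le_mul_of_nonneg_right (k2 s) (abs_nonneg y)
  have hlip := M.lipK_pos
  have hhi := M.hi_pos
  set K' := K + M.lipK * K * K + M.hi * K with hK'
  refine ⟨K', by positivity, fun y s => (hp y s).trans ?_, fun y => ?_⟩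
  · gcongr
    rw [hK', add_assoc]
    exact le_add_of_nonneg_right (by positivity)
  have hd : ∀ t, HasDerivAt (push α y) (deriv α t + y • deriv (nor α) t) t := fun t =>
    ((h.localGeod.contDiff.differentiable (by simp) t).hasDerivAt).add
      (((h.contDiff_nor.differentiable (by simp) t).hasDerivAt).const_smul y)
  have hn : ∀ t, M.nrm (push α y t) (deriv α t + y • deriv (nor α) t) ≤ 1 + K' * |y| := by
    intro t
    have a1 := M.nrm_add_le (push α y t) (deriv α t) (y • deriv (nor α) t)
    have a2 := (abs_le.1 (M.nrm_lip (push α y t) (α t) (deriv α t))).2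
    rw [h.localGeod.nrm_deriv] at a2
    have a3 := M.nrm_le_hi (push α y t) (deriv (nor α) t)
    rw [M.nrm_smul] at a1
    have a4 : M.lipK * ‖push α y t - α t‖ * ‖deriv α t‖ ≤ M.lipK * (K * |y|) * K := by
      gcongr
      exacts [hp y t, k1 t]
    have a5 : |y| * M.nrm (push α y t) (deriv (nor α) t) ≤ |y| * (M.hi * K) := by
      gcongr
      exact a3.trans (by gcongr; exact k3 t)
    have : K' * |y| = K * |y| + M.lipK * (K * |y|) * K + |y| * (M.hi * K) := by rw [hK']; ring
    rw [this]
    have : 0 ≤ K * |y| := by positivity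
    linarith
  have hmain : ∀ s t, s ≤ t → M.dist (push α y s) (push α y t) ≤ (1 + K' * |y|) * (t - s) := by
    intro s t hst
    have c1 := h.contDiff_deriv.continuous
    have c2 : Continuous (deriv (nor α)) := h.contDiff_nor.continuous_deriv (by simp)
    have c3 : Continuous (push α y) := continuous_iff_continuousAt.2 fun t => (hd t).continuousAt
    have cv : Continuous fun t => deriv α t + y • deriv (nor α) t := by fun_prop
    refine (M.dist_le_integral hst cv.continuousOn c3.continuousOn fun t _ => hd t).trans ?_
    have := intervalIntegral.integral_mono_on (μ := MeasureTheory.volume) hst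
      ((M.continuous_nrm_comp c3 cv).intervalIntegrable s t)
      ((continuous_const (y := 1 + K' * |y|)).intervalIntegrable s t) fun t _ => hn t
    rw [intervalIntegral.integral_const, smul_eq_mul, mul_comm (t - s)] at this
    exact this
  intro s t
  rcases le_total s t with hst | hst
  · rw [abs_sub_comm, abs_of_nonneg (sub_nonneg.2 hst)]; exact hmain s t hst
  · rw [abs_of_nonneg (sub_nonneg.2 hst), M.dist_comm]; exact hmain t s hst

/-- Thin tubes around a minimal line are embedded. -/
theorem exists_push_notMem (h : MinLine M τ L α) (hL0 : 0 < L) :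
    ∃ y₀ > 0, ∀ y s, |y| < y₀ → push α y s ∈ range α → y = 0 := by
  obtain ⟨K, hK, hp, -⟩ := h.exists_push_bound hL0
  have hloc : ∀ s ∈ Icc 0 L, ∀ᶠ z : ℝ × ℝ in 𝓝 (0, s), push α z.1 z.2 ∈ range α → z.1 = 0 := by
    intro s _
    have hs := h.hasStrictFDerivAt_push s
    obtain ⟨r, hr, hball⟩ := Metric.eventually_nhds_iff_ball.1 hs.eventually_left_inverse
    have hc : Continuous fun z : ℝ × ℝ => M.hi * (K * |z.1|) := by fun_prop
    have e1 : ∀ᶠ z : ℝ × ℝ in 𝓝 (0, s), M.hi * (K * |z.1|) < r / 2 :=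
      hc.continuousAt.eventually_lt continuousAt_const (by simpa using hr)
    filter_upwards [e1, Metric.ball_mem_nhds _ (half_pos hr)] with z hz1 hz2
    rintro ⟨t, ht⟩
    rw [Metric.mem_ball, Prod.dist_eq, max_lt_iff] at hz2
    have d1 : |z.2 - t| < r / 2 := by
      rw [← h.dist_eq, ht, M.dist_comm]
      refine ((M.dist_le_hi_mul _ _).trans ?_).trans_lt hz1
      exact mul_le_mul_of_nonneg_left (hp _ _) M.hi_pos.le
    have m1 : ((z.2, z.1) : ℝ × ℝ) ∈ Metric.ball ((s, 0) : ℝ × ℝ) r := by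
      rw [Metric.mem_ball, Prod.dist_eq, max_lt_iff]
      exact ⟨by simpa using hz2.2.trans (half_lt_self hr), hz2.1.trans (half_lt_self hr)⟩
    have m2 : ((t, 0) : ℝ × ℝ) ∈ Metric.ball ((s, 0) : ℝ × ℝ) r := by
      rw [Metric.mem_ball, Prod.dist_eq, max_lt_iff]
      refine ⟨?_, by simpa using hr⟩
      have := hz2.2
      simp only [Real.dist_eq] at this ⊢
      rw [abs_lt] at *
      constructor <;> linarith
    have i1 := hball _ m1
    have i2 := hball _ m2
    have e : push α (z.2, z.1).2 (z.2, z.1).1 = push α ((t, 0) : ℝ × ℝ).2 ((t, 0) : ℝ × ℝ).1 := by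
      simp only [ht.symm]
      simp [push]
    rw [e, i2] at i1
    exact (congrArg Prod.snd i1).symm
  have hev := isCompact_Icc.eventually_forall_of_forall_eventually
    (P := fun y s => push α y s ∈ range α → y = 0) hloc
  obtain ⟨y₀, hy₀, hball⟩ := Metric.eventually_nhds_iff_ball.1 hev
  refine ⟨y₀, hy₀, fun y s hy hm => ?_⟩
  have b1 := (le_div_iff₀ hL0).1 (Int.floor_le (s / L))
  have b2 := (div_lt_iff₀ hL0).1 (Int.lt_floor_add_one (s / L))
  refine hball y (by simpa using hy) (s - ⌊s / L⌋ * L) ⟨by linarith, by linarith⟩ ?_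
  have a1 := add_int_mul_period (h.push_per y) ⌊s / L⌋ (s - ⌊s / L⌋ * L)
  rw [sub_add_cancel] at a1
  have := h.range_add _ hm (-⌊s / L⌋)
  rw [a1, neg_smul, lat_neg, lat_zsmul, add_neg_cancel_right] at this
  exact this

theorem eventually_mem_push (h : MinLine M τ L α) {y₀ : ℝ} (hy₀ : 0 < y₀) (s : ℝ) :
    ∀ᶠ x in 𝓝 (α s), ∃ y s', |y| < y₀ ∧ push α y s' = x := by
  have hs := h.hasStrictFDerivAt_push s
  have e : push α 0 s = α s := by simp [push]
  have := hs.map_nhds_eq_of_equiv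
  simp only [e] at this
  rw [← this, eventually_map]
  have hb : ∀ᶠ z : ℝ × ℝ in 𝓝 (s, 0), |z.2| < y₀ :=
    (continuous_snd.abs.continuousAt (x := ((s, 0) : ℝ × ℝ))).eventually_lt continuousAt_const
      (by simpa using hy₀)
  filter_upwards [hb] with z hz
  exact ⟨z.2, z.1, hz, rfl⟩

/-- The two halves of a thin tube. -/
theorem subset_of_isOpen (h : MinLine M τ L α) {y₀ : ℝ} (hy₀ : 0 < y₀)
    (hpush : ∀ y s, |y| < y₀ → push α y s ∈ range α → y = 0) {O : Set (ℝ × ℝ)} (hO : IsOpen O)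
    (hO' : IsOpen ((range α)ᶜ \ O)) (hsub : O ⊆ (range α)ᶜ) (hne : O.Nonempty) :
    (∀ y s, 0 < y → y < y₀ → push α y s ∈ O) ∨ ∀ y s, 0 < y → y < y₀ → push α (-y) s ∈ O := by
  have hncl : ¬ IsClosed O := fun hcl => by
    rcases isClopen_iff.1 ⟨hcl, hO⟩ with h1 | h1
    · exact hne.ne_empty h1
    · exact hsub (h1 ▸ mem_univ (α 0)) ⟨0, rfl⟩
  obtain ⟨x, hx, hxO⟩ : ∃ x ∈ closure O, x ∉ O := by
    by_contra! hcon
    exact hncl (isClosed_of_closure_subset hcon)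
  have hxC : x ∈ range α := by
    by_contra hxC
    obtain ⟨z, hz1, hz2⟩ := mem_closure_iff.1 hx _ hO' ⟨hxC, hxO⟩
    exact hz1.2 hz2
  obtain ⟨s, rfl⟩ := hxC
  obtain ⟨z, hzO, y, s', hy, rfl⟩ :=
    ((mem_closure_iff_frequently.1 hx).and_eventually (h.eventually_mem_push hy₀ s)).exists
  have hy0 : y ≠ 0 := fun hy0 => hsub hzO ⟨s', by simp [push, hy0]⟩
  have key : ∀ D : Set (ℝ × ℝ), IsPreconnected D → (∀ w ∈ D, w.2 ≠ 0 ∧ |w.2| < y₀) →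
      (s', y) ∈ D → ∀ w ∈ D, push α w.2 w.1 ∈ O := by
    intro D hD hDy hm w hw
    have hI := hD.image _ h.continuous_push.continuousOn
    have hsubI : (fun z : ℝ × ℝ => push α z.2 z.1) '' D ⊆ (range α)ᶜ := by
      rintro _ ⟨w, hw, rfl⟩ hmem
      exact (hDy w hw).1 (hpush _ _ (hDy w hw).2 hmem)
    refine hI.subset_left_of_subset_union hO hO' disjoint_sdiff_right
      (fun v hv => ?_) ⟨_, mem_image_of_mem _ hm, hzO⟩ (mem_image_of_mem _ hw)
    by_cases hvO : v ∈ O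
    · exact Or.inl hvO
    · exact Or.inr ⟨hsubI hv, hvO⟩
  rcases hy0.lt_or_gt with hneg | hpos
  · right
    intro y' t h1 h2
    refine key (univ ×ˢ Ioo (-y₀) 0) (isPreconnected_univ.prod isPreconnected_Ioo)
      (fun w hw => ⟨hw.2.2.ne, abs_lt.2 ⟨hw.2.1, hw.2.2.trans hy₀⟩⟩)
      ⟨mem_univ _, (abs_lt.1 hy).1, hneg⟩ (t, -y') ⟨mem_univ _, ?_, ?_⟩
    · exact neg_lt_neg h2
    · exact neg_neg_of_pos h1
  · left
    intro y' t h1 h2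
    exact key (univ ×ˢ Ioo 0 y₀) (isPreconnected_univ.prod isPreconnected_Ioo)
      (fun w hw => ⟨hw.2.1.ne', abs_lt.2 ⟨by linarith [hw.2.1], hw.2.2⟩⟩)
      ⟨mem_univ _, hpos, (abs_lt.1 hy).2⟩ (t, y') ⟨mem_univ _, h1, h2⟩

theorem Up_nonempty (h : MinLine M τ L α) (hτ : τ ≠ 0) (hL0 : 0 < L) :
    (Up τ (range α)).Nonempty := by
  obtain ⟨c, -, hc⟩ := (h.isWave hL0).exists_max
  refine ⟨c + rot τ, mem_Up_of_forall_lt fun c' hc' => (hc c' hc').trans_lt ?_⟩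
  rw [ht_add]
  linarith [ht_rot_pos hτ]

/-- A minimal line separates the plane into its upper and its lower side, and the upper side
contains one half of a thin tube around the line. -/
theorem separation (h : MinLine M τ L α) (hτ : τ ≠ 0) (hL0 : 0 < L) :
    (∀ x ∉ range α, x ∈ Up τ (range α) ∨ x ∈ Low τ (range α)) ∧
    ∃ y₀ > 0, (∀ y s, 0 < y → y < y₀ → push α y s ∈ Up τ (range α)) ∨
      ∀ y s, 0 < y → y < y₀ → push α (-y) s ∈ Up τ (range α) := by
  have hw := h.isWave hL0
  have hcl := hw.isClosed hτ
  obtain ⟨y₀, hy₀, hpush⟩ := h.exists_push_notMem hL0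
  have hd := hw.disjoint_Up_Low hτ
  have o1 := isOpen_Up (τ := τ) hcl
  have o2 : IsOpen (Low τ (range α)) := isOpen_Up (τ := -τ) hcl
  have hU := h.subset_of_isOpen hy₀ hpush o1 (isOpen_compl_diff_Up hcl) Up_subset_compl
    (h.Up_nonempty hτ hL0)
  have hL := h.subset_of_isOpen hy₀ hpush o2 (isOpen_compl_diff_Up (τ := -τ) hcl)
    Low_subset_compl (by
      have := h.neg.Up_nonempty (neg_ne_zero.2 hτ) hL0
      rwa [show range (fun t => α (-t)) = range α from (Equiv.neg ℝ).surjective.range_comp α]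
        at this)
  refine ⟨fun x hx => ?_, y₀, hy₀, hU⟩
  by_contra! hcon
  have hR := h.subset_of_isOpen hy₀ hpush
    (O := ((range α)ᶜ \ Up τ (range α)) ∩ ((range α)ᶜ \ Low τ (range α)))
    ((isOpen_compl_diff_Up hcl).inter (isOpen_compl_diff_Up (τ := -τ) hcl)) (by
      have : (range α)ᶜ \ (((range α)ᶜ \ Up τ (range α)) ∩ ((range α)ᶜ \ Low τ (range α))) =
          Up τ (range α) ∪ Low τ (range α) := by
        ext z
        have i1 := @Up_subset_compl τ (range α) z
        have i2 := @Low_subset_compl τ (range α) z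
        simp only [Set.mem_sdiff, mem_inter_iff, mem_union, mem_compl_iff] at i1 i2 ⊢
        tauto
      rw [this]
      exact o1.union o2) (fun z hz => hz.1.1) ⟨x, ⟨hx, hcon.1⟩, hx, hcon.2⟩
  have hy1 : 0 < y₀ / 2 := half_pos hy₀
  have hy2 : y₀ / 2 < y₀ := half_lt_self hy₀
  have nUL : ∀ z, z ∈ Up τ (range α) → z ∈ Low τ (range α) → False := fun z =>
    fun hz => disjoint_left.1 hd hz
  rcases hU with hU | hU <;> rcases hL with hL | hL <;> rcases hR with hR | hR <;>
    first
    | exact nUL _ (hU _ 0 hy1 hy2) (hL _ 0 hy1 hy2)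
    | exact (hR _ 0 hy1 hy2).1.2 (hU _ 0 hy1 hy2)
    | exact (hR _ 0 hy1 hy2).2.2 (hL _ 0 hy1 hy2)

end TorusMetric.MinLine

theorem abs_ht_le (τ : ℤ × ℤ) (q : ℝ × ℝ) :
    |ht τ q| ≤ (|(τ.1 : ℝ)| + |(τ.2 : ℝ)|) * ‖q‖ := by
  have h1 : |q.1| ≤ ‖q‖ := norm_fst_le q
  have h2 : |q.2| ≤ ‖q‖ := norm_snd_le q
  calc |ht τ q| ≤ |(τ.1 : ℝ)| * |q.2| + |(τ.2 : ℝ)| * |q.1| := by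
        rw [← abs_mul, ← abs_mul]; exact abs_sub _ _
    _ ≤ |(τ.1 : ℝ)| * ‖q‖ + |(τ.2 : ℝ)| * ‖q‖ := by gcongr
    _ = _ := by ring

theorem ht_sub (τ : ℤ × ℤ) (p q : ℝ × ℝ) : ht τ (p - q) = ht τ p - ht τ q := by
  simp only [ht, Prod.fst_sub, Prod.snd_sub]; ring

namespace TorusMetric

variable {M : TorusMetric} {τ : ℤ × ℤ} {L : ℝ} {α β : ℝ → ℝ × ℝ}

theorem continuousOn_eval_lipD (D : ℝ) :
    ContinuousOn (fun z : (ℝ → ℝ × ℝ) × ℝ => z.1 z.2) {z | M.LipD z.1 D} := by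
  intro z₀ _
  rw [ContinuousWithinAt, tendsto_iff_dist_tendsto_zero]
  have hc : Continuous fun z : (ℝ → ℝ × ℝ) × ℝ =>
      D / M.lo * |z.2 - z₀.2| + Dist.dist (z.1 z₀.2) (z₀.1 z₀.2) := by fun_prop
  have h0 := (hc.tendsto z₀).mono_left (nhdsWithin_le_nhds (s := {z | M.LipD z.1 D}))
  simp only [sub_self, abs_zero, mul_zero, _root_.dist_self, add_zero] at h0
  refine squeeze_zero' (Eventually.of_forall fun _ => _root_.dist_nonneg) ?_ h0
  filter_upwards [self_mem_nhdsWithin] with z hz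
  refine (_root_.dist_triangle _ (z.1 z₀.2) _).trans (add_le_add_left ?_ _)
  rw [dist_eq_norm]
  exact LipD.norm_sub_le M hz _ _

namespace MinLine

theorem abs_ht_sub_le (h : MinLine M τ L α) (hL0 : 0 < L) (t : ℝ) :
    |ht τ (α t) - ht τ (α 0)| ≤ (|(τ.1 : ℝ)| + |(τ.2 : ℝ)|) * (1 / M.lo * L) := by
  have b1 := (le_div_iff₀ hL0).1 (Int.floor_le (t / L))
  have b2 := (div_lt_iff₀ hL0).1 (Int.lt_floor_add_one (t / L))
  have a1 := add_int_mul_period h.per ⌊t / L⌋ (t - ⌊t / L⌋ * L)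
  rw [sub_add_cancel] at a1
  rw [a1, ← lat_zsmul, ht_lat_zsmul, ← ht_sub]
  refine (abs_ht_le τ _).trans ?_
  gcongr
  refine (LipD.norm_sub_le M h.lipD _ _).trans ?_
  have := M.lo_pos
  gcongr
  rw [sub_zero, abs_of_nonneg] <;> linarith

/-- Points above a minimal line are above all nearby minimal lines. -/
theorem eventually_mem_Up (hτ : τ ≠ 0) (hL0 : 0 < L) (hL : ∀ x, L ≤ M.dist x (x + lat τ))
    (h : MinLine M τ L α) {p : ℝ × ℝ} (hp : p ∈ Up τ (range α)) :
    ∀ᶠ x in 𝓝 (α 0), ∀ β, MinLine M τ L β → β 0 = x → p ∈ Up τ (range β) := by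
  set K := Metric.closedBall (α 0) 1 with hK
  have hKc : IsCompact K := isCompact_closedBall _ _
  set c := |(τ.1 : ℝ)| + |(τ.2 : ℝ)| with hc
  have hnK : ∀ x ∈ K, ‖x‖ ≤ ‖α 0‖ + 1 := fun x hx => by
    have h1 := norm_sub_norm_le x (α 0)
    rw [hK, mem_closedBall_iff_norm] at hx
    linarith
  obtain ⟨q, hq, -, γ, hγ⟩ := exists_joinedIn_high hτ hp (c * (1 / M.lo * L) + c * (‖α 0‖ + 1))
  have hΓ : IsCompact (range γ) := isCompact_range γ.continuous
  obtain ⟨B, hB⟩ := hΓ.isBounded.exists_norm_le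
  set R := M.hi * (‖α 0‖ + 1 + B) with hR
  set 𝒦 := {f : ℝ → ℝ × ℝ | f 0 ∈ K ∧ M.LipD f 1} with h𝒦
  have hcomp : IsCompact (𝒦 ×ˢ Icc (-R) R) := (M.isCompact_lipD hKc 1).prod isCompact_Icc
  have hcl1 : IsClosed ((𝒦 ×ˢ Icc (-R) R) ∩ (fun z : (ℝ → ℝ × ℝ) × ℝ => z.1 z.2) ⁻¹' range γ) :=
    ((continuousOn_eval_lipD (M := M) 1).mono fun z hz => hz.1.2).preimage_isClosed_of_isClosed
      hcomp.isClosed hΓ.isClosed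
  have hcl2 : IsClosed {z : (ℝ → ℝ × ℝ) × ℝ | (∀ a b, a ≤ b → M.dist (z.1 a) (z.1 b) = b - a) ∧
      ∀ t, z.1 (t + L) = z.1 t + lat τ} := by
    simp only [ofPred_and, ofPred_forall]
    refine IsClosed.inter (isClosed_iInter fun a => isClosed_iInter fun b => isClosed_iInter
      fun _ => isClosed_eq (M.continuous_dist_comp (by fun_prop) (by fun_prop)) continuous_const)
      (isClosed_iInter fun t => isClosed_eq (by fun_prop) (by fun_prop))
  have hT := (hcomp.of_isClosed_subset (hcl1.inter hcl2) fun z hz => hz.1.1).image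
    (show Continuous fun z : (ℝ → ℝ × ℝ) × ℝ => z.1 0 by fun_prop)
  have hn : α 0 ∉ (fun z : (ℝ → ℝ × ℝ) × ℝ => z.1 0) ''
      (((𝒦 ×ˢ Icc (-R) R) ∩ (fun z : (ℝ → ℝ × ℝ) × ℝ => z.1 z.2) ⁻¹' range γ) ∩
      {z : (ℝ → ℝ × ℝ) × ℝ | (∀ a b, a ≤ b → M.dist (z.1 a) (z.1 b) = b - a) ∧
      ∀ t, z.1 (t + L) = z.1 t + lat τ}) := by
    rintro ⟨⟨f, t⟩, ⟨⟨-, s, hs⟩, hf1, hf2⟩, hf0⟩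
    have hfl : MinLine M τ L f := ⟨fun a b s _ t _ hst => hf1 s t hst, hf2⟩
    have hfα := eq_of_eq hτ hL0 hL hfl h hf0
    have := hγ s
    simp only at hs
    rw [hs, hfα] at this
    exact this ⟨t, rfl⟩
  filter_upwards [hT.isClosed.isOpen_compl.mem_nhds hn, Metric.closedBall_mem_nhds (α 0) one_pos]
    with x hx hxK β hβ hβx
  have hβK : β 0 ∈ K := hβx ▸ hxK
  refine ⟨q, ?_, γ, fun s hs => ?_⟩
  · rintro _ ⟨t, rfl⟩
    have h1 := (abs_le.1 (hβ.abs_ht_sub_le hL0 t)).2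
    have h2 := (le_abs_self _).trans (abs_ht_le τ (β 0))
    have h3 : c * ‖β 0‖ ≤ c * (‖α 0‖ + 1) := by gcongr; exact hnK _ hβK
    linarith
  · obtain ⟨t, ht⟩ := hs
    refine hx ⟨(β, t), ⟨⟨⟨⟨hβK, hβ.lipD⟩, ?_⟩, s, ht.symm⟩,
      fun a b hab => hβ.iso a b a ⟨le_rfl, hab⟩ b ⟨hab, le_rfl⟩ hab, hβ.per⟩, hβx⟩
    refine abs_le.1 ?_
    have h1 : |t| = M.dist (β t) (β 0) := by rw [hβ.dist_eq, sub_zero]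
    rw [h1]
    refine (M.dist_le_hi_mul _ _).trans ?_
    have h2 := norm_sub_le (β t) (β 0)
    have h3 := hB (β t) ⟨s, ht.symm⟩
    have h4 := hnK _ hβK
    have := M.hi_pos
    rw [hR]
    gcongr
    linarith

theorem range_neg_eq (α : ℝ → ℝ × ℝ) : range (fun t => α (-t)) = range α :=
  (Equiv.neg ℝ).surjective.range_comp α

theorem eventually_mem_Low (hτ : τ ≠ 0) (hL0 : 0 < L) (hL : ∀ x, L ≤ M.dist x (x + lat τ))
    (h : MinLine M τ L α) {p : ℝ × ℝ} (hp : p ∈ Low τ (range α)) :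
    ∀ᶠ x in 𝓝 (α 0), ∀ β, MinLine M τ L β → β 0 = x → p ∈ Low τ (range β) := by
  have := eventually_mem_Up (neg_ne_zero.2 hτ) hL0 (le_psi_neg hL) h.neg
    (p := p) (by rwa [range_neg_eq])
  simp only [neg_zero] at this
  filter_upwards [this] with x hx β hβ h0
  have := hx _ hβ.neg (by simpa using h0)
  rwa [range_neg_eq] at this

/-- Among the minimal lines below `p` there is a highest one. -/
theorem exists_top (hτ : τ ≠ 0) (hL0 : 0 < L) (hL : ∀ x, L ≤ M.dist x (x + lat τ))
    (hex : ∃ α, MinLine M τ L α) {p : ℝ × ℝ} (hp : L < M.dist p (p + lat τ)) :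
    ∃ α, MinLine M τ L α ∧ p ∈ Up τ (range α) ∧ ∀ β, MinLine M τ L β → p ∈ Up τ (range β) →
      range β = range α ∨ range β ⊆ Low τ (range α) := by
  have hpn : ∀ β, MinLine M τ L β → p ∉ range β := by
    rintro β hβ ⟨t, rfl⟩
    exact hp.ne' (hβ.dist_lat hL0 t)
  have hw := ht_rot_pos hτ
  set w := rot τ with hwd
  set c := |(τ.1 : ℝ)| + |(τ.2 : ℝ)| with hc
  set S := {r : ℝ | ∃ β, MinLine M τ L β ∧ p ∈ Up τ (range β) ∧ β 0 = p + r • w} with hS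
  have hpc : Continuous fun x : ℝ × ℝ => M.dist x (x + lat τ) :=
    M.continuous_dist_comp continuous_id (by fun_prop)
  have hrc : Continuous fun r : ℝ => p + r • w := by fun_prop
  have hScl : IsClosed S := by
    refine isClosed_of_closure_subset fun r hr => ?_
    have hψ : M.dist (p + r • w) (p + r • w + lat τ) = L := by
      have hcl : IsClosed {r : ℝ | M.dist (p + r • w) (p + r • w + lat τ) = L} :=
        isClosed_eq (hpc.comp hrc) continuous_const
      refine hcl.closure_subset_iff.2 ?_ hr
      rintro r ⟨β, hβ, -, h0⟩
      rw [mem_ofPred_eq, ← h0, hβ.dist_lat hL0]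
    obtain ⟨α, hα, hα0⟩ := exists_minLine hτ hL0 hL hψ
    refine ⟨α, hα, ?_, hα0⟩
    refine ((hα.separation hτ hL0).1 p (hpn α hα)).resolve_right fun hlow => ?_
    have hev := eventually_mem_Low hτ hL0 hL hα hlow
    rw [hα0] at hev
    obtain ⟨r', ⟨β, hβ, hβp, hβ0⟩, hr'⟩ :=
      ((mem_closure_iff_frequently.1 hr).and_eventually (hrc.continuousAt.eventually hev)).exists
    exact disjoint_left.1 ((hβ.isWave hL0).disjoint_Up_Low hτ) hβp (hr' β hβ hβ0)
  have hSbdd : BddAbove S := by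
    refine ⟨c * (1 / M.lo * L) / ht τ w, ?_⟩
    rintro r ⟨β, hβ, hβp, hβ0⟩
    rw [le_div_iff₀ hw]
    by_contra! hlt
    refine disjoint_left.1 ((hβ.isWave hL0).disjoint_Up_Low hτ) hβp
      (mem_Up_of_forall_lt ?_)
    rintro _ ⟨t, rfl⟩
    have h1 := (abs_le.1 (hβ.abs_ht_sub_le hL0 t)).1
    rw [hβ0, ht_add, ht_smul] at h1
    rw [ht_neg, ht_neg, neg_lt_neg_iff]
    linarith
  have hcross : ∀ β, MinLine M τ L β → ∃ r t : ℝ, β t = p + r • w := by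
    intro β hβ
    have hpp := prog_lat_self_pos hτ
    have hcont : Continuous fun t => prog τ (β t) := (continuous_prog τ).comp hβ.continuous
    have hval : ∀ n : ℤ, prog τ (β (n * L)) = prog τ (β 0) + n * prog τ (lat τ) := fun n => by
      have := add_int_mul_period hβ.per n 0
      rw [zero_add] at this
      rw [this, prog_add, prog_smul]
    set m : ℤ := ⌊(prog τ p - prog τ (β 0)) / prog τ (lat τ)⌋
    have b1 := (le_div_iff₀ hpp).1 (Int.floor_le ((prog τ p - prog τ (β 0)) / prog τ (lat τ)))
    have b2 := (div_lt_iff₀ hpp).1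
      (Int.lt_floor_add_one ((prog τ p - prog τ (β 0)) / prog τ (lat τ)))
    have hle : (m : ℝ) * L ≤ ((m + 1 : ℤ) : ℝ) * L := by push_cast; nlinarith
    obtain ⟨t, -, hpt⟩ := intermediate_value_Icc hle hcont.continuousOn
      (show prog τ p ∈ Icc _ _ by
        rw [hval, hval]; push_cast; exact ⟨by linarith, by linarith⟩)
    refine ⟨(ht τ (β t) - ht τ p) / ht τ w, t, ?_⟩
    have hwv : ht τ w = τ.1 * τ.1 + τ.2 * τ.2 := by simp [hwd, rot, _root_.ht]
    have e : ∀ x y : ℝ × ℝ, prog τ x = prog τ y → ht τ x = ht τ y → x = y := by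
      intro x y h1 h2
      have hne : (τ.1 * τ.1 + τ.2 * τ.2 : ℝ) ≠ 0 := hwv ▸ hw.ne'
      simp only [prog, _root_.ht] at h1 h2
      ext
      · apply mul_left_cancel₀ hne; linear_combination τ.1 * h1 - τ.2 * h2
      · apply mul_left_cancel₀ hne; linear_combination τ.2 * h1 + τ.1 * h2
    apply e
    · rw [prog_add, prog_smul, ← hpt]
      have : prog τ w = 0 := by simp only [hwd, rot, prog]; ring
      rw [this]; ring
    · rw [ht_add, ht_smul, div_mul_cancel₀ _ hw.ne']; ring
  have hSne : S.Nonempty := by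
    obtain ⟨α, hα⟩ := hex
    obtain ⟨n, hn⟩ := exists_nat_gt ((c * (1 / M.lo * L) + ht τ (α 0) - ht τ p) / ht τ w)
    rw [div_lt_iff₀ hw] at hn
    have hlatw : lat (-(-τ.2, τ.1)) = -w := by
      simp [lat, hwd, rot]
    have hβ := hα.add_lat ((n : ℤ) • (-(-τ.2, τ.1)))
    have hval : ∀ t, α t + lat ((n : ℤ) • (-(-τ.2, τ.1))) = α t - (n : ℝ) • w := fun t => by
      rw [lat_zsmul, hlatw, smul_neg, sub_eq_add_neg]; norm_cast
    simp only [hval] at hβ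
    obtain ⟨r, t, hrt⟩ := hcross _ hβ
    refine ⟨r, _, hβ.shift t, ?_, by simpa using hrt⟩
    refine mem_Up_of_forall_lt ?_
    rintro _ ⟨s, rfl⟩
    have h1 := (abs_le.1 (hα.abs_ht_sub_le hL0 (s + t))).2
    simp only [ht_sub, ht_smul]
    linarith
  obtain ⟨hmem, hub⟩ := hScl.isGreatest_csSup hSne hSbdd
  obtain ⟨α, hα, hαp, hα0⟩ := hmem
  refine ⟨α, hα, hαp, fun β hβ hβp => ?_⟩
  rcases disjoint_or_eq hτ hL0 hL hα hβ with hd | he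
  swap
  · exact Or.inl he.symm
  rcases (hα.isWave hL0).trichotomy hτ (hβ.isWave hL0) hd with ⟨-, h2⟩ | ⟨h1, -⟩
  swap
  · exact Or.inr h1
  exfalso
  refine disjoint_left.1 ((hβ.isWave hL0).disjoint_Up_Low hτ) ?_ (h2 ⟨0, rfl⟩)
  obtain ⟨b, -, hb⟩ := (hβ.isWave hL0).exists_max
  obtain ⟨n, hn⟩ := exists_nat_gt ((ht τ b - ht τ (α 0)) / ht τ w)
  rw [div_lt_iff₀ hw] at hn
  refine mem_Up_of_segment (q := α 0 + (n : ℝ) • w) (mem_Up_of_forall_lt fun c' hc' => ?_) ?_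
  · rw [ht_add, ht_smul]; linarith [hb c' hc']
  · rw [disjoint_left, segment_eq_image']
    rintro _ ⟨θ, hθ, rfl⟩ ⟨t, ht⟩
    simp only [add_sub_cancel_left] at ht
    have hmem : sSup S + θ * n ∈ S := by
      refine ⟨_, hβ.shift t, ?_, ?_⟩
      · have : range (fun s => β (s + t)) = range β :=
          (Equiv.addRight t).surjective.range_comp β
        rwa [this]
      · simp only [zero_add, ht, hα0]
        rw [add_smul, mul_smul, add_assoc]
    have h3 := hub hmem
    have h4 : θ * n ≤ 0 := by linarith
    have h5 : θ * n = 0 := le_antisymm h4 (mul_nonneg hθ.1 n.cast_nonneg)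
    rw [← mul_smul, h5, zero_smul, add_zero] at ht
    exact disjoint_left.1 hd ⟨0, rfl⟩ ⟨t, ht⟩

/-- Around a point which is on no minimal line, there is a gap between minimal lines. -/
theorem exists_gap (hτ : τ ≠ 0) (hL0 : 0 < L) (hL : ∀ x, L ≤ M.dist x (x + lat τ))
    (hex : ∃ α, MinLine M τ L α) {p : ℝ × ℝ} (hp : L < M.dist p (p + lat τ)) :
    ∃ α β, MinLine M τ L α ∧ MinLine M τ L β ∧ range β ⊆ Up τ (range α) ∧
      range α ⊆ Low τ (range β) ∧ ∀ f, MinLine M τ L f → range f = range α ∨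
        range f ⊆ Low τ (range α) ∨ range f = range β ∨ range f ⊆ Up τ (range β) := by
  obtain ⟨α, hα, hαp, hα'⟩ := exists_top hτ hL0 hL hex hp
  have hex' : ∃ α, MinLine M (-τ) L α := by
    obtain ⟨α, hα⟩ := hex
    exact ⟨_, hα.neg⟩
  have hp' : L < M.dist p (p + lat (-τ)) := by
    have := M.psi_periodic τ (-τ) p
    rw [← this, lat_neg', neg_add_cancel_right, M.dist_comm, ← lat_neg'] at hp
    exact hp
  obtain ⟨β₀, hβ₀, hβp, hβ'⟩ := exists_top (neg_ne_zero.2 hτ) hL0 (le_psi_neg hL) hex' hp'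
  have hβ : MinLine M τ L fun t => β₀ (-t) := by simpa using hβ₀.neg
  have hr : range (fun t => β₀ (-t)) = range β₀ := range_neg_eq β₀
  rw [← hr] at hβp hβ'
  set β := fun t => β₀ (-t)
  have hd : Disjoint (range α) (range β) := by
    refine (disjoint_or_eq hτ hL0 hL hα hβ).resolve_right fun he => ?_
    rw [← he] at hβp
    exact disjoint_left.1 ((hα.isWave hL0).disjoint_Up_Low hτ) hαp hβp
  have key : range β ⊆ Up τ (range α) ∧ range α ⊆ Low τ (range β) := by
    refine ((hα.isWave hL0).trichotomy hτ (hβ.isWave hL0) hd).resolve_right fun ⟨h1, h2⟩ => ?_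
    refine disjoint_left.1 ((hβ.isWave hL0).disjoint_Up_Low hτ) ?_ hβp
    refine Up_subset_Up hτ (hβ.isWave hL0) ?_ hαp
    exact ((hα.isWave hL0).disjoint_Up_Low hτ).mono_right h1
  refine ⟨α, β, hα, hβ, key.1, key.2, fun f hf => ?_⟩
  have hpf : p ∉ range f := by
    rintro ⟨t, rfl⟩
    exact hp.ne' (hf.dist_lat hL0 t)
  rcases (hf.separation hτ hL0).1 p hpf with h | h
  · rcases hα' f hf h with h | h
    · exact Or.inl h
    · exact Or.inr (Or.inl h)
  · have := hβ' _ hf.neg (by rwa [range_neg_eq])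
    rw [range_neg_eq, Low_neg] at this
    exact Or.inr (Or.inr this)

end MinLine

end TorusMetric

section UpLow

variable {τ : ℤ × ℤ} {C : Set (ℝ × ℝ)}

theorem infDist_add_lat (hC : ∀ x ∈ C, ∀ n : ℤ, x + lat (n • τ) ∈ C) (x : ℝ × ℝ) (n : ℤ) :
    Metric.infDist (x + lat (n • τ)) C = Metric.infDist x C := by
  have key : ∀ (x : ℝ × ℝ) (n : ℤ), Metric.infDist (x + lat (n • τ)) C ≤ Metric.infDist x C := by
    intro x n
    rcases C.eq_empty_or_nonempty with rfl | hne
    · simp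
    refine (Metric.le_infDist hne).2 fun {y} hy => ?_
    refine (Metric.infDist_le_dist_of_mem (hC y hy n)).trans ?_
    simp
  refine (key x n).antisymm ?_
  have h := key (x + lat (n • τ)) (-n)
  rwa [add_assoc, neg_smul, lat_neg', add_neg_cancel, add_zero] at h

theorem exists_abs_ht_le_of_infDist {C : Set (ℝ × ℝ)} (hCc : IsClosed C) (hne : C.Nonempty)
    {H : ℝ} (hH : ∀ c ∈ C, |ht τ c| ≤ H) (r : ℝ) :
    ∃ H', ∀ x, Metric.infDist x C ≤ r → |ht τ x| ≤ H' := by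
  refine ⟨H + (|(τ.1 : ℝ)| + |(τ.2 : ℝ)|) * r, fun x hx => ?_⟩
  obtain ⟨c, hc, hxc⟩ := hCc.exists_infDist_eq_dist hne x
  have h1 := abs_ht_le τ (x - c)
  rw [ht_sub, ← dist_eq_norm, ← hxc] at h1
  have h2 := abs_sub_abs_le_abs_sub (ht τ x) (ht τ c)
  have h3 := hH c hc
  have h4 : (|(τ.1 : ℝ)| + |(τ.2 : ℝ)|) * Metric.infDist x C ≤
    (|(τ.1 : ℝ)| + |(τ.2 : ℝ)|) * r := by gcongr
  linarith

theorem exists_excursion {c : ℝ → ℝ × ℝ} {l t : ℝ} {U : Set (ℝ × ℝ)}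
    (hc : ContinuousOn c (Icc 0 l)) (hU : IsOpen U) (ht : t ∈ Icc 0 l) (h0 : c 0 ∉ U)
    (hl : c l ∉ U) (htU : c t ∈ U) : ∃ u v, 0 ≤ u ∧ u < t ∧ t < v ∧ v ≤ l ∧ c u ∉ U ∧ c v ∉ U ∧
      ∀ s ∈ Ioo u v, c s ∈ U := by
  have hK := hc.preimage_isClosed_of_isClosed isClosed_Icc hU.isClosed_compl
  obtain ⟨u, ⟨hu, hu2⟩, hu'⟩ := ((isCompact_Icc (a := (0 : ℝ)) (b := t)).inter_right
    hK).exists_isGreatest ⟨0, ⟨le_rfl, ht.1⟩, ⟨le_rfl, ht.1.trans ht.2⟩, h0⟩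
  obtain ⟨v, ⟨hv, hv2⟩, hv'⟩ := ((isCompact_Icc (a := t) (b := l)).inter_right
    hK).exists_isLeast ⟨l, ⟨ht.2, le_rfl⟩, ⟨ht.1.trans ht.2, le_rfl⟩, hl⟩
  refine ⟨u, v, hu.1, hu.2.lt_of_ne fun h => hu2.2 (h ▸ htU),
    hv.1.lt_of_ne fun h => hv2.2 (h ▸ htU), hv.2, hu2.2, hv2.2, fun s hs => ?_⟩
  by_contra hsU
  have hs0 : s ∈ Icc 0 l := ⟨hu.1.trans hs.1.le, hs.2.le.trans hv.2⟩
  rcases le_total s t with h | h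
  · exact hs.1.not_ge (hu' ⟨⟨hs0.1, h⟩, hs0, hsU⟩)
  · exact hs.2.not_ge (hv' ⟨⟨h, hs0.2⟩, hs0, hsU⟩)

/-- The boundary of the upper region of `C` is part of `C`. -/
theorem mem_of_frontier_Up (hC : IsClosed C) {x : ℝ × ℝ} (h1 : x ∈ closure (Up τ C))
    (h2 : x ∉ Up τ C) : x ∈ C := by
  by_contra hx
  obtain ⟨y, hy, hy'⟩ := mem_closure_iff.1 h1 _ (isOpen_compl_diff_Up (τ := τ) hC) ⟨hx, h2⟩
  exact hy.2 hy'

end UpLow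

namespace TorusMetric

variable {M : TorusMetric} {τ : ℤ × ℤ} {L : ℝ} {α : ℝ → ℝ × ℝ}

namespace MinLine

/-- A shortest loop in an annulus next to a minimal line. -/
theorem exists_trap_loop (hτ : τ ≠ 0) (hL0 : 0 < L) (hL : ∀ x, L ≤ M.dist x (x + lat τ))
    (h : MinLine M τ L α) {δ : ℝ} (hδ : 0 < δ)
    (hgap : ∀ x ∈ Up τ (range α), M.dist x (x + lat τ) = L → δ < Metric.infDist x (range α))
    (hside : ∃ y₀ > 0, (∀ y s, 0 < y → y < y₀ → push α y s ∈ Up τ (range α)) ∨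
      ∀ y s, 0 < y → y < y₀ → push α (-y) s ∈ Up τ (range α)) :
    ∃ (γ : ℝ → ℝ × ℝ) (D η : ℝ), 0 < η ∧ L ≤ D ∧ D ≤ 3 / 2 * L ∧ M.LipD γ D ∧
      (∀ t, γ (t + 1) = γ t + lat τ) ∧
      (∀ t, γ t ∉ Low τ (range α) ∧ η ≤ Metric.infDist (γ t) (range α) ∧
        Metric.infDist (γ t) (range α) < δ / 2) ∧
      ∀ (f : ℝ → ℝ × ℝ) (D' : ℝ), M.LipD f D' → (∀ t, f (t + 1) = f t + lat τ) →
        (∀ t, f t ∉ Low τ (range α) ∧ η ≤ Metric.infDist (f t) (range α) ∧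
          Metric.infDist (f t) (range α) ≤ δ) → D ≤ D' := by
  set C := range α with hC
  have hw : IsWave τ C := h.isWave hL0
  have hCc : IsClosed C := hw.isClosed hτ
  have hper : ∀ x ∈ C, ∀ n : ℤ, x + lat (n • τ) ∈ C := fun x hx n => h.range_add x hx n
  have hper' : ∀ x ∈ C, ∀ n : ℤ, x + lat (n • -τ) ∈ C := fun x hx n => by
    rw [smul_neg, ← neg_smul]; exact hper x hx _
  have hlow : ∀ x (n : ℤ), x ∈ Low τ C → x + lat (n • τ) ∈ Low τ C := fun x n hx => by
    have := add_lat_mem_Up hper' hx (-n)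
    rwa [neg_smul, smul_neg, neg_neg] at this
  have hlow' : ∀ x (n : ℤ), x ∉ Low τ C → x + lat (n • τ) ∉ Low τ C := fun x n hx hx' => by
    have := hlow _ (-n) hx'
    rw [add_assoc, neg_smul, lat_neg', add_neg_cancel, add_zero] at this
    exact hx this
  have hlowo : IsOpen (Low τ C) := isOpen_Up hCc
  have hψc : Continuous fun x : ℝ × ℝ => M.dist x (x + lat τ) :=
    M.continuous_dist_comp continuous_id (by fun_prop)
  have hic : Continuous fun x : ℝ × ℝ => Metric.infDist x C := Metric.continuous_infDist_pt C
  obtain ⟨H₀, hH₀⟩ := hw.exists_abs_ht_le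
  obtain ⟨H, hH⟩ := exists_abs_ht_le_of_infDist hCc hw.nonempty hH₀ δ
  have hin : ∀ x, 0 < Metric.infDist x C → x ∉ C := fun x hx hx' => by
    rw [Metric.infDist_zero_of_mem hx'] at hx; exact hx.false
  obtain ⟨ε, hε, hεQ⟩ := exists_pos_le_of_periodic hτ
    (Q := {x | x ∉ Low τ C ∧ δ / 2 ≤ Metric.infDist x C ∧ Metric.infDist x C ≤ δ})
    (hlowo.isClosed_compl.inter ((isClosed_le continuous_const hic).inter
      (isClosed_le hic continuous_const)))
    (fun x hx n => ⟨hlow' x n hx.1, by rw [infDist_add_lat hper]; exact hx.2.1,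
      by rw [infDist_add_lat hper]; exact hx.2.2⟩) (fun x hx => hH x hx.2.2)
    (φ := fun x => M.dist x (x + lat τ) - L) (hψc.sub continuous_const)
    (fun x n => by rw [M.psi_periodic])
    (fun x ⟨hx1, hx2, hx3⟩ => by
      refine sub_pos.2 ((hL x).lt_of_ne fun he => ?_)
      refine (hgap x ?_ he.symm).not_ge hx3
      exact ((h.separation hτ hL0).1 x (hin x (by linarith))).resolve_right hx1)
  obtain ⟨K, hK, hK1, hK2⟩ := h.exists_push_bound hL0
  obtain ⟨y₀, hy₀, hside⟩ := hside
  obtain ⟨y, hy0, hy1⟩ : ∃ y > 0, y < min y₀ (min (ε / (L * K)) (min (δ / 2 / K) (1 / 2 / K))) :=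
    exists_between (by positivity)
  simp only [lt_min_iff, lt_div_iff₀ hK, lt_div_iff₀ (mul_pos hL0 hK)] at hy1
  obtain ⟨hyy₀, hy2, hy3, hy4⟩ := hy1
  obtain ⟨z, hz, hzU⟩ : ∃ z, |z| = y ∧ ∀ s, push α z s ∈ Up τ C := by
    rcases hside with hs | hs
    · exact ⟨y, abs_of_pos hy0, fun s => hs y s hy0 hyy₀⟩
    · exact ⟨-y, by rw [abs_neg, abs_of_pos hy0], fun s => hs y s hy0 hyy₀⟩
  set f₀ : ℝ → ℝ × ℝ := fun t => push α z (L * t) with hf₀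
  have hf₀L : M.LipD f₀ (L * (1 + K * y)) := fun s t => by
    refine (hK2 z _ _).trans ?_
    rw [← mul_sub, abs_mul, abs_of_pos hL0, hz]
    exact le_of_eq (by ring)
  have hf₀p : ∀ t, f₀ (t + 1) = f₀ t + lat τ := fun t => by
    simp only [hf₀, mul_add, mul_one, h.push_per]
  have hf₀w : IsWave τ (range f₀) :=
    isWave_of_lipD hf₀L one_pos one_pos (fun t => by rw [hf₀p]; simp)
  have hwper : ∀ {f : ℝ → ℝ × ℝ}, (∀ t, f (t + 1) = f t + lat τ) → ∀ (t : ℝ) (n : ℤ),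
      f t + lat (n • τ) = f (t + n) := fun hf t n => by
    have := add_int_mul_period hf n t
    rw [mul_one] at this
    rw [this, lat_zsmul]
  obtain ⟨H₁, hH₁⟩ := hf₀w.exists_abs_ht_le
  obtain ⟨η, hη, hηf⟩ := exists_pos_le_of_periodic hτ (hf₀w.isClosed hτ)
    (by rintro _ ⟨t, rfl⟩ n; exact ⟨t + n, (hwper hf₀p t n).symm⟩) hH₁ hic
    (fun x n => infDist_add_lat hper x n) (by
      rintro _ ⟨t, rfl⟩
      exact (hCc.notMem_iff_infDist_pos hw.nonempty).1 (Up_subset_compl (hzU _)))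
  have hf₀d : ∀ t, Metric.infDist (f₀ t) C < δ / 2 := fun t => by
    refine (Metric.infDist_le_dist_of_mem (mem_range_self (L * t))).trans_lt ?_
    rw [dist_eq_norm]
    refine (hK1 z _).trans_lt ?_
    rw [hz, mul_comm]; exact hy3
  set S := {f : ℝ → ℝ × ℝ | (∀ t, f (t + 1) = f t + lat τ) ∧
    ∀ t, f t ∉ Low τ C ∧ η ≤ Metric.infDist (f t) C ∧ Metric.infDist (f t) C ≤ δ} with hS
  have hScl : IsClosed S := by
    simp only [hS, ofPred_and, ofPred_forall]
    refine IsClosed.inter (isClosed_iInter fun t => isClosed_eq (by fun_prop) (by fun_prop))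
      (isClosed_iInter fun t => IsClosed.inter ?_ (IsClosed.inter ?_ ?_))
    · exact hlowo.isClosed_compl.preimage
        (show Continuous fun f : ℝ → ℝ × ℝ => f t from continuous_apply t)
    · exact isClosed_le continuous_const (hic.comp (continuous_apply t))
    · exact isClosed_le (hic.comp (continuous_apply t)) continuous_const
  have hSD : ∀ f ∈ S, ∀ D', M.LipD f D' → L ≤ D' := fun f hf D' hfD => by
    have h1 := hfD 0 1
    have h2 := hf.1 0
    rw [zero_add] at h2
    rw [h2, zero_sub, abs_neg, abs_one, mul_one] at h1
    exact (hL _).trans h1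
  set 𝒟 := {D' | ∃ f ∈ S, M.LipD f D'} with h𝒟
  have hf₀S : f₀ ∈ S := ⟨hf₀p, fun t =>
    ⟨fun hl => disjoint_left.1 (hw.disjoint_Up_Low hτ) (hzU _) hl, hηf _ ⟨t, rfl⟩,
      by linarith [hf₀d t]⟩⟩
  have h𝒟b : BddBelow 𝒟 := ⟨L, fun D' ⟨f, hf, hfD⟩ => hSD f hf D' hfD⟩
  have h𝒟n : 𝒟.Nonempty := ⟨_, f₀, hf₀S, hf₀L⟩
  obtain ⟨γ, hγS, -, hγD⟩ := M.exists_lipD_of_forall_lt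
    (isCompact_strip hτ (prog τ (lat τ)) H) hScl (D := sInf 𝒟) fun D' hD' => by
      obtain ⟨D'', ⟨f, hf, hfD⟩, hlt⟩ := exists_lt_of_csInf_lt h𝒟n hD'
      obtain ⟨n, hn1, hn2⟩ := exists_zsmul_prog_mem hτ (f 0)
      rw [hwper hf.1] at hn1 hn2
      refine ⟨fun t => f (t + n), ⟨fun t => ?_, fun t => hf.2 _⟩,
        ⟨by simpa using hn1, by simpa using hn2, ?_⟩, fun s t => ?_⟩
      · rw [← hf.1 (t + n), add_right_comm]
      · exact hH _ (hf.2 _).2.2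
      · refine (hfD _ _).trans ?_
        rw [add_sub_add_right_eq_sub]
        gcongr
  have hDle : sInf 𝒟 ≤ L * (1 + K * y) := csInf_le h𝒟b ⟨f₀, hf₀S, hf₀L⟩
  refine ⟨γ, sInf 𝒟, η, hη, hSD γ hγS _ hγD, ?_, hγD, hγS.1, fun t => ?_,
    fun f D' hfD hfp hf => csInf_le h𝒟b ⟨f, ⟨hfp, hf⟩, hfD⟩⟩
  · nlinarith
  · obtain ⟨h1, h2, h3⟩ := hγS.2 t
    refine ⟨h1, h2, ?_⟩
    by_contra! h4
    have h5 := hεQ _ ⟨h1, h4, h3⟩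
    simp only [← hγS.1 t] at h5
    have h6 := hγD t (t + 1)
    rw [sub_add_cancel_left, abs_neg, abs_one, mul_one] at h6
    nlinarith

/-- There is a periodic curve above `α` and close to `α` such that the region below it is convex
for short minimal arcs. -/
theorem exists_trap (hτ : τ ≠ 0) (hL0 : 0 < L) (hL : ∀ x, L ≤ M.dist x (x + lat τ))
    (h : MinLine M τ L α) {δ : ℝ} (hδ : 0 < δ)
    (hgap : ∀ x ∈ Up τ (range α), M.dist x (x + lat τ) = L → δ < Metric.infDist x (range α)) :
    ∃ (Γ : Set (ℝ × ℝ)) (ρ : ℝ), IsWave τ Γ ∧ (∀ x ∈ Γ, ∀ n : ℤ, x + lat (n • τ) ∈ Γ) ∧ 0 < ρ ∧ Γ ⊆ Up τ (range α) ∧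
      (∀ x ∈ Γ, Metric.infDist x (range α) < δ / 2) ∧ (Up τ (range α))ᶜ ⊆ Low τ Γ ∧
      ∀ (c : ℝ → ℝ × ℝ) (l : ℝ), l ≤ ρ → M.IsoOn c 0 l → c 0 ∉ Up τ Γ → c l ∉ Up τ Γ →
        ∀ t ∈ Icc 0 l, c t ∉ Up τ Γ := by
  obtain ⟨hsep, hside⟩ := h.separation hτ hL0
  obtain ⟨γ, D, η, hη, hLD, hDL, hγD, hγp, hγ, hmin⟩ :=
    h.exists_trap_loop hτ hL0 hL hδ hgap hside
  obtain ⟨ρ₀, hρ₀, huniq⟩ := M.exists_unique_radius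
  set C := range α with hC
  have hD0 : 0 < D := hL0.trans_le hLD
  have hlo := M.lo_pos
  have hw : IsWave τ C := h.isWave hL0
  have hCc : IsClosed C := hw.isClosed hτ
  have hΓ : IsWave τ (range γ) :=
    isWave_of_lipD hγD one_pos one_pos (fun t => by rw [hγp]; simp)
  have hΓc : IsClosed (range γ) := hΓ.isClosed hτ
  have hper : ∀ x ∈ C, ∀ n : ℤ, x + lat (n • τ) ∈ C := fun x hx n => h.range_add x hx n
  have hin : ∀ x, 0 < Metric.infDist x C → x ∉ C := fun x hx hx' => by
    rw [Metric.infDist_zero_of_mem hx'] at hx; exact hx.false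
  have hΓU : range γ ⊆ Up τ C := by
    rintro _ ⟨t, rfl⟩
    exact (hsep _ (hin _ (hη.trans_le (hγ t).2.1))).resolve_right (hγ t).1
  have hCL : C ⊆ Low τ (range γ) := by
    refine ((hw.trichotomy hτ hΓ ?_).resolve_right fun ⟨h1, _⟩ => ?_).2
    · exact disjoint_left.2 fun x hx hx' => Up_subset_compl (hΓU hx') hx
    · exact (hγ 0).1 (h1 ⟨0, rfl⟩)
  have hUL : (Up τ C)ᶜ ⊆ Low τ (range γ) := by
    intro x hx
    by_cases hxC : x ∈ C
    · exact hCL hxC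
    · refine Low_subset_Low hτ hΓ ?_ ((hsep x hxC).resolve_left hx)
      exact disjoint_left.2 fun x hx hx' =>
        disjoint_left.1 (hw.disjoint_Up_Low hτ) (hΓU hx') hx
  have hUΓ : ∀ x ∈ Up τ (range γ), x ∉ Low τ C ∧ η ≤ Metric.infDist x C := by
    intro x hx
    have hxL := fun hx' => disjoint_left.1 (hΓ.disjoint_Up_Low hτ) hx hx'
    have hxU : x ∈ Up τ C := by
      by_contra hx'
      exact hxL (hUL hx')
    refine ⟨fun hx' => disjoint_left.1 (hw.disjoint_Up_Low hτ) hxU hx', ?_⟩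
    by_contra! hlt
    obtain ⟨a, ha, hxa⟩ := hCc.exists_infDist_eq_dist hw.nonempty x
    refine hxL (mem_Up_of_segment (hCL ha) (disjoint_left.2 ?_))
    rintro _ hz ⟨t, rfl⟩
    have h1 := (hγ t).2.1
    have h2 := Metric.infDist_le_dist_of_mem (x := γ t) ha
    rw [segment_symm] at hz
    have h3 := mem_closedBall_iff_norm.1 ((convex_closedBall a (Dist.dist x a)).segment_subset
      (Metric.mem_closedBall_self _root_.dist_nonneg)
      (Metric.mem_closedBall.2 le_rfl) hz)
    rw [dist_eq_norm] at h2
    linarith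
  have key : ∀ (e : ℝ → ℝ × ℝ) (w a b : ℝ), 0 ≤ w → w ≤ ρ₀ → w ≤ L / 4 → M.IsoOn e 0 w →
      e 0 = γ a → e w = γ b → a ≤ b → (∀ s ∈ Icc 0 w, e s ∉ Low τ C ∧
        η ≤ Metric.infDist (e s) C ∧ Metric.infDist (e s) C ≤ δ) →
      ∀ s ∈ Icc 0 w, e s ∈ range γ := by
    intro e w a b hw0 hwρ hwL he hea heb hab hreg
    have hwd : M.dist (γ a) (γ b) = w := by
      rw [← hea, ← heb, he 0 ⟨le_rfl, hw0⟩ w ⟨hw0, le_rfl⟩ hw0, sub_zero]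
    have hwD : w ≤ D * (b - a) := by
      have := hγD a b
      rwa [hwd, abs_sub_comm, abs_of_nonneg (sub_nonneg.2 hab)] at this
    have hγn : ∀ (n : ℤ) t, γ (t + n) = γ t + lat (n • τ) := fun n t => by
      have := add_int_mul_period hγp n t
      rwa [mul_one, ← lat_zsmul] at this
    have hlt : b - a < 1 := by
      by_contra! hge
      set m := ⌊b - a⌋
      have hm1 : (m : ℝ) ≤ b - a := Int.floor_le _
      have hm2 : b - a < m + 1 := Int.lt_floor_add_one _
      have hm : (1 : ℝ) ≤ m := by exact_mod_cast Int.le_floor.2 (by simpa using hge)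
      have h1 := dist_lat_ge hτ hL0.le hL (m + 1) (γ a)
      rw [← hγn] at h1
      have h2 := M.dist_triangle (γ a) (γ b) (γ (a + (m + 1 : ℤ)))
      have h3 := hγD b (a + (m + 1 : ℤ))
      rw [hwd] at h2
      push_cast at h1 h2 h3
      rw [abs_of_nonneg (by linarith)] at h1
      have h4 : |b - (a + (m + 1))| ≤ 1 := by rw [abs_le]; constructor <;> linarith
      have h5 := mul_le_mul_of_nonneg_left h4 hD0.le
      nlinarith
    set T := w + D * (1 - (b - a)) with hT
    have hT0 : 0 < T := by have := mul_pos hD0 (sub_pos.2 hlt); linarith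
    set e' : ℝ → ℝ × ℝ := fun s => if s ≤ w then e s else γ (b + (s - w) / D) with he'
    have hwT : w < T := by have := mul_pos hD0 (sub_pos.2 hlt); linarith
    have e'T : e' T = e' 0 + lat τ := by
      simp only [he', if_neg hwT.not_ge, if_pos hw0, hea, ← hγp]
      congr 1
      rw [hT]
      field_simp
      ring
    have hγsh : ∀ s t : ℝ, s ≤ t → M.dist (γ (b + (s - w) / D)) (γ (b + (t - w) / D)) ≤ t - s := by
      intro s t hst
      refine (hγD _ _).trans (le_of_eq ?_)
      have : b + (s - w) / D - (b + (t - w) / D) = -((t - s) / D) := by ring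
      rw [this, abs_neg, abs_of_nonneg (div_nonneg (sub_nonneg.2 hst) hD0.le)]
      field_simp
    have e'L : ∀ s t : ℝ, 0 ≤ s → s ≤ t → t ≤ T → M.dist (e' s) (e' t) ≤ 1 * (t - s) := by
      intro s t hs hst _
      rw [one_mul]
      rcases le_or_gt t w with h1 | h1
      · simp only [he', if_pos h1, if_pos (hst.trans h1)]
        exact (he s ⟨hs, hst.trans h1⟩ t ⟨hs.trans hst, h1⟩ hst).le
      rcases le_or_gt s w with h2 | h2
      · simp only [he', if_neg h1.not_ge, if_pos h2]
        have h3 := hγsh w t h1.le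
        rw [sub_self, zero_div, add_zero, ← heb] at h3
        have h4 := he s ⟨hs, h2⟩ w ⟨hw0, le_rfl⟩ h2
        linarith [M.dist_triangle (e s) (e w) (γ (b + (t - w) / D))]
      · simp only [he', if_neg h1.not_ge, if_neg h2.not_ge]
        exact hγsh s t hst
    have e'reg : ∀ s, 0 ≤ s → e' s ∉ Low τ C ∧
        η ≤ Metric.infDist (e' s) C ∧ Metric.infDist (e' s) C ≤ δ := by
      intro s hs
      rcases le_or_gt s w with h2 | h2
      · simp only [he', if_pos h2]; exact hreg s ⟨hs, h2⟩
      · simp only [he', if_neg h2.not_ge]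
        exact ⟨(hγ _).1, (hγ _).2.1, by linarith [(hγ (b + (s - w) / D)).2.2]⟩
    have hDT : D ≤ T := by
      refine hmin (fun t => perExt e' T (lat τ) (T * t)) T (fun s t => ?_) (fun t => ?_)
        (fun t => ?_)
      · have := lipD_perExt hT0 e'T e'L (T * s) (T * t)
        rwa [one_mul, ← mul_sub, abs_mul, abs_of_pos hT0] at this
      · rw [mul_add, mul_one, perExt_add hT0]
      · rw [perExt, ← lat_zsmul]
        obtain ⟨h1, h2, h3⟩ := e'reg (T * t - ⌊T * t / T⌋ * T)
          (by have := (le_div_iff₀ hT0).1 (Int.floor_le (T * t / T)); linarith)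
        refine ⟨fun h4 => h1 ?_, ?_, ?_⟩
        · have hper' : ∀ x ∈ C, ∀ n : ℤ, x + lat (n • -τ) ∈ C := fun x hx n => by
            rw [smul_neg, ← neg_smul]; exact hper x hx _
          have := add_lat_mem_Up hper' h4 ⌊T * t / T⌋
          rwa [smul_neg, lat_neg', add_neg_cancel_right] at this
        · rwa [infDist_add_lat hper]
        · rwa [infDist_add_lat hper]
    have hwe : w = D * (b - a) := by linarith
    have hg1 : ∀ s t : ℝ, s ≤ t → M.dist (γ (a + s / D)) (γ (a + t / D)) ≤ t - s := by
      intro s t hst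
      refine (hγD _ _).trans (le_of_eq ?_)
      have : a + s / D - (a + t / D) = -((t - s) / D) := by ring
      rw [this, abs_neg, abs_of_nonneg (div_nonneg (sub_nonneg.2 hst) hD0.le)]
      field_simp
    have hgb : a + w / D = b := by rw [hwe]; field_simp; ring
    have hg : M.IsoOn (fun s => γ (a + s / D)) 0 w := by
      intro s hs t ht hst
      refine (hg1 s t hst).antisymm ?_
      have h1 := hg1 0 s hs.1
      have h2 := hg1 t w ht.2
      have h3 := M.dist_triangle (γ (a + 0 / D)) (γ (a + s / D)) (γ (a + w / D))
      have h4 := M.dist_triangle (γ (a + s / D)) (γ (a + t / D)) (γ (a + w / D))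
      have h5 : M.dist (γ (a + 0 / D)) (γ (a + w / D)) = w := by
        rw [hgb, zero_div, add_zero, hwd]
      linarith
    intro s hs
    rw [huniq e _ w hwρ he hg (by simp [hea]) (by simp only [heb, hgb]) s hs]
    exact ⟨_, rfl⟩
  refine ⟨range γ, min ρ₀ (min (L / 4) (δ / 2 * M.lo)), hΓ, ?_, by positivity, hΓU, ?_, hUL, ?_⟩
  · rintro _ ⟨t, rfl⟩ n
    have := add_int_mul_period hγp n t
    exact ⟨t + n, by rwa [mul_one, ← lat_zsmul] at this⟩
  · rintro _ ⟨t, rfl⟩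
    exact (hγ t).2.2
  intro c l hl hc h0 h1 t ht htU
  simp only [le_min_iff] at hl
  obtain ⟨hl1, hl2, hl3⟩ := hl
  obtain ⟨u, v, hu0, hut, htv, hvl, hu, hv, huv⟩ :=
    exists_excursion hc.continuousOn (isOpen_Up hΓc) ht h0 h1 htU
  have hlu : u < v := hut.trans htv
  have hcl : ∀ s ∈ Icc u v, c s ∈ closure (Up τ (range γ)) := by
    intro s hs
    rw [← closure_Ioo hlu.ne] at hs
    have hcu : ContinuousOn c (closure (Ioo u v)) := hc.continuousOn.mono <| by
      rw [closure_Ioo hlu.ne]; exact Icc_subset_Icc hu0 hvl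
    have him : c '' Ioo u v ⊆ Up τ (range γ) := image_subset_iff.2 fun s hs => huv s hs
    exact closure_mono him (hcu.image_closure (mem_image_of_mem c hs))
  obtain ⟨a, ha⟩ := mem_of_frontier_Up hΓc (hcl u ⟨le_rfl, hlu.le⟩) hu
  obtain ⟨b, hb⟩ := mem_of_frontier_Up hΓc (hcl v ⟨hlu.le, le_rfl⟩) hv
  have hcuv : M.IsoOn c u v := hc.mono hu0 hvl
  have hreg : ∀ s ∈ Icc u v, c s ∉ Low τ C ∧
        η ≤ Metric.infDist (c s) C ∧ Metric.infDist (c s) C ≤ δ := by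
    intro s hs
    have hd : Metric.infDist (c s) C ≤ δ := by
      have h2 := Metric.infDist_le_infDist_add_dist (s := C) (x := c s) (y := c u)
      have h3 := hcuv.norm_sub_le hs ⟨le_rfl, hlu.le⟩
      rw [← dist_eq_norm] at h3
      have h4 := (hγ a).2.2
      rw [ha] at h4
      have h5 : |s - u| / M.lo ≤ δ / 2 := by
        rw [div_le_iff₀ hlo, abs_of_nonneg (sub_nonneg.2 hs.1)]
        linarith [hs.2]
      linarith
    rcases hs.1.eq_or_lt with h2 | h2
    · rw [← h2, ← ha]; exact ⟨(hγ a).1, (hγ a).2.1, by linarith [(hγ a).2.2]⟩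
    rcases hs.2.eq_or_lt with h3 | h3
    · rw [h3, ← hb]; exact ⟨(hγ b).1, (hγ b).2.1, by linarith [(hγ b).2.2]⟩
    obtain ⟨h4, h5⟩ := hUΓ _ (huv s ⟨h2, h3⟩)
    exact ⟨h4, h5, hd⟩
  refine Up_subset_compl htU ?_
  rcases le_total a b with hab | hab
  · have := key (fun s => c (s + u)) (v - u) a b (by linarith) (by linarith) (by linarith)
      (by simpa using hcuv.shift u) (by simp [ha]) (by simp [hb]) hab
      (fun s hs => hreg _ ⟨by linarith [hs.1], by linarith [hs.2]⟩) (t - u)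
      ⟨by linarith, by linarith⟩
    simpa using this
  · have := key (fun s => c (v - s)) (v - u) b a (by linarith) (by linarith) (by linarith)
      (by simpa [sub_eq_add_neg, add_comm] using hcuv.reverse.shift (-v)) (by simp [hb]) (by simp [ha]) hab
      (fun s hs => hreg _ ⟨by linarith [hs.2], by linarith [hs.1]⟩) (v - t)
      ⟨by linarith, by linarith⟩
    simpa using this

end MinLine

end TorusMetric

section UpLow

variable {τ : ℤ × ℤ} {C C' U : Set (ℝ × ℝ)}

theorem add_lat_notMem_Up (hC : ∀ x ∈ C, ∀ n : ℤ, x + lat (n • τ) ∈ C) {p : ℝ × ℝ}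
    (hp : p ∉ Up τ C) (n : ℤ) : p + lat (n • τ) ∉ Up τ C := fun h => by
  have := add_lat_mem_Up hC h (-n)
  rw [add_assoc, neg_smul, lat_neg', add_neg_cancel, add_zero] at this
  exact hp this

theorem add_lat_notMem_Low (hC : ∀ x ∈ C, ∀ n : ℤ, x + lat (n • τ) ∈ C) {p : ℝ × ℝ}
    (hp : p ∉ Low τ C) (n : ℤ) : p + lat (n • τ) ∉ Low τ C := by
  have hC' : ∀ x ∈ C, ∀ n : ℤ, x + lat (n • -τ) ∈ C := fun x hx n => by
    rw [smul_neg, ← neg_smul]; exact hC x hx _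
  have := add_lat_notMem_Up hC' hp (-n)
  rwa [neg_smul, smul_neg, neg_neg] at this

theorem exists_pos_le_infDist (hτ : τ ≠ 0) (hC : IsWave τ C)
    (hper : ∀ x ∈ C, ∀ n : ℤ, x + lat (n • τ) ∈ C) (hU : IsOpen U)
    (hUper : ∀ x ∉ U, ∀ n : ℤ, x + lat (n • τ) ∉ U) (hCU : C ⊆ U) :
    ∃ ε > 0, ∀ x ∉ U, ε ≤ Metric.infDist x C := by
  have hCc := hC.isClosed hτ
  have hic : Continuous fun x : ℝ × ℝ => Metric.infDist x C := Metric.continuous_infDist_pt C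
  obtain ⟨H₀, hH₀⟩ := hC.exists_abs_ht_le
  obtain ⟨H, hH⟩ := exists_abs_ht_le_of_infDist hCc hC.nonempty hH₀ 1
  obtain ⟨ε, hε, h⟩ := exists_pos_le_of_periodic hτ (Q := {x | x ∉ U ∧ Metric.infDist x C ≤ 1})
    (hU.isClosed_compl.inter (isClosed_le hic continuous_const))
    (fun x hx n => ⟨hUper x hx.1 n, by rw [infDist_add_lat hper]; exact hx.2⟩)
    (fun x hx => hH x hx.2) hic (fun x n => infDist_add_lat hper x n)
    (fun x hx => (hCc.notMem_iff_infDist_pos hC.nonempty).1 fun h => hx.1 (hCU h))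
  refine ⟨min ε 1, by positivity, fun x hx => ?_⟩
  by_contra! hlt
  rw [lt_min_iff] at hlt
  exact hlt.1.not_ge (h x ⟨hx, hlt.2.le⟩)

theorem dist_le_of_mem_segment {x a z : ℝ × ℝ} (hz : z ∈ segment ℝ x a) :
    dist z a ≤ dist x a :=
  (convex_closedBall a (dist x a)).segment_subset (Metric.mem_closedBall.2 le_rfl)
    (Metric.mem_closedBall_self dist_nonneg) hz

/-- Every point is above the lower one of two nested waves or below the upper one. -/
theorem mem_Up_or_mem_Low (hτ : τ ≠ 0) (hC : IsWave τ C) (h1 : C' ⊆ Up τ C) (h2 : C ⊆ Low τ C')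
    (x : ℝ × ℝ) : x ∈ Up τ C ∨ x ∈ Low τ C' := by
  refine or_iff_not_imp_left.2 fun hx => ?_
  obtain ⟨b, -, hb⟩ := hC.exists_max
  obtain ⟨n, hn⟩ := exists_nat_gt ((ht τ b - ht τ x) / ht τ (rot τ))
  rw [div_lt_iff₀ (ht_rot_pos hτ)] at hn
  set c : ℝ → ℝ × ℝ := fun t => x + t • rot τ with hc
  have hcc : Continuous c := by fun_prop
  have hseg : ∀ t, 0 ≤ t → ∀ z ∈ segment ℝ x (c t), ∃ s ∈ Icc 0 t, z = c s := by
    intro t ht z hz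
    rw [segment_eq_image'] at hz
    obtain ⟨θ, hθ, rfl⟩ := hz
    refine ⟨θ * t, ⟨mul_nonneg hθ.1 ht, mul_le_of_le_one_left ht hθ.2⟩, ?_⟩
    simp only [hc, add_sub_cancel_left, mul_smul]
  have hq : c n ∈ Up τ C := mem_Up_of_forall_lt fun c' hc' => by
    simp only [hc]
    rw [ht_add, ht_smul]
    linarith [hb c' hc']
  have hne : ((Icc (0 : ℝ) n) ∩ c ⁻¹' C).Nonempty := by
    by_contra hne
    refine hx (mem_Up_of_segment hq (disjoint_left.2 fun z hz hzC => hne ?_))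
    obtain ⟨s, hs, rfl⟩ := hseg n n.cast_nonneg z hz
    exact ⟨s, hs, hzC⟩
  obtain ⟨t, ⟨ht, htC⟩, hmin⟩ := (isCompact_Icc.inter_right
    ((hC.isClosed hτ).preimage hcc)).exists_isLeast hne
  refine mem_Up_of_segment (h2 htC) (disjoint_left.2 fun z hz hzC' => ?_)
  obtain ⟨s, hs, rfl⟩ := hseg t ht.1 z hz
  refine hx (mem_Up_of_segment (h1 hzC') (disjoint_left.2 fun z hz hzC => ?_))
  obtain ⟨r, hr, rfl⟩ := hseg s hs.1 z hz
  have hrt : t = r :=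
    (hmin ⟨⟨hr.1, hr.2.trans (hs.2.trans ht.2)⟩, hzC⟩).antisymm (hr.2.trans hs.2)
  have hst : t = s := (hrt.trans_le hr.2).antisymm hs.2
  rw [← hst] at hzC'
  exact Up_subset_compl (h1 hzC') htC

end UpLow

namespace TorusMetric

variable {M : TorusMetric} {τ : ℤ × ℤ} {L : ℝ} {α : ℝ → ℝ × ℝ}

variable (M τ L) in
/-- Two nested waves bounding a region which the displacement of `τ` is larger than `L` on, with
the regions outside of it being convex for short minimal arcs. -/
structure Barrier (Γ Γ' : Set (ℝ × ℝ)) (ρ ξ : ℝ) : Prop where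
  wave : IsWave τ Γ
  wave' : IsWave τ Γ'
  per : ∀ x ∈ Γ, ∀ n : ℤ, x + lat (n • τ) ∈ Γ
  per' : ∀ x ∈ Γ', ∀ n : ℤ, x + lat (n • τ) ∈ Γ'
  ρ_pos : 0 < ρ
  lt : L < ξ
  le : ξ ≤ 2 * L
  convex : ∀ (c : ℝ → ℝ × ℝ) (l : ℝ), l ≤ ρ → M.IsoOn c 0 l → c 0 ∉ Up τ Γ → c l ∉ Up τ Γ →
    ∀ t ∈ Icc 0 l, c t ∉ Up τ Γ
  convex' : ∀ (c : ℝ → ℝ × ℝ) (l : ℝ), l ≤ ρ → M.IsoOn c 0 l → c 0 ∉ Low τ Γ' → c l ∉ Low τ Γ' →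
    ∀ t ∈ Icc 0 l, c t ∉ Low τ Γ'
  cover : ∀ x, x ∈ Up τ Γ ∨ x ∈ Low τ Γ'
  disp : ∀ x, x ∉ Low τ Γ → x ∉ Up τ Γ' → ξ ≤ M.dist x (x + lat τ)
  exists_line : ∃ α, MinLine M τ L α ∧ range α ⊆ Low τ Γ

theorem exists_barrier (hτ : τ ≠ 0) (hL0 : 0 < L) (hL : ∀ x, L ≤ M.dist x (x + lat τ))
    (hex : ∃ α, MinLine M τ L α) {p : ℝ × ℝ} (hp : L < M.dist p (p + lat τ)) :
    ∃ Γ Γ' ρ ξ, Barrier M τ L Γ Γ' ρ ξ := by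
  obtain ⟨α, β, hα, hβ, hβα, hαβ, hall⟩ := MinLine.exists_gap hτ hL0 hL hex hp
  set A := range α with hA
  set B := range β with hB
  have wA : IsWave τ A := hα.isWave hL0
  have wB : IsWave τ B := hβ.isWave hL0
  have pA : ∀ x ∈ A, ∀ n : ℤ, x + lat (n • τ) ∈ A := fun x hx n => hα.range_add x hx n
  have pB : ∀ x ∈ B, ∀ n : ℤ, x + lat (n • τ) ∈ B := fun x hx n => hβ.range_add x hx n
  have cA := wA.isClosed hτ
  have cB := wB.isClosed hτ
  have hline : ∀ x, M.dist x (x + lat τ) = L → x ∉ Up τ A ∨ x ∉ Low τ B := by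
    intro x hx
    obtain ⟨f, hf, hfx⟩ := exists_minLine hτ hL0 hL hx
    have hxf : x ∈ range f := ⟨0, hfx⟩
    rcases hall f hf with h | h | h | h
    · exact Or.inl fun h' => Up_subset_compl h' (h ▸ hxf)
    · exact Or.inl fun h' => disjoint_left.1 (wA.disjoint_Up_Low hτ) h' (h hxf)
    · exact Or.inr fun h' => Low_subset_compl h' (h ▸ hxf)
    · exact Or.inr fun h' => disjoint_left.1 (wB.disjoint_Up_Low hτ) (h hxf) h'
  obtain ⟨ε₁, hε₁, h₁⟩ := exists_pos_le_infDist hτ wA pA (isOpen_Up (τ := -τ) cB : IsOpen (Low τ B))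
    (fun x hx n => add_lat_notMem_Low pB hx n) hαβ
  obtain ⟨ε₂, hε₂, h₂⟩ := exists_pos_le_infDist hτ wB pB (isOpen_Up cA : IsOpen (Up τ A))
    (fun x hx n => add_lat_notMem_Up pA hx n) hβα
  obtain ⟨δ, hδ, hδlt⟩ : ∃ δ > 0, δ < min ε₁ ε₂ := exists_between (lt_min hε₁ hε₂)
  rw [lt_min_iff] at hδlt
  obtain ⟨Γ, ρ₁, wΓ, pΓ, hρ₁, hΓA, hΓd, hAΓ, hconv⟩ := hα.exists_trap hτ hL0 hL hδ
    fun x hx hxL => hδlt.1.trans_le (h₁ x ((hline x hxL).resolve_left (not_not.2 hx)))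
  have hrB : range (fun t => β (-t)) = B := MinLine.range_neg_eq β
  obtain ⟨Γ', ρ₂, wΓ', pΓ', hρ₂, hΓB, hΓ'd, hBΓ, hconv'⟩ := hβ.neg.exists_trap (neg_ne_zero.2 hτ) hL0
    (le_psi_neg hL) hδ (by
      rw [hrB]
      intro x hx hxL
      refine hδlt.2.trans_le (h₂ x ?_)
      have hpsi := M.psi_periodic τ (-τ) x
      rw [lat_neg', neg_add_cancel_right, M.dist_comm, ← lat_neg', hxL] at hpsi
      exact (hline x hpsi.symm).resolve_right (not_not.2 hx))
  rw [hrB] at hΓB hΓ'd hBΓ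
  have wΓ' : IsWave τ Γ' := by simpa using wΓ'.neg
  rw [Low_neg] at hBΓ
  have pΓ' : ∀ x ∈ Γ', ∀ n : ℤ, x + lat (n • τ) ∈ Γ' := fun x hx n => by
    have := pΓ' x hx (-n)
    rwa [neg_smul, smul_neg, neg_neg] at this
  have hΓ'A : Γ' ⊆ Up τ A := by
    intro x hx
    obtain ⟨b, hb, hxb⟩ := cB.exists_infDist_eq_dist wB.nonempty x
    refine mem_Up_of_segment (hβα hb) (disjoint_left.2 fun z hz hzA => ?_)
    have h1 := dist_le_of_mem_segment hz
    have h2 := h₂ z fun h => Up_subset_compl h hzA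
    have h3 := Metric.infDist_le_dist_of_mem (x := z) hb
    have h4 := hΓ'd x hx
    linarith
  have hAΓ' : A ⊆ Low τ Γ' := by
    refine ((wA.trichotomy hτ wΓ' ?_).resolve_right fun ⟨h1, _⟩ => ?_).2
    · exact disjoint_left.2 fun x hx hx' => Up_subset_compl (hΓ'A hx') hx
    · obtain ⟨x, hx⟩ := wΓ'.nonempty
      exact disjoint_left.1 (wA.disjoint_Up_Low hτ) (hΓ'A hx) (h1 hx)
  have hΓΓ' : Γ ⊆ Low τ Γ' := by
    intro x hx
    obtain ⟨a, ha, hxa⟩ := cA.exists_infDist_eq_dist wA.nonempty x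
    refine mem_Up_of_segment (hAΓ' ha) (disjoint_left.2 fun z hz hzΓ => ?_)
    obtain ⟨b, hb, hzb⟩ := cB.exists_infDist_eq_dist wB.nonempty z
    have h1 := dist_le_of_mem_segment hz
    have h2 := h₂ a fun h => Up_subset_compl h ha
    have h3 := Metric.infDist_le_dist_of_mem (x := a) hb
    have h4 := hΓ'd z hzΓ
    have h5 := hΓd x hx
    have h6 := _root_.dist_triangle_left a b z
    linarith
  have hΓ'Γ : Γ' ⊆ Up τ Γ := by
    refine ((wΓ.trichotomy hτ wΓ' ?_).resolve_right fun ⟨_, h1⟩ => ?_).1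
    · exact disjoint_left.2 fun x hx hx' => Low_subset_compl (hΓΓ' hx) hx'
    · obtain ⟨x, hx⟩ := wΓ.nonempty
      exact disjoint_left.1 (wΓ'.disjoint_Up_Low hτ) (h1 hx) (hΓΓ' hx)
  have hψc : Continuous fun x : ℝ × ℝ => M.dist x (x + lat τ) :=
    M.continuous_dist_comp continuous_id (by fun_prop)
  obtain ⟨H₁, hH₁⟩ := wΓ.exists_abs_ht_le
  obtain ⟨H₂, hH₂⟩ := wΓ'.exists_abs_ht_le
  obtain ⟨ε, hε, hεQ⟩ := exists_pos_le_of_periodic hτ (H := max H₁ H₂)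
    (Q := {x | x ∉ Low τ Γ ∧ x ∉ Up τ Γ'})
    ((isOpen_Up (τ := -τ) (wΓ.isClosed hτ)).isClosed_compl.inter
      (isOpen_Up (wΓ'.isClosed hτ)).isClosed_compl)
    (fun x hx n => ⟨add_lat_notMem_Low pΓ hx.1 n, add_lat_notMem_Up pΓ' hx.2 n⟩)
    (fun x hx => by
      refine abs_le.2 ⟨?_, ?_⟩
      · by_contra! hlt
        refine hx.1 (mem_Up_of_forall_lt fun c hc => ?_)
        have := (abs_le.1 (hH₁ c hc)).1
        have := le_max_left H₁ H₂
        rw [ht_neg, ht_neg]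
        linarith
      · by_contra! hlt
        refine hx.2 (mem_Up_of_forall_lt fun c hc => ?_)
        have := (abs_le.1 (hH₂ c hc)).2
        have := le_max_right H₁ H₂
        linarith)
    (φ := fun x => M.dist x (x + lat τ) - L) (hψc.sub continuous_const)
    (fun x n => by rw [M.psi_periodic])
    (fun x hx => by
      refine sub_pos.2 ((hL x).lt_of_ne fun he => ?_)
      rcases hline x he.symm with h | h
      · exact hx.1 (hAΓ h)
      · exact hx.2 (hBΓ h))
  refine ⟨Γ, Γ', min ρ₁ ρ₂, min (L + ε) (2 * L), wΓ, wΓ', pΓ, pΓ', lt_min hρ₁ hρ₂,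
    lt_min (by linarith) (by linarith), min_le_right _ _,
    fun c l hl => hconv c l (hl.trans (min_le_left _ _)),
    fun c l hl => hconv' c l (hl.trans (min_le_right _ _)),
    mem_Up_or_mem_Low hτ wΓ hΓ'Γ hΓΓ', fun x h1 h2 => (min_le_left _ _).trans ?_,
    α, hα, fun x hx => hAΓ fun h => Up_subset_compl h hx⟩
  linarith [hεQ x ⟨h1, h2⟩]

end TorusMetric

namespace TorusMetric

variable (M : TorusMetric)

/-- Minimal arcs of length at most `ρ` are determined by their endpoints. -/
def UniqueRadius (ρ : ℝ) : Prop := ∀ (c e : ℝ → ℝ × ℝ) (l : ℝ), l ≤ ρ → M.IsoOn c 0 l →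
    M.IsoOn e 0 l → c 0 = e 0 → c l = e l → ∀ t ∈ Icc 0 l, c t = e t

/-- A minimal arc from `x` to `y`. -/
def seg (x y : ℝ × ℝ) : ℝ → ℝ × ℝ := (M.exists_isoOn x y).choose

theorem seg_zero (x y : ℝ × ℝ) : M.seg x y 0 = x := (M.exists_isoOn x y).choose_spec.1

theorem seg_dist (x y : ℝ × ℝ) : M.seg x y (M.dist x y) = y := (M.exists_isoOn x y).choose_spec.2.1

theorem isoOn_seg (x y : ℝ × ℝ) : M.IsoOn (M.seg x y) 0 (M.dist x y) :=
  (M.exists_isoOn x y).choose_spec.2.2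

/-- The midpoint of a minimal arc from `x` to `y`. -/
def mid (x y : ℝ × ℝ) : ℝ × ℝ := M.seg x y (M.dist x y / 2)

theorem dist_mid_left (x y : ℝ × ℝ) : M.dist x (M.mid x y) = M.dist x y / 2 := by
  have h0 := M.dist_nonneg x y
  have := M.isoOn_seg x y 0 ⟨le_rfl, h0⟩ (M.dist x y / 2) ⟨by linarith, by linarith⟩ (by linarith)
  rwa [seg_zero, sub_zero] at this

theorem dist_mid_right (x y : ℝ × ℝ) : M.dist (M.mid x y) y = M.dist x y / 2 := by
  have h0 := M.dist_nonneg x y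
  have := M.isoOn_seg x y (M.dist x y / 2) ⟨by linarith, by linarith⟩ _ ⟨h0, le_rfl⟩ (by linarith)
  rw [seg_dist] at this
  rw [mid, this]
  ring

variable {M} {ρ : ℝ}

theorem UniqueRadius.seg_add_lat (hu : M.UniqueRadius ρ) {x y : ℝ × ℝ} (hxy : M.dist x y ≤ ρ)
    (κ : ℤ × ℤ) {t : ℝ} (ht : t ∈ Icc 0 (M.dist x y)) :
    M.seg (x + lat κ) (y + lat κ) t = M.seg x y t + lat κ := by
  have h1 := M.isoOn_seg (x + lat κ) (y + lat κ)
  have h2 := M.seg_dist (x + lat κ) (y + lat κ)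
  rw [dist_add_lat] at h1 h2
  refine hu _ _ _ hxy h1 ((M.isoOn_seg x y).add_lat κ) ?_ ?_ t ht
  · rw [seg_zero, seg_zero]
  · rw [h2, seg_dist]

theorem UniqueRadius.mid_add_lat (hu : M.UniqueRadius ρ) {x y : ℝ × ℝ} (hxy : M.dist x y ≤ ρ)
    (κ : ℤ × ℤ) : M.mid (x + lat κ) (y + lat κ) = M.mid x y + lat κ := by
  have h0 := M.dist_nonneg x y
  rw [mid, dist_add_lat, hu.seg_add_lat hxy κ ⟨by linarith, by linarith⟩, mid]

theorem UniqueRadius.eq_mid (hu : M.UniqueRadius ρ) {x y z : ℝ × ℝ} (hxy : M.dist x y ≤ ρ)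
    (h1 : M.dist x z = M.dist x y / 2) (h2 : M.dist z y = M.dist x y / 2) : z = M.mid x y := by
  have h0 := M.dist_nonneg x y
  have i1 := M.isoOn_seg x z
  have i2 := (M.isoOn_seg z y).shift (-(M.dist x y / 2))
  have e1 := M.seg_dist x z
  have e2 := M.seg_dist z y
  rw [h1] at i1 e1
  rw [h2] at i2 e2
  have i3 := i1.glue (e := M.dist x y) (by convert i2 using 1 <;> ring) (by linarith) (by linarith)
    (by rw [e1, add_neg_cancel, seg_zero]) (by
      rw [seg_zero, show M.dist x y + -(M.dist x y / 2) = M.dist x y / 2 by ring, e2, sub_zero])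
  have := hu _ _ _ hxy (M.isoOn_seg x y) i3
    (by rw [if_pos (by linarith), seg_zero, seg_zero]) (by
      rw [seg_dist]
      split_ifs with h
      · have h3 : M.dist x y = 0 := by linarith
        rw [h3] at h1 ⊢
        have h4 := M.dist_eq_zero_iff.1 h3
        rw [seg_zero, h4]
      · rw [show M.dist x y + -(M.dist x y / 2) = M.dist x y / 2 by ring, e2])
      (M.dist x y / 2) ⟨by linarith, by linarith⟩
  rw [if_pos le_rfl, e1] at this
  exact this.symm

theorem UniqueRadius.continuousOn_mid (hu : M.UniqueRadius ρ) :
    ContinuousOn (fun p : (ℝ × ℝ) × (ℝ × ℝ) => M.mid p.1 p.2) {p | M.dist p.1 p.2 ≤ ρ} := by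
  intro p₀ hp₀
  set l := 𝓝[{p : (ℝ × ℝ) × (ℝ × ℝ) | M.dist p.1 p.2 ≤ ρ}] p₀ with hl
  have hc : ∀ {f : (ℝ × ℝ) × (ℝ × ℝ) → ℝ}, Continuous f → Tendsto f l (𝓝 (f p₀)) := fun hf =>
    (hf.tendsto p₀).mono_left nhdsWithin_le_nhds
  have hd : Tendsto (fun p : (ℝ × ℝ) × (ℝ × ℝ) => M.dist p.1 p.2 / 2) l
      (𝓝 (M.dist p₀.1 p₀.2 / 2)) :=
    hc ((M.continuous_dist_comp continuous_fst continuous_snd).div_const 2)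
  have t1 : Tendsto (fun p : (ℝ × ℝ) × (ℝ × ℝ) => M.dist p₀.1 (M.mid p.1 p.2)) l
      (𝓝 (M.dist p₀.1 p₀.2 / 2)) := by
    have h0 := hc (M.continuous_dist_comp (continuous_const (y := p₀.1)) continuous_fst)
    rw [M.dist_self] at h0
    have h1 := hd.sub h0
    have h2 := hd.add h0
    rw [sub_zero] at h1
    rw [add_zero] at h2
    refine tendsto_of_tendsto_of_tendsto_of_le_of_le h1 h2 (fun p => ?_) (fun p => ?_)
    · have := M.dist_triangle p.1 p₀.1 (M.mid p.1 p.2)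
      rw [dist_mid_left, M.dist_comm p.1 p₀.1] at this
      beta_reduce
      linarith
    · have := M.dist_triangle p₀.1 p.1 (M.mid p.1 p.2)
      rw [dist_mid_left] at this
      beta_reduce
      linarith
  have t2 : Tendsto (fun p : (ℝ × ℝ) × (ℝ × ℝ) => M.dist (M.mid p.1 p.2) p₀.2) l
      (𝓝 (M.dist p₀.1 p₀.2 / 2)) := by
    have h0 := hc (M.continuous_dist_comp (continuous_const (y := p₀.2)) continuous_snd)
    rw [M.dist_self] at h0
    have h1 := hd.sub h0
    have h2 := hd.add h0
    rw [sub_zero] at h1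
    rw [add_zero] at h2
    refine tendsto_of_tendsto_of_tendsto_of_le_of_le h1 h2 (fun p => ?_) (fun p => ?_)
    · have := M.dist_triangle (M.mid p.1 p.2) p₀.2 p.2
      rw [dist_mid_right] at this
      beta_reduce
      linarith
    · have := M.dist_triangle (M.mid p.1 p.2) p.2 p₀.2
      rw [dist_mid_right, M.dist_comm p.2 p₀.2] at this
      beta_reduce
      linarith
  have hclus : ∀ {z : ℝ × ℝ} {f : ℝ × ℝ → ℝ} {a : ℝ}, Continuous f →
      MapClusterPt z l (fun p => M.mid p.1 p.2) →
      Tendsto (fun p : (ℝ × ℝ) × (ℝ × ℝ) => f (M.mid p.1 p.2)) l (𝓝 a) → f z = a := by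
    intro z f a hf hz hft
    have h1 : MapClusterPt (f z) l (f ∘ fun p => M.mid p.1 p.2) := hz.continuousAt_comp
      hf.continuousAt
    exact eq_of_nhds_neBot (NeBot.mono h1 (inf_le_inf_left (𝓝 (f z)) hft))
  refine IsCompact.tendsto_nhds_of_unique_mapClusterPt
    (s := Metric.closedBall p₀.1 ((M.dist p₀.1 p₀.2 / 2 + 1) / M.lo)) (isCompact_closedBall _ _)
    ?_ fun z _ hz => ?_
  · have := t1.eventually_lt_const (lt_add_one _)
    filter_upwards [this] with p hp
    have h1 := M.norm_sub_le_dist p₀.1 (M.mid p.1 p.2)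
    rw [mem_closedBall_iff_norm, norm_sub_rev]
    refine h1.trans ?_
    have := M.lo_pos
    gcongr
  · refine hu.eq_mid hp₀ (hclus (f := fun z => M.dist p₀.1 z)
      (M.continuous_dist_comp continuous_const continuous_id) hz t1)
      (hclus (f := fun z => M.dist z p₀.2)
        (M.continuous_dist_comp continuous_id continuous_const) hz t2)

end TorusMetric

namespace TorusMetric

variable (M : TorusMetric)

/-- Birkhoff's shortening process: pass to the polygon of the midpoints. -/
def birk (x : ℤ → ℝ × ℝ) : ℤ → ℝ × ℝ := fun i => M.mid (x i) (x (i + 1))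

/-- Polygons which are closed up to a translation, with edges of length at most `ρ`. -/
def polys (N : ℕ) (κ : ℤ × ℤ) (ρ : ℝ) : Set (ℤ → ℝ × ℝ) :=
  {x | (∀ i, x (i + N) = x i + lat κ) ∧ ∀ i, M.dist (x i) (x (i + 1)) ≤ ρ}

/-- The discrete energy of a polygon. -/
def polyEnergy (N : ℕ) (x : ℤ → ℝ × ℝ) : ℝ :=
  ∑ i ∈ Finset.range N, M.dist (x i) (x (i + 1)) ^ 2

variable {M} {N : ℕ} {κ : ℤ × ℤ} {ρ : ℝ} {x : ℤ → ℝ × ℝ}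

theorem polys_add_mul (hx : x ∈ M.polys N κ ρ) (i q : ℤ) :
    x (i + q * N) = x i + lat (q • κ) := by
  have step : ∀ (q : ℤ), x (i + q * N) = x i + lat (q • κ) →
      x (i + (q + 1) * N) = x i + lat ((q + 1) • κ) := fun q h => by
    rw [show i + (q + 1) * N = (i + q * N) + N by ring, hx.1, h, add_smul, one_smul, lat_add,
      add_assoc]
  have step' : ∀ (q : ℤ), x (i + q * N) = x i + lat (q • κ) →
      x (i + (q - 1) * N) = x i + lat ((q - 1) • κ) := fun q h => by
    have h1 := hx.1 (i + (q - 1) * N)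
    rw [show i + (q - 1) * N + N = i + q * N by ring, h, show q = (q - 1) + 1 by ring, add_smul,
      one_smul, lat_add, ← add_assoc] at h1
    simpa using (add_right_cancel h1).symm
  induction q using Int.induction_on with
  | zero => simp [lat_zero]
  | succ q ih => exact step _ ih
  | pred q ih => exact step' _ ih

theorem dist_birk_le (x : ℤ → ℝ × ℝ) (i : ℤ) : M.dist (M.birk x i) (M.birk x (i + 1)) ≤
    (M.dist (x i) (x (i + 1)) + M.dist (x (i + 1)) (x (i + 1 + 1))) / 2 := by
  have := M.dist_triangle (M.birk x i) (x (i + 1)) (M.birk x (i + 1))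
  rw [birk, birk, dist_mid_right, dist_mid_left] at this
  rw [birk, birk]
  linarith

theorem UniqueRadius.mapsTo_birk (hu : M.UniqueRadius ρ) :
    MapsTo M.birk (M.polys N κ ρ) (M.polys N κ ρ) := by
  intro x hx
  refine ⟨fun i => ?_, fun i => ?_⟩
  · rw [birk, hx.1, show i + (N : ℤ) + 1 = i + 1 + N by ring, hx.1, hu.mid_add_lat (hx.2 i)]
    rfl
  · have := dist_birk_le (M := M) x i
    linarith [hx.2 i, hx.2 (i + 1)]

theorem UniqueRadius.continuousOn_birk (hu : M.UniqueRadius ρ) :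
    ContinuousOn M.birk (M.polys N κ ρ) := by
  refine continuousOn_pi.2 fun i => ?_
  have h1 : Continuous fun x : ℤ → ℝ × ℝ => (x i, x (i + 1)) :=
    (continuous_apply i).prodMk (continuous_apply (i + 1))
  have h2 : MapsTo (fun x : ℤ → ℝ × ℝ => (x i, x (i + 1))) (M.polys N κ ρ)
      {p : (ℝ × ℝ) × (ℝ × ℝ) | M.dist p.1 p.2 ≤ ρ} := fun x hx => hx.2 i
  have h3 := hu.continuousOn_mid.comp h1.continuousOn h2
  exact h3

theorem UniqueRadius.birk_add_lat (hu : M.UniqueRadius ρ) (hx : x ∈ M.polys N κ ρ) (v : ℤ × ℤ) :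
    M.birk (fun i => x i + lat v) = fun i => M.birk x i + lat v := by
  funext i
  exact hu.mid_add_lat (hx.2 i) v

theorem polys_add_lat (hx : x ∈ M.polys N κ ρ) (v : ℤ × ℤ) :
    (fun i => x i + lat v) ∈ M.polys N κ ρ :=
  ⟨fun i => by beta_reduce; rw [hx.1, add_right_comm], fun i => by
    rw [dist_add_lat]; exact hx.2 i⟩

theorem UniqueRadius.iterate_birk_add_lat (hu : M.UniqueRadius ρ) (hx : x ∈ M.polys N κ ρ)
    (v : ℤ × ℤ) (n : ℕ) :
    M.birk^[n] (fun i => x i + lat v) = fun i => M.birk^[n] x i + lat v := by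
  induction n generalizing x with
  | zero => rfl
  | succ n ih =>
    rw [Function.iterate_succ_apply, Function.iterate_succ_apply, hu.birk_add_lat hx,
      ih (hu.mapsTo_birk hx)]

theorem polyEnergy_add_lat (x : ℤ → ℝ × ℝ) (v : ℤ × ℤ) :
    M.polyEnergy N (fun i => x i + lat v) = M.polyEnergy N x := by
  simp only [polyEnergy, dist_add_lat]

theorem continuous_polyEnergy : Continuous (M.polyEnergy N) :=
  continuous_finsetSum _ fun _ _ =>
    (M.continuous_dist_comp (continuous_apply _) (continuous_apply _)).pow 2

theorem polyEnergy_eq_sum_shift (hx : x ∈ M.polys N κ ρ) :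
    M.polyEnergy N x = ∑ i ∈ Finset.range N,
      (M.dist (x i) (x (i + 1)) ^ 2 + M.dist (x (i + 1)) (x (i + 1 + 1)) ^ 2) / 2 := by
  have h1 := Finset.sum_range_succ (fun i : ℕ => M.dist (x i) (x (i + 1)) ^ 2) N
  have h2 := Finset.sum_range_succ' (fun i : ℕ => M.dist (x i) (x (i + 1)) ^ 2) N
  have h3 : M.dist (x N) (x (N + 1)) = M.dist (x 0) (x (0 + 1)) := by
    have e1 := hx.1 0
    have e2 := hx.1 1
    rw [zero_add] at e1
    rw [add_comm] at e2
    rw [e1, e2, dist_add_lat, zero_add]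
  rw [h3, zero_add] at h1
  push_cast at h2
  rw [← Finset.sum_div, Finset.sum_add_distrib, polyEnergy]
  linarith

theorem polyEnergy_birk_aux (x : ℤ → ℝ × ℝ) (i : ℤ) :
    M.dist (M.birk x i) (M.birk x (i + 1)) ^ 2 ≤
      (M.dist (x i) (x (i + 1)) ^ 2 + M.dist (x (i + 1)) (x (i + 1 + 1)) ^ 2) / 2 := by
  have h1 := dist_birk_le (M := M) x i
  have h0 := M.dist_nonneg (M.birk x i) (M.birk x (i + 1))
  have h2 := pow_le_pow_left₀ h0 h1 2
  nlinarith [sq_nonneg (M.dist (x i) (x (i + 1)) - M.dist (x (i + 1)) (x (i + 1 + 1)))]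

theorem polyEnergy_birk_le (hx : x ∈ M.polys N κ ρ) :
    M.polyEnergy N (M.birk x) ≤ M.polyEnergy N x := by
  rw [polyEnergy_eq_sum_shift hx]
  exact Finset.sum_le_sum fun i _ => polyEnergy_birk_aux x i

theorem exists_eq_of_polyEnergy_birk (hx : x ∈ M.polys N κ ρ) (hN : 0 < N)
    (h : M.polyEnergy N (M.birk x) = M.polyEnergy N x) (hu : M.UniqueRadius ρ) :
    ∃ η, (∀ i, M.dist (x i) (x (i + 1)) = η) ∧ ∀ i, M.dist (M.birk x i) (M.birk x (i + 1)) = η := by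
  rw [polyEnergy_eq_sum_shift hx] at h
  have h1 := (Finset.sum_eq_sum_iff_of_le fun (i : ℕ) _ =>
    polyEnergy_birk_aux (M := M) x i).1 h
  have hper : ∀ i : ℤ, M.dist (x i) (x (i + 1)) = M.dist (x (i % N)) (x (i % N + 1)) := fun i => by
    have e1 := polys_add_mul hx (i % N) (i / N)
    have e2 := polys_add_mul hx (i % N + 1) (i / N)
    have e3 : i % (N : ℤ) + i / N * N = i := by rw [mul_comm]; exact Int.emod_add_mul_ediv i N
    rw [add_right_comm, e3] at e2
    rw [e3] at e1
    rw [e1, e2, dist_add_lat]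
  have hb := hu.mapsTo_birk hx
  have hper' : ∀ i : ℤ, M.dist (M.birk x i) (M.birk x (i + 1)) =
      M.dist (M.birk x (i % N)) (M.birk x (i % N + 1)) := fun i => by
    have e1 := polys_add_mul hb (i % N) (i / N)
    have e2 := polys_add_mul hb (i % N + 1) (i / N)
    have e3 : i % (N : ℤ) + i / N * N = i := by rw [mul_comm]; exact Int.emod_add_mul_ediv i N
    rw [add_right_comm, e3] at e2
    rw [e3] at e1
    rw [e1, e2, dist_add_lat]
  have h2 : ∀ i : ℕ, i < N → M.dist (x (i + 1)) (x (i + 1 + 1)) = M.dist (x i) (x (i + 1)) ∧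
      M.dist (M.birk x i) (M.birk x (i + 1)) = M.dist (x i) (x (i + 1)) := fun i hi => by
    have e := h1 i (Finset.mem_range.2 hi)
    have h3 := dist_birk_le (M := M) x i
    have h0 := M.dist_nonneg (M.birk x i) (M.birk x (i + 1))
    have h4 := pow_le_pow_left₀ h0 h3 2
    have h5 : (M.dist (x i) (x (i + 1)) - M.dist (x (i + 1)) (x (i + 1 + 1))) ^ 2 ≤ 0 := by
      nlinarith
    have h6 : M.dist (x i) (x (i + 1)) = M.dist (x (i + 1)) (x (i + 1 + 1)) :=
      sub_eq_zero.1 (pow_eq_zero_iff two_ne_zero |>.1 (le_antisymm h5 (sq_nonneg _)))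
    rw [← h6] at e
    refine ⟨h6.symm, ?_⟩
    have h7 := M.dist_nonneg (x i) (x (i + 1))
    exact (pow_left_inj₀ h0 h7 two_ne_zero).1 (by linarith)
  have h8 : ∀ i : ℕ, i < N → M.dist (x i) (x (i + 1)) = M.dist (x 0) (x 1) := fun i => by
    induction i with
    | zero => intro; simp
    | succ i ih =>
      intro hi
      push_cast
      rw [(h2 i (by omega)).1, ih (by omega)]
  have hmod : ∀ i : ℤ, ∃ j : ℕ, j < N ∧ i % N = j := fun i => by
    have hN' : (0 : ℤ) < N := by exact_mod_cast hN
    refine ⟨(i % N).toNat, ?_, ?_⟩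
    · have := Int.emod_lt_of_pos i hN'
      omega
    · rw [Int.toNat_of_nonneg (Int.emod_nonneg i hN'.ne')]
  refine ⟨M.dist (x 0) (x 1), fun i => ?_, fun i => ?_⟩
  · obtain ⟨j, hj, e⟩ := hmod i
    rw [hper, e, h8 j hj]
  · obtain ⟨j, hj, e⟩ := hmod i
    rw [hper', e, (h2 j hj).2, h8 j hj]

theorem exists_localGeod_of_birk (hu : M.UniqueRadius ρ) (hx : x ∈ M.polys N κ ρ) (hN : 0 < N)
    (hκ : κ ≠ 0) (h : M.polyEnergy N (M.birk x) = M.polyEnergy N x) :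
    ∃ (c : ℝ → ℝ × ℝ) (η : ℝ), 0 < η ∧ M.LocalGeod c ∧ (∀ t, c (t + N * η) = c t + lat κ) ∧
      (∀ i : ℤ, c (i * η) = x i) ∧ N * η ^ 2 = M.polyEnergy N x := by
  obtain ⟨η, h1, h2⟩ := exists_eq_of_polyEnergy_birk hx hN h hu
  have hη0 : 0 ≤ η := by rw [← h1 0]; exact M.dist_nonneg _ _
  have hη : 0 < η := by
    refine hη0.lt_of_ne fun h0 => hκ ?_
    have h3 : ∀ n : ℕ, x n = x 0 := fun n => by
      induction n with
      | zero => rfl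
      | succ n ih =>
        have := h1 n
        rw [← h0] at this
        push_cast
        rw [← M.dist_eq_zero_iff.1 this, ih]
    have h4 := hx.1 0
    rw [zero_add, h3 N] at h4
    have h5 : lat κ = 0 := by simpa using h4.symm
    have h6 := congrArg Prod.fst h5
    have h7 := congrArg Prod.snd h5
    simp only [lat, Prod.fst_zero, Prod.snd_zero, Int.cast_eq_zero] at h6 h7
    exact Prod.ext h6 h7
  set c : ℝ → ℝ × ℝ := fun t => M.seg (x ⌊t / η⌋) (x (⌊t / η⌋ + 1)) (t - ⌊t / η⌋ * η) with hc
  have hcell : ∀ (n : ℤ) (t : ℝ), t ∈ Icc (n * η) (n * η + η) →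
      c t = M.seg (x n) (x (n + 1)) (t - n * η) := fun n t ht => by
    rcases ht.2.eq_or_lt with e | hlt
    · have e2 : ⌊t / η⌋ = n + 1 := by
        rw [e, show n * η + η = ((n + 1 : ℤ) : ℝ) * η by push_cast; ring,
          mul_div_cancel_right₀ _ hη.ne', Int.floor_intCast]
      have e3 := M.seg_dist (x n) (x (n + 1))
      rw [h1] at e3
      rw [hc]
      beta_reduce
      rw [e2, e, show n * η + η - ((n + 1 : ℤ) : ℝ) * η = 0 by push_cast; ring, seg_zero,
        add_sub_cancel_left, e3]
    · have e2 : ⌊t / η⌋ = n := by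
        rw [Int.floor_eq_iff, le_div_iff₀ hη, div_lt_iff₀ hη]
        exact ⟨ht.1, by linarith⟩
      rw [hc]
      beta_reduce
      rw [e2]
  have hiso : ∀ n : ℤ, M.IsoOn c (n * η) (n * η + η) := fun n => by
    have i1 := (M.isoOn_seg (x n) (x (n + 1))).shift (-(n * η))
    rw [h1] at i1
    have i2 : M.IsoOn (fun t => M.seg (x n) (x (n + 1)) (t + -(n * η))) (n * η) (n * η + η) := by
      convert i1 using 1 <;> ring
    exact i2.congr fun t ht => by rw [hcell n t ht, sub_eq_add_neg]
  have hcn : ∀ n : ℤ, c (n * η) = x n := fun n => by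
    rw [hcell n _ ⟨le_rfl, by linarith⟩, sub_self, seg_zero]
  have hmid : ∀ n : ℤ, c (n * η + η / 2) = M.birk x n := fun n => by
    rw [hcell n _ ⟨by linarith, by linarith⟩, add_sub_cancel_left, birk, mid, h1]
  have hiso' : ∀ n : ℤ, M.IsoOn c (n * η - η / 2) (n * η + η / 2) := fun n => by
    have e1 : ((n - 1 : ℤ) : ℝ) * η = n * η - η := by push_cast; ring
    have i1 := hiso (n - 1)
    rw [e1] at i1
    have m1 := hmid (n - 1)
    rw [e1, show n * η - η + η / 2 = n * η - η / 2 by ring] at m1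
    have i3 := h2 (n - 1)
    rw [sub_add_cancel] at i3
    refine (i1.mono (a' := n * η - η / 2) (b' := n * η) (by linarith) (by linarith)).of_dist
      ((hiso n).mono le_rfl (by linarith)) (by linarith) (by linarith) ?_
    rw [m1, hmid, i3]
    linarith
  refine ⟨c, η, hη, fun t => ?_, fun t => ?_, hcn, ?_⟩
  · set n := ⌊t / η⌋ with hn
    have f1 : n * η ≤ t := by rw [← le_div_iff₀ hη]; exact Int.floor_le _
    have f2 : t < n * η + η := by
      have := Int.lt_floor_add_one (t / η)
      rw [div_lt_iff₀ hη] at this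
      linarith
    rcases f1.eq_or_lt with e | hlt
    · exact ⟨η / 2, by linarith, by rw [← e]; exact hiso' n⟩
    · refine ⟨min (t - n * η) (n * η + η - t), lt_min (by linarith) (by linarith),
        (hiso n).mono ?_ ?_⟩
      · linarith [min_le_left (t - n * η) (n * η + η - t)]
      · linarith [min_le_right (t - n * η) (n * η + η - t)]
  · have e1 : ⌊(t + N * η) / η⌋ = ⌊t / η⌋ + N := by
      rw [add_div, mul_div_cancel_right₀ _ hη.ne', Int.floor_add_natCast]
    have f1 : (⌊t / η⌋ : ℝ) * η ≤ t := by rw [← le_div_iff₀ hη]; exact Int.floor_le _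
    have f2 : t < ⌊t / η⌋ * η + η := by
      have := Int.lt_floor_add_one (t / η)
      rw [div_lt_iff₀ hη] at this
      linarith
    rw [hc]
    beta_reduce
    rw [e1, show ⌊t / η⌋ + (N : ℤ) + 1 = ⌊t / η⌋ + 1 + N by ring, hx.1, hx.1,
      show t + N * η - ((⌊t / η⌋ + (N : ℤ) : ℤ) : ℝ) * η = t - ⌊t / η⌋ * η by push_cast; ring]
    exact hu.seg_add_lat (hx.2 _) κ ⟨by linarith, by rw [h1]; linarith⟩
  · rw [polyEnergy, Finset.sum_congr rfl fun i _ => by rw [h1], Finset.sum_const, Finset.card_range,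
      nsmul_eq_mul]

end TorusMetric

namespace TorusMetric

variable {M : TorusMetric} {N k : ℕ} {κ τ : ℤ × ℤ} {ρ : ℝ} {x : ℤ → ℝ × ℝ} {O : Set (ℝ × ℝ)}

theorem isClosed_polys : IsClosed (M.polys N κ ρ) := by
  rw [polys, ofPred_and, ofPred_forall, ofPred_forall]
  refine (isClosed_iInter fun i => ?_).inter (isClosed_iInter fun i => ?_)
  · exact isClosed_eq (continuous_apply _) ((continuous_apply _).add continuous_const)
  · exact isClosed_le (M.continuous_dist_comp (continuous_apply _) (continuous_apply _))
      continuous_const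

theorem norm_sub_le_of_mem_polys (hx : x ∈ M.polys N κ ρ) (i : ℤ) :
    ‖x i - x 0‖ ≤ |(i : ℝ)| * (ρ / M.lo) := by
  have hstep : ∀ i, ‖x (i + 1) - x i‖ ≤ ρ / M.lo := fun i => by
    rw [norm_sub_rev]
    refine (M.norm_sub_le_dist _ _).trans ?_
    have := M.lo_pos
    gcongr
    exact hx.2 i
  have hnat : ∀ (n : ℕ) (i : ℤ), ‖x (i + n) - x i‖ ≤ n * (ρ / M.lo) := fun n i => by
    induction n with
    | zero => simp
    | succ n ih =>
      have h1 := norm_sub_le_norm_sub_add_norm_sub (x (i + n + 1)) (x (i + n)) (x i)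
      have h2 := hstep (i + n)
      push_cast
      rw [← add_assoc]
      linarith
  rcases le_total 0 i with h | h
  · obtain ⟨n, rfl⟩ := Int.eq_ofNat_of_zero_le h
    simpa using hnat n 0
  · obtain ⟨n, hn⟩ := Int.eq_ofNat_of_zero_le (neg_nonneg.2 h)
    obtain rfl : i = -n := by omega
    have := hnat n (-n)
    rw [neg_add_cancel, norm_sub_rev] at this
    simpa using this

variable (M) in
/-- The polygons which Birkhoff's process does not move into `O`. -/
def trapped (N : ℕ) (κ : ℤ × ℤ) (ρ : ℝ) (O : Set (ℝ × ℝ)) : Set (ℤ → ℝ × ℝ) :=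
  {x | x ∈ M.polys N κ ρ ∧ ∀ n, ∃ i ∈ Finset.range N, M.birk^[n] x i ∉ O}

theorem UniqueRadius.isClosed_trapped (hu : M.UniqueRadius ρ) (hO : IsOpen O) :
    IsClosed (M.trapped N κ ρ O) := by
  set F : Set (ℤ → ℝ × ℝ) := ⋃ i ∈ Finset.range N, {y : ℤ → ℝ × ℝ | y i ∉ O} with hF
  have hFc : IsClosed F := by
    refine (Finset.range N).finite_toSet.isClosed_biUnion fun i _ => ?_
    exact hO.isClosed_compl.preimage (continuous_apply (A := fun _ : ℤ => ℝ × ℝ) (i : ℤ))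
  have h1 : M.trapped N κ ρ O = ⋂ n, M.polys N κ ρ ∩ M.birk^[n] ⁻¹' F := by
    ext x
    simp only [trapped, hF, mem_iInter, mem_inter_iff, mem_preimage, mem_iUnion, mem_ofPred_eq,
      exists_prop]
    exact ⟨fun h n => ⟨h.1, h.2 n⟩, fun h => ⟨(h 0).1, fun n => (h n).2⟩⟩
  rw [h1]
  exact isClosed_iInter fun n =>
    (hu.continuousOn_birk.iterate hu.mapsTo_birk n).preimage_isClosed_of_isClosed isClosed_polys hFc

theorem UniqueRadius.birk_mem_trapped (hu : M.UniqueRadius ρ) (hx : x ∈ M.trapped N κ ρ O) :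
    M.birk x ∈ M.trapped N κ ρ O :=
  ⟨hu.mapsTo_birk hx.1, fun n => by
    rw [← Function.iterate_succ_apply]; exact hx.2 (n + 1)⟩

theorem UniqueRadius.add_lat_mem_trapped (hu : M.UniqueRadius ρ)
    (hO : ∀ p ∉ O, ∀ n : ℤ, p + lat (n • τ) ∉ O) (hx : x ∈ M.trapped N κ ρ O) (n : ℤ) :
    (fun i => x i + lat (n • τ)) ∈ M.trapped N κ ρ O := by
  refine ⟨polys_add_lat hx.1 _, fun m => ?_⟩
  obtain ⟨i, hi, h⟩ := hx.2 m
  refine ⟨i, hi, ?_⟩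
  rw [hu.iterate_birk_add_lat hx.1]
  exact hO _ h n

theorem UniqueRadius.iterate_birk_notMem {ρ' : ℝ} (hu : M.UniqueRadius ρ) (hρ : ρ ≤ ρ')
    (hO : ∀ (c : ℝ → ℝ × ℝ) (l : ℝ), l ≤ ρ' → M.IsoOn c 0 l → c 0 ∉ O → c l ∉ O →
      ∀ t ∈ Icc 0 l, c t ∉ O) (hx : x ∈ M.polys N κ ρ) (h : ∀ i, x i ∉ O) (n : ℕ) (i : ℤ) :
    M.birk^[n] x i ∉ O := by
  induction n generalizing x with
  | zero => exact h i
  | succ n ih =>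
    rw [Function.iterate_succ_apply]
    refine ih (hu.mapsTo_birk hx) fun j => ?_
    have h0 := M.dist_nonneg (x j) (x (j + 1))
    refine hO _ _ ((hx.2 j).trans hρ) (M.isoOn_seg (x j) (x (j + 1))) ?_ ?_ _
      ⟨by linarith, by linarith⟩
    · rw [seg_zero]; exact h j
    · rw [seg_dist]; exact h _

theorem forall_mem_of_forall_range (hN : 0 < N) (hO : ∀ p ∉ O, ∀ n : ℤ, p + lat (n • τ) ∉ O)
    (hx : x ∈ M.polys N ((k : ℤ) • τ) ρ) (h : ∀ i ∈ Finset.range N, x i ∈ O) (i : ℤ) : x i ∈ O := by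
  by_contra hi
  have hN' : (0 : ℤ) < N := by exact_mod_cast hN
  have e1 := polys_add_mul hx i (-(i / N))
  have e2 : i + -(i / N) * N = ((i % N).toNat : ℕ) := by
    rw [Int.toNat_of_nonneg (Int.emod_nonneg i hN'.ne'), Int.emod_def]
    ring
  rw [e2, smul_smul] at e1
  refine hO _ hi (-(i / N) * k) (e1 ▸ h _ (Finset.mem_range.2 ?_))
  have := Int.emod_lt_of_pos i hN'
  omega

variable {L ξ ρ' : ℝ} {Γ Γ' : Set (ℝ × ℝ)}

namespace Barrier

theorem disjoint (hB : M.Barrier τ L Γ Γ' ρ' ξ) (hτ : τ ≠ 0) : Disjoint (Low τ Γ) (Up τ Γ') := by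
  rw [disjoint_left]
  intro x h1 h2
  rcases hB.cover x with h | h
  · exact disjoint_left.1 (hB.wave.disjoint_Up_Low hτ) h h1
  · exact disjoint_left.1 (hB.wave'.disjoint_Up_Low hτ) h2 h

theorem trapped_or (hB : M.Barrier τ L Γ Γ' ρ' ξ) (hτ : τ ≠ 0) (hu : M.UniqueRadius ρ)
    (hρ : ρ ≤ ρ') (hN : 0 < N)
    (hx : x ∈ M.polys N ((k : ℤ) • τ) ρ) : x ∈ M.trapped N ((k : ℤ) • τ) ρ (Low τ Γ) ∨
      x ∈ M.trapped N ((k : ℤ) • τ) ρ (Up τ Γ') := by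
  by_contra! h
  simp only [trapped, mem_ofPred_eq, not_and, not_forall, not_exists, not_not] at h
  obtain ⟨n, h1⟩ := h.1 hx
  obtain ⟨m, h2⟩ := h.2 hx
  have hp : ∀ n, M.birk^[n] x ∈ M.polys N ((k : ℤ) • τ) ρ := fun n => hu.mapsTo_birk.iterate n hx
  have f1 : ∀ i, M.birk^[n] x i ∉ Up τ Γ := fun i hi => disjoint_left.1
    (hB.wave.disjoint_Up_Low hτ) hi (forall_mem_of_forall_range hN
      (fun p hp n => add_lat_notMem_Low hB.per hp n) (hp n) h1 i)
  have f2 : ∀ i, M.birk^[m] x i ∉ Low τ Γ' := fun i hi => disjoint_left.1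
    (hB.wave'.disjoint_Up_Low hτ) (forall_mem_of_forall_range hN
      (fun p hp n => add_lat_notMem_Up hB.per' hp n) (hp m) h2 i) hi
  have g1 := hu.iterate_birk_notMem hρ hB.convex (hp n) f1 m 0
  have g2 := hu.iterate_birk_notMem hρ hB.convex' (hp m) f2 n 0
  rw [← Function.iterate_add_apply] at g1 g2
  rw [add_comm] at g2
  exact (hB.cover _).elim g1 g2

theorem exists_trapped (hB : M.Barrier τ L Γ Γ' ρ' ξ) (hτ : τ ≠ 0) (hu : M.UniqueRadius ρ)
    (hρ : ρ ≤ ρ') (hN : 0 < N)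
    {P : ℝ → ℤ → ℝ × ℝ} (hP : Continuous P) (hPp : ∀ u, P u ∈ M.polys N ((k : ℤ) • τ) ρ)
    {u₀ u₁ : ℝ} (h0 : ∀ i, P u₀ i ∈ Low τ Γ) (h1 : ∀ i, P u₁ i ∈ Up τ Γ') :
    ∃ u, P u ∈ M.trapped N ((k : ℤ) • τ) ρ (Low τ Γ) ∧
      P u ∈ M.trapped N ((k : ℤ) • τ) ρ (Up τ Γ') := by
  have c1 := (hu.isClosed_trapped (N := N) (κ := (k : ℤ) • τ)
    (isOpen_Up (τ := -τ) (hB.wave.isClosed hτ))).preimage hP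
  have c2 := (hu.isClosed_trapped (N := N) (κ := (k : ℤ) • τ)
    (isOpen_Up (τ := τ) (hB.wave'.isClosed hτ))).preimage hP
  have g1 := (hB.trapped_or hτ hu hρ hN (hPp u₁)).resolve_right fun h => by
    obtain ⟨i, -, hi⟩ := h.2 0
    exact hi (h1 i)
  have g0 := (hB.trapped_or hτ hu hρ hN (hPp u₀)).resolve_left fun h => by
    obtain ⟨i, -, hi⟩ := h.2 0
    exact hi (h0 i)
  obtain ⟨u, -, hu'⟩ := isPreconnected_closed_iff.1 (isPreconnected_univ (α := ℝ)) _ _ c1 c2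
    (fun u _ => hB.trapped_or hτ hu hρ hN (hPp u)) ⟨u₁, mem_univ _, g1⟩ ⟨u₀, mem_univ _, g0⟩
  exact ⟨u, hu'⟩

theorem exists_abs_ht_le (hB : M.Barrier τ L Γ Γ' ρ' ξ) (N : ℕ) (κ : ℤ × ℤ) (ρ : ℝ) : ∃ H, ∀ x,
    x ∈ M.trapped N κ ρ (Low τ Γ) → x ∈ M.trapped N κ ρ (Up τ Γ') → |ht τ (x 0)| ≤ H := by
  obtain ⟨H₁, h1⟩ := hB.wave.exists_abs_ht_le
  obtain ⟨H₂, h2⟩ := hB.wave'.exists_abs_ht_le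
  set A := |(τ.1 : ℝ)| + |(τ.2 : ℝ)| with hA
  refine ⟨max H₁ H₂ + A * (N * (|ρ| / M.lo)), fun x hx hx' => ?_⟩
  have hn : ∀ i ∈ Finset.range N, |ht τ (x i) - ht τ (x 0)| ≤ A * (N * (|ρ| / M.lo)) :=
    fun i hi => by
    rw [← ht_sub]
    refine (abs_ht_le τ _).trans ?_
    have := norm_sub_le_of_mem_polys hx.1 i
    have hlo := M.lo_pos
    rw [← hA]
    have hi' : (i : ℝ) ≤ N := by exact_mod_cast (Finset.mem_range.1 hi).le
    have e : |((i : ℤ) : ℝ)| = i := by simp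
    rw [e] at this
    gcongr
    refine this.trans ((mul_le_mul_of_nonneg_left (div_le_div_of_nonneg_right (le_abs_self ρ)
      hlo.le) (Nat.cast_nonneg i)).trans ?_)
    gcongr
  obtain ⟨i, hi, hxi⟩ := hx.2 0
  obtain ⟨j, hj, hxj⟩ := hx'.2 0
  have g1 : -H₁ ≤ ht τ (x i) := by
    by_contra! h
    refine hxi (mem_Up_of_forall_lt fun c hc => ?_)
    rw [ht_neg, ht_neg, neg_lt_neg_iff]
    exact h.trans_le (abs_le.1 (h1 c hc)).1
  have g2 : ht τ (x j) ≤ H₂ := by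
    by_contra! h
    exact hxj (mem_Up_of_forall_lt fun c hc => (abs_le.1 (h2 c hc)).2.trans_lt h)
  have e1 := abs_le.1 (hn i hi)
  have e2 := abs_le.1 (hn j hj)
  exact abs_le.2 ⟨by linarith [le_max_left H₁ H₂], by linarith [le_max_right H₁ H₂]⟩

theorem exists_localGeod (hB : M.Barrier τ L Γ Γ' ρ' ξ) (hτ : τ ≠ 0) (hu : M.UniqueRadius ρ)
    (hρ : ρ ≤ ρ') (hN : 0 < N)
    (hk : k ≠ 0) {P : ℝ → ℤ → ℝ × ℝ} (hP : Continuous P)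
    (hPp : ∀ u, P u ∈ M.polys N ((k : ℤ) • τ) ρ) {u₀ u₁ E : ℝ} (h0 : ∀ i, P u₀ i ∈ Low τ Γ)
    (h1 : ∀ i, P u₁ i ∈ Up τ Γ') (hE : ∀ u, M.polyEnergy N (P u) ≤ E) :
    ∃ (c : ℝ → ℝ × ℝ) (η : ℝ), 0 < η ∧ M.LocalGeod c ∧
      (∀ t, c (t + N * η) = c t + lat ((k : ℤ) • τ)) ∧ (∃ t, c t ∉ Low τ Γ) ∧
      (∃ t, c t ∉ Up τ Γ') ∧ N * η ^ 2 ≤ E := by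
  obtain ⟨u, hu1, hu2⟩ := hB.exists_trapped hτ hu hρ hN hP hPp h0 h1
  set κ := (k : ℤ) • τ with hκ
  have hκ0 : κ ≠ 0 := smul_ne_zero (by exact_mod_cast hk) hτ
  set T := M.trapped N κ ρ (Low τ Γ) ∩ M.trapped N κ ρ (Up τ Γ') with hT
  have hTc : IsClosed T := (hu.isClosed_trapped
    (isOpen_Up (τ := -τ) (hB.wave.isClosed hτ))).inter (hu.isClosed_trapped
    (isOpen_Up (τ := τ) (hB.wave'.isClosed hτ)))
  have hTb : ∀ x ∈ T, M.birk x ∈ T := fun x hx =>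
    ⟨hu.birk_mem_trapped hx.1, hu.birk_mem_trapped hx.2⟩
  have hTl : ∀ x ∈ T, ∀ n : ℤ, (fun i => x i + lat (n • τ)) ∈ T := fun x hx n =>
    ⟨hu.add_lat_mem_trapped (fun p hp n => add_lat_notMem_Low hB.per hp n) hx.1 n,
      hu.add_lat_mem_trapped (fun p hp n => add_lat_notMem_Up hB.per' hp n) hx.2 n⟩
  obtain ⟨H, hH⟩ := hB.exists_abs_ht_le N κ ρ
  set K : Set (ℝ × ℝ) := {x | 0 ≤ prog τ x ∧ prog τ x ≤ prog τ (lat τ) ∧ |ht τ x| ≤ H} with hK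
  have hKc : IsCompact K := isCompact_strip hτ _ _
  obtain ⟨R, hR⟩ := hKc.isBounded.exists_norm_le
  set S := T ∩ {x | x 0 ∈ K} with hS
  have hSc : IsCompact S := by
    refine (isCompact_univ_pi fun i : ℤ =>
      isCompact_closedBall (0 : ℝ × ℝ) (R + |(i : ℝ)| * (ρ / M.lo))).of_isClosed_subset
      (hTc.inter (hKc.isClosed.preimage (continuous_apply 0))) fun x hx i _ => ?_
    have e1 := norm_sub_le_of_mem_polys hx.1.1.1 i
    have e2 := hR _ hx.2
    have e3 := norm_le_norm_add_norm_sub' (x i) (x 0)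
    rw [mem_closedBall_zero_iff]
    linarith
  have hST : ∀ x ∈ T, ∃ n : ℤ, (fun i => x i + lat (n • τ)) ∈ S := fun x hx => by
    obtain ⟨n, h1, h2⟩ := exists_zsmul_prog_mem hτ (x 0)
    have h3 := hTl x hx n
    exact ⟨n, h3, h1, h2, hH _ h3.1 h3.2⟩
  obtain ⟨n₀, hn₀⟩ := hST _ ⟨hu1, hu2⟩
  obtain ⟨y, hy, hmin⟩ := hSc.exists_isMinOn ⟨_, hn₀⟩
    (M.continuous_polyEnergy (N := N)).continuousOn
  have hmin' : ∀ x ∈ T, M.polyEnergy N y ≤ M.polyEnergy N x := fun x hx => by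
    obtain ⟨n, hn⟩ := hST x hx
    rw [← polyEnergy_add_lat x (n • τ)]
    exact hmin hn
  have hyp := hy.1.1.1
  obtain ⟨c, η, hη, hc, hper, hcy, hen⟩ := exists_localGeod_of_birk hu hyp hN hκ0
    (le_antisymm (polyEnergy_birk_le hyp) (hmin' _ (hTb _ hy.1)))
  obtain ⟨i, -, hi⟩ := hy.1.1.2 0
  obtain ⟨j, -, hj⟩ := hy.1.2.2 0
  exact ⟨c, η, hη, hc, hper, ⟨i * η, by rw [← Int.cast_natCast, hcy]; exact hi⟩,
    ⟨j * η, by rw [← Int.cast_natCast, hcy]; exact hj⟩, hen.le.trans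
      ((hmin' _ ⟨hu1, hu2⟩).trans (hE u))⟩

end Barrier

end TorusMetric

namespace TorusMetric

variable {M : TorusMetric} {τ : ℤ × ℤ} {L : ℝ} {α : ℝ → ℝ × ℝ}

section LocalGeod

variable {c : ℝ → ℝ × ℝ} {Λ ξ : ℝ} {k : ℕ}

theorem LocalGeod.lipD (h : M.LocalGeod c) : M.LipD c 1 := fun s t => by
  rw [one_mul]
  rcases le_total s t with hst | hst
  · have := M.dist_le_length_of_contDiff (h.contDiff.of_le (by exact_mod_cast le_top)) hst
    rw [h.length_eq] at this
    rw [abs_sub_comm]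
    exact this.trans (le_abs_self _)
  · have := M.dist_le_length_of_contDiff (h.contDiff.of_le (by exact_mod_cast le_top)) hst
    rw [h.length_eq] at this
    rw [M.dist_comm]
    exact this.trans (le_abs_self _)

theorem le_dist_lat (hτ : τ ≠ 0) (hL0 : 0 ≤ L) (hL : ∀ x, L ≤ M.dist x (x + lat τ)) (hξ : ξ ≤ 2 * L)
    {q : ℝ × ℝ} (hq : ξ ≤ M.dist q (q + lat τ)) {m n : ℤ} (hmn : m ≠ n) :
    ξ ≤ M.dist (q + lat (m • τ)) (q + lat (n • τ)) := by
  have e1 : M.dist (q + lat (m • τ)) (q + lat (n • τ)) = M.dist q (q + lat ((n - m) • τ)) := by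
    rw [← M.dist_add_lat (m • τ) q, add_assoc, ← lat_add, ← add_smul, sub_add_cancel]
  have e2 : M.dist q (q + lat ((n - m) • τ)) = M.dist q (q + lat ((m - n) • τ)) := by
    rw [← M.dist_add_lat ((n - m) • τ) q (q + lat ((m - n) • τ)), add_assoc, ← lat_add, ← add_smul,
      M.dist_comm]
    simp [lat_zero]
  rw [e1]
  by_cases h1 : n - m = 1
  · rw [h1, one_smul]; exact hq
  by_cases h2 : m - n = 1
  · rw [e2, h2, one_smul]; exact hq
  have h3 : 2 ≤ |n - m| := by
    rw [le_abs]; omega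
  have h4 : (2 : ℝ) ≤ |((n - m : ℤ) : ℝ)| := by exact_mod_cast h3
  have := dist_lat_ge hτ hL0 hL (n - m) q
  nlinarith

theorem LocalGeod.range_ne (hc : M.LocalGeod c) (hξ0 : 0 < ξ) (hΛ0 : 0 < Λ) (hΛ : Λ < k * ξ)
    (hper : ∀ t, c (t + Λ) = c t + lat ((k : ℤ) • τ)) {s : ℝ}
    (hs : ∀ m n : ℤ, m ≠ n → ξ ≤ M.dist (c s + lat (m • τ)) (c s + lat (n • τ))) :
    range c ≠ range (transl τ c) := by
  intro hr
  have hk : 0 < k := by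
    rcases Nat.eq_zero_or_pos k with rfl | h
    · simp at hΛ; linarith
    · exact h
  have hadd : ∀ j : ℤ, ∃ t, c t = c s + lat (j • τ) := fun j => by
    induction j using Int.induction_on with
    | zero => exact ⟨s, by simp [lat_zero]⟩
    | succ n ih =>
      obtain ⟨t, ht⟩ := ih
      have : transl τ c t ∈ range c := hr ▸ mem_range_self t
      obtain ⟨r, hr'⟩ := this
      exact ⟨r, by rw [hr', transl, ht, add_smul, one_smul, lat_add, add_assoc]⟩
    | pred n ih =>
      obtain ⟨t, ht⟩ := ih
      have : c t ∈ range (transl τ c) := hr ▸ mem_range_self t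
      obtain ⟨r, hr'⟩ := this
      refine ⟨r, add_right_cancel (b := lat τ) ?_⟩
      rw [transl] at hr'
      rw [hr', ht, add_assoc, ← lat_add, sub_smul, one_smul, sub_add_cancel]
  have hper' : ∀ (n : ℤ) t, c (t + n * Λ) = c t + lat ((n * k) • τ) := fun n t => by
    rw [add_int_mul_period hper n t, mul_smul, lat_zsmul n]
  have hsep : ∀ {t t' : ℝ} {m n : ℤ}, m ≠ n → c t = c s + lat (m • τ) →
      c t' = c s + lat (n • τ) → ξ ≤ |t - t'| := fun {t t' m n} hmn h1 h2 => by
    have h3 := hc.lipD t t'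
    rw [h1, h2, one_mul] at h3
    exact (hs m n hmn).trans h3
  have hmod : ∀ {i j : ℕ} (m n : ℤ), i < k → j < k → (i : ℤ) + m * k = j + n * k → i = j :=
    fun {i j} m n hi hj h => by
    have h1 : ((i : ℤ) + m * k) % k = i := by
      rw [Int.add_mul_emod_self_right]; exact Int.emod_eq_of_lt (by omega) (by omega)
    have h2 : ((j : ℤ) + n * k) % k = j := by
      rw [Int.add_mul_emod_self_right]; exact Int.emod_eq_of_lt (by omega) (by omega)
    rw [h, h2] at h1
    exact_mod_cast h1.symm
  have cs : c s = c s + lat ((0 : ℤ) • τ) := by simp [lat_zero]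
  have cs' : c (s + Λ) = c s + lat ((k : ℤ) • τ) := hper s
  have hΛξ : ξ ≤ Λ := by
    have := hsep (m := 0) (n := k) (by omega) cs cs'
    rwa [sub_add_cancel_left, abs_neg, abs_of_pos hΛ0] at this
  have hex : ∀ j ∈ Finset.range k, ∃ (t : ℝ) (m : ℤ), s ≤ t ∧ t ≤ s + Λ - ξ ∧
      c t = c s + lat (((j : ℤ) + m * k) • τ) := fun j hj => by
    rcases Nat.eq_zero_or_pos j with rfl | hj0
    · exact ⟨s, 0, le_rfl, by linarith, by simpa using cs⟩
    obtain ⟨t, ht⟩ := hadd j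
    set n := ⌊(t - s) / Λ⌋ with hn
    have f1 : n * Λ ≤ t - s := by rw [← le_div_iff₀ hΛ0]; exact Int.floor_le _
    have f2 : t - s < n * Λ + Λ := by
      have := Int.lt_floor_add_one ((t - s) / Λ)
      rw [div_lt_iff₀ hΛ0] at this
      linarith
    have e1 := hper' (-n) t
    rw [ht, add_assoc, ← lat_add, ← add_smul] at e1
    have hne : (k : ℤ) ≠ j + -n * k := fun h => by
      have := hmod (i := 0) (j := j) 1 (-n) hk (Finset.mem_range.1 hj) (by simpa using h)
      omega
    have e2 := hsep hne cs' e1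
    push_cast at e1 e2
    refine ⟨t + -n * Λ, -n, by linarith, ?_, by exact_mod_cast e1⟩
    rw [abs_of_nonneg (by linarith)] at e2
    linarith
  choose! T m hT using hex
  obtain ⟨i, hi, j, hj, hij, he⟩ := Finset.exists_ne_map_eq_of_card_lt_of_maps_to
    (s := Finset.range k) (t := Finset.range (k - 1)) (f := fun j => ⌊(T j - s) / ξ⌋₊)
    (by rw [Finset.card_range, Finset.card_range]; omega) (fun j hj => by
      have h1 := hT j (Finset.mem_coe.1 hj)
      rw [Finset.mem_coe, Finset.mem_range, Nat.floor_lt (div_nonneg (by linarith) hξ0.le),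
        div_lt_iff₀ hξ0, Nat.cast_sub hk, Nat.cast_one]
      linarith)
  have hTi := hT i hi
  have hTj := hT j hj
  have h1 := hsep (fun h => hij (hmod _ _ (Finset.mem_range.1 hi) (Finset.mem_range.1 hj) h))
    hTi.2.2 hTj.2.2
  have hi0 : 0 ≤ (T i - s) / ξ := div_nonneg (by linarith) hξ0.le
  have hj0 : 0 ≤ (T j - s) / ξ := div_nonneg (by linarith) hξ0.le
  have g1 := Nat.floor_le hi0
  have g2 := Nat.floor_le hj0
  have g3 := Nat.lt_floor_add_one ((T i - s) / ξ)
  have g4 := Nat.lt_floor_add_one ((T j - s) / ξ)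
  rw [he] at g1 g3
  rw [le_div_iff₀ hξ0] at g1 g2
  rw [div_lt_iff₀ hξ0] at g3 g4
  have : |T i - T j| < ξ := abs_lt.2 ⟨by linarith, by linarith⟩
  linarith

end LocalGeod

theorem MinLine.exists_lat_mem_Up (hτ : τ ≠ 0) (hα : MinLine M τ L α) (hL0 : 0 < L)
    {Γ : Set (ℝ × ℝ)} (hΓ : IsWave τ Γ) : ∃ w, ∀ t, α t + lat w ∈ Up τ Γ := by
  obtain ⟨H, hH⟩ := hΓ.exists_abs_ht_le
  have hp := prog_lat_self_pos hτ
  obtain ⟨n, hn⟩ := exists_nat_gt ((H - ht τ (α 0) +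
    (|(τ.1 : ℝ)| + |(τ.2 : ℝ)|) * (1 / M.lo * L)) / prog τ (lat τ))
  rw [div_lt_iff₀ hp] at hn
  refine ⟨(n : ℤ) • (-τ.2, τ.1), fun t => mem_Up_of_forall_lt fun c hc => ?_⟩
  have h1 := (abs_le.1 (hα.abs_ht_sub_le hL0 t)).1
  have h2 := (abs_le.1 (hH c hc)).2
  have h3 : ht τ (lat (-τ.2, τ.1)) = prog τ (lat τ) := by rw [← ht_rot]; simp [lat]
  rw [ht_add, lat_zsmul, ht_smul, h3]
  push_cast
  linarith

end TorusMetric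

section Front

variable {N m : ℕ}

/-- The distance of `i` to `N / 2`, periodically continued from the integers between `0`
and `N`. -/
def centerDist (N : ℕ) (i : ℤ) : ℝ := |((i % N : ℤ) : ℝ) - N / 2|

/-- A bump on the integers modulo `N`, growing from `0` to `1` with the parameter `u`. -/
def front (N m : ℕ) (u : ℝ) (i : ℤ) : ℝ := max 0 (min 1 (u + centerDist N i / m))

theorem centerDist_add (i : ℤ) : centerDist N (i + N) = centerDist N i := by
  rw [centerDist, Int.add_emod_right, centerDist]

theorem centerDist_nonneg (i : ℤ) : 0 ≤ centerDist N i := abs_nonneg _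

theorem centerDist_le (hN : 0 < N) (i : ℤ) : centerDist N i ≤ N := by
  have hN' : (0 : ℤ) < N := by exact_mod_cast hN
  have h1 : (0 : ℝ) ≤ ((i % N : ℤ) : ℝ) := by exact_mod_cast Int.emod_nonneg i hN'.ne'
  have h2 : ((i % N : ℤ) : ℝ) ≤ N := by exact_mod_cast (Int.emod_lt_of_pos i hN').le
  exact abs_le.2 ⟨by linarith, by linarith⟩

theorem abs_centerDist_sub_le (hN : 0 < N) (i : ℤ) :
    |centerDist N (i + 1) - centerDist N i| ≤ 1 := by
  have hN' : (0 : ℤ) < N := by exact_mod_cast hN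
  have h1 := Int.emod_nonneg i hN'.ne'
  have h2 := Int.emod_lt_of_pos i hN'
  have hN1 : (1 : ℝ) ≤ N := by exact_mod_cast hN
  rw [centerDist, centerDist]
  have h3 : (i + 1) % (N : ℤ) = (i % N + 1) % N := by rw [Int.emod_add_emod]
  rcases (show i % (N : ℤ) + 1 ≤ N by omega).eq_or_lt with h | h
  · have h4 : ((i % N : ℤ) : ℝ) = N - 1 := by
      have : i % (N : ℤ) = N - 1 := by omega
      rw [this]; push_cast; ring
    have h5 : |(0 : ℝ) - N / 2| = N / 2 := by
      rw [zero_sub, abs_neg, abs_of_nonneg (by linarith)]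
    rw [h3, h, Int.emod_self, h4, Int.cast_zero, h5,
      show (N : ℝ) - 1 - N / 2 = N / 2 - 1 by ring]
    refine abs_le.2 ⟨?_, by linarith [le_abs_self ((N : ℝ) / 2 - 1)]⟩
    have : |(N : ℝ) / 2 - 1| ≤ N / 2 + 1 := abs_le.2 ⟨by linarith, by linarith⟩
    linarith
  · rw [h3, Int.emod_eq_of_lt (by omega) h]
    refine (abs_abs_sub_abs_le_abs_sub _ _).trans ?_
    push_cast
    rw [sub_sub_sub_cancel_right, add_sub_cancel_left, abs_one]

theorem front_add (u : ℝ) (i : ℤ) : front N m u (i + N) = front N m u i := by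
  rw [front, centerDist_add, front]

theorem front_eq_zero {u : ℝ} {i : ℤ} (h : u + centerDist N i / m ≤ 0) : front N m u i = 0 :=
  max_eq_left ((min_le_right _ _).trans h)

theorem front_eq_one {u : ℝ} {i : ℤ} (h : 1 ≤ u + centerDist N i / m) : front N m u i = 1 := by
  rw [front, min_eq_left h, max_eq_right zero_le_one]

theorem continuous_front (i : ℤ) : Continuous fun u => front N m u i := by
  unfold front
  fun_prop

theorem abs_front_sub_le (hN : 0 < N) (hm : 0 < m) (u : ℝ) (i : ℤ) :
    |front N m u (i + 1) - front N m u i| ≤ 1 / m := by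
  have hm' : (0 : ℝ) < m := by exact_mod_cast hm
  have h1 := abs_centerDist_sub_le hN i
  have h2 : |(u + centerDist N (i + 1) / m) - (u + centerDist N i / m)| ≤ 1 / m := by
    rw [add_sub_add_left_eq_sub, ← sub_div, abs_div, abs_of_pos hm']
    gcongr
  refine le_trans ?_ h2
  rw [front, front]
  refine (abs_max_sub_max_le_max _ _ _ _).trans (max_le (by simp) ?_)
  exact (abs_min_sub_min_le_max _ _ _ _).trans (max_le (by simp) le_rfl)

theorem front_cases (hN : 0 < N) (hm : 0 < m) (u : ℝ) (i : ℤ)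
    (h : ¬ (-1 - u * m < centerDist N i ∧ centerDist N i < -1 - u * m + (m + 2))) :
    (front N m u i = 0 ∧ front N m u (i + 1) = 0) ∨
      (front N m u i = 1 ∧ front N m u (i + 1) = 1) := by
  have hm' : (0 : ℝ) < m := by exact_mod_cast hm
  have h1 := abs_le.1 (abs_centerDist_sub_le hN i)
  have key0 : ∀ j, centerDist N j ≤ - u * m → front N m u j = 0 := fun j hj => by
    refine front_eq_zero ?_
    have := (div_le_iff₀ hm').2 hj
    linarith
  have key1 : ∀ j, (1 - u) * m ≤ centerDist N j → front N m u j = 1 := fun j hj => by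
    refine front_eq_one ?_
    have := (le_div_iff₀ hm').2 hj
    linarith
  rcases lt_or_ge (-1 - u * m) (centerDist N i) with h2 | h2
  · have h3 := not_lt.1 fun h3 => h ⟨h2, h3⟩
    exact Or.inr ⟨key1 _ (by linarith), key1 _ (by linarith)⟩
  · exact Or.inl ⟨key0 _ (by linarith), key0 _ (by linarith)⟩

theorem card_filter_Ioo_le (N : ℕ) (a : ℝ) {l : ℝ} (hl : 0 ≤ l) :
    (((Finset.range N).filter fun i : ℕ => a < i ∧ (i : ℝ) < a + l).card : ℝ) ≤ l + 1 := by
  have h1 : ((Finset.range N).filter fun i : ℕ => a < i ∧ (i : ℝ) < a + l).card ≤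
      (Finset.Ioo ⌊a⌋ ⌈a + l⌉).card := by
    refine Finset.card_le_card_of_injOn (fun i => (i : ℤ)) (fun i hi => ?_)
      (fun i _ j _ h => Nat.cast_injective h)
    have hi' := (Finset.mem_filter.1 (Finset.mem_coe.1 hi)).2
    rw [Finset.mem_coe, Finset.mem_Ioo, Int.floor_lt, Int.lt_ceil]
    exact_mod_cast hi'
  have h2 : (((Finset.Ioo ⌊a⌋ ⌈a + l⌉).card : ℤ) : ℝ) ≤ l + 1 := by
    rw [Int.card_Ioo, Int.toNat_eq_max]
    push_cast
    have := Int.ceil_lt_add_one (a + l)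
    have := Int.lt_floor_add_one a
    exact max_le (by linarith) (by linarith)
  have h3 : ((((Finset.range N).filter fun i : ℕ => a < i ∧ (i : ℝ) < a + l).card : ℤ) : ℝ) ≤
      (((Finset.Ioo ⌊a⌋ ⌈a + l⌉).card : ℤ) : ℝ) := by exact_mod_cast h1
  exact_mod_cast h3.trans h2

theorem card_filter_centerDist_le (N : ℕ) (a : ℝ) {l : ℝ} (hl : 0 ≤ l) :
    (((Finset.range N).filter fun i : ℕ => a < centerDist N i ∧ centerDist N i < a + l).card : ℝ) ≤
      2 * (l + 1) := by
  have h1 : ((Finset.range N).filter fun i : ℕ => a < centerDist N i ∧ centerDist N i < a + l) ⊆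
      ((Finset.range N).filter fun i : ℕ => N / 2 + a < i ∧ (i : ℝ) < N / 2 + a + l) ∪
      ((Finset.range N).filter fun i : ℕ => N / 2 - a - l < i ∧ (i : ℝ) < N / 2 - a - l + l) := by
    intro i hi
    obtain ⟨hi, h1, h2⟩ := Finset.mem_filter.1 hi
    have e : centerDist N i = |(i : ℝ) - N / 2| := by
      rw [centerDist, Int.emod_eq_of_lt (by omega) (by exact_mod_cast Finset.mem_range.1 hi)]
      simp
    rw [e] at h1 h2
    rw [Finset.mem_union, Finset.mem_filter, Finset.mem_filter]
    rcases abs_cases ((i : ℝ) - N / 2) with ⟨e, -⟩ | ⟨e, -⟩ <;> rw [e] at h1 h2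
    · exact Or.inl ⟨hi, by linarith, by linarith⟩
    · exact Or.inr ⟨hi, by linarith, by linarith⟩
  have h2 := (Finset.card_le_card h1).trans (Finset.card_union_le _ _)
  have h3 := card_filter_Ioo_le N (N / 2 + a) hl
  have h4 := card_filter_Ioo_le N (N / 2 - a - l) hl
  have h5 := (Nat.cast_le (α := ℝ)).2 h2
  push_cast at h5
  linarith

end Front

namespace TorusMetric

variable {M : TorusMetric} {τ w : ℤ × ℤ} {L : ℝ} {α : ℝ → ℝ × ℝ} {k m : ℕ}

/-- A polygon with vertices on translates of a line by multiples of a vector. -/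
def sweep (L : ℝ) (α : ℝ → ℝ × ℝ) (w : ℤ × ℤ) (k m : ℕ) (u : ℝ) (i : ℤ) : ℝ × ℝ :=
  α (i * (L / m)) + front (k * m) m u i • lat w

theorem continuous_sweep : Continuous (sweep L α w k m) :=
  continuous_pi fun i => continuous_const.add ((continuous_front i).smul continuous_const)

namespace MinLine

theorem dist_step (h : MinLine M τ L α) (hL0 : 0 < L) (t : ℝ) : M.dist (α t) (α
    (t + L / m)) = L / m := by
  rw [h.dist_eq, abs_sub_comm, add_sub_cancel_left, abs_of_nonneg (by positivity)]

theorem dist_sweep_le (h : MinLine M τ L α) (hL0 : 0 < L) (hk : 0 < k) (hm : 0 < m) (u : ℝ)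
    (i : ℤ) :
    M.dist (sweep L α w k m u i) (sweep L α w k m u (i + 1)) ≤
      M.hi * (L / M.lo + ‖lat w‖) / m := by
  have hlo := M.lo_pos
  have hhi := M.hi_pos
  have e : ((i + 1 : ℤ) : ℝ) * (L / m) = i * (L / m) + L / m := by push_cast; ring
  refine (M.dist_le_hi_mul _ _).trans ?_
  rw [norm_sub_rev, sweep, sweep, e, add_sub_add_comm, ← sub_smul, mul_div_assoc]
  gcongr
  refine (norm_add_le _ _).trans ?_
  have h1 := M.norm_sub_le_dist (α (i * (L / m) + L / m)) (α (i * (L / m)))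
  rw [M.dist_comm, h.dist_step hL0] at h1
  rw [norm_smul, Real.norm_eq_abs]
  have h2 := mul_le_mul_of_nonneg_right (abs_front_sub_le (N := k * m) (by positivity) hm u i)
    (norm_nonneg (lat w))
  calc _ ≤ L / m / M.lo + 1 / m * ‖lat w‖ := add_le_add h1 h2
    _ = (L / M.lo + ‖lat w‖) / m := by field_simp

theorem dist_sweep_eq (h : MinLine M τ L α) (hL0 : 0 < L) (hk : 0 < k) (hm : 0 < m) (u : ℝ) (i : ℤ)
    (hi : ¬ (-1 - u * m < centerDist (k * m) i ∧
      centerDist (k * m) i < -1 - u * m + (m + 2))) :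
    M.dist (sweep L α w k m u i) (sweep L α w k m u (i + 1)) = L / m := by
  have e : ((i + 1 : ℤ) : ℝ) * (L / m) = i * (L / m) + L / m := by push_cast; ring
  rw [sweep, sweep, e]
  rcases front_cases (by positivity) hm u i hi with ⟨h1, h2⟩ | ⟨h1, h2⟩
  · rw [h1, h2, zero_smul, add_zero, add_zero, h.dist_step hL0]
  · rw [h1, h2, one_smul, M.dist_add_lat, h.dist_step hL0]

theorem sweep_mem_polys (h : MinLine M τ L α) (hL0 : 0 < L) (hk : 0 < k) (hm : 0 < m) {ρ : ℝ}
    (hρ : M.hi * (L / M.lo + ‖lat w‖) / m ≤ ρ) (u : ℝ) :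
    sweep L α w k m u ∈ M.polys (k * m) ((k : ℤ) • τ) ρ := by
  refine ⟨fun i => ?_, fun i => (h.dist_sweep_le hL0 hk hm u i).trans hρ⟩
  have hm' : (m : ℝ) ≠ 0 := by exact_mod_cast hm.ne'
  have e : ((i + (k * m : ℕ) : ℤ) : ℝ) * (L / m) = i * (L / m) + (k : ℤ) * L := by
    push_cast; field_simp
  rw [sweep, front_add, e, add_int_mul_period h.per, ← lat_zsmul, sweep, add_right_comm]

theorem polyEnergy_sweep_le (h : MinLine M τ L α) (hL0 : 0 < L) (hk : 0 < k) (hm : 0 < m) (u : ℝ) :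
    m * M.polyEnergy (k * m) (sweep L α w k m u) ≤
      k * L ^ 2 + 8 * (M.hi * (L / M.lo + ‖lat w‖)) ^ 2 := by
  set C := M.hi * (L / M.lo + ‖lat w‖) with hC
  have hm' : (1 : ℝ) ≤ m := by exact_mod_cast hm
  have h1 : ∀ i ∈ Finset.range (k * m),
      M.dist (sweep L α w k m u i) (sweep L α w k m u (i + 1)) ^ 2 ≤ (L / m) ^ 2 +
        if -1 - u * m < centerDist (k * m) i ∧ centerDist (k * m) i < -1 - u * m + (m + 2)
          then (C / m) ^ 2 else 0 := fun i _ => by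
    split_ifs with hi
    · have := pow_le_pow_left₀ (M.dist_nonneg _ _) (h.dist_sweep_le (w := w) hL0 hk hm u i) 2
      exact this.trans (le_add_of_nonneg_left (sq_nonneg _))
    · rw [h.dist_sweep_eq hL0 hk hm u i hi, add_zero]
  have h2 := Finset.sum_le_sum h1
  rw [Finset.sum_add_distrib, Finset.sum_const, Finset.card_range, ← Finset.sum_filter,
    Finset.sum_const, nsmul_eq_mul, nsmul_eq_mul] at h2
  have h3 := card_filter_centerDist_le (k * m) (-1 - u * m) (l := (m : ℝ) + 2) (by positivity)
  have h4 : M.polyEnergy (k * m) (sweep L α w k m u) ≤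
      (k * m : ℕ) * (L / m) ^ 2 + 8 * m * (C / m) ^ 2 := by
    refine h2.trans ?_
    gcongr
    linarith
  calc _ ≤ m * ((k * m : ℕ) * (L / m) ^ 2 + 8 * m * (C / m) ^ 2) := by gcongr
    _ = k * L ^ 2 + 8 * C ^ 2 := by push_cast; field_simp

end MinLine

theorem Barrier.exists_axis (hτ : τ ≠ 0) (hL0 : 0 < L) (hL : ∀ x, L ≤ M.dist x (x + lat τ))
    {Γ Γ' : Set (ℝ × ℝ)} {ρ ξ : ℝ} (hB : M.Barrier τ L Γ Γ' ρ ξ) :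
    ∃ (k : ℕ) (c : ℝ → ℝ × ℝ), 2 ≤ k ∧ IsAxisOf M c ((k : ℤ) • τ) ∧
      range c ≠ range (transl τ c) := by
  obtain ⟨α, hα, hαΓ⟩ := hB.exists_line
  obtain ⟨w, hw⟩ := hα.exists_lat_mem_Up hτ hL0 hB.wave'
  obtain ⟨ρ₀, hρ₀, hu⟩ := M.exists_unique_radius
  have hρ := hB.ρ_pos
  have hLξ := hB.lt
  have hξ0 : 0 < ξ := hL0.trans hLξ
  have hu' : M.UniqueRadius (min ρ ρ₀) := fun c e l hl => hu c e l (hl.trans (min_le_right _ _))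
  set C := M.hi * (L / M.lo + ‖lat w‖) with hC
  have hlt : 0 < ξ ^ 2 - L ^ 2 := by nlinarith
  obtain ⟨k₀, hk₀⟩ := exists_nat_gt (8 * C ^ 2 / (ξ ^ 2 - L ^ 2))
  set k := k₀ + 2 with hk
  have hk0 : 0 < k := by omega
  have hkC : k * L ^ 2 + 8 * C ^ 2 < k * ξ ^ 2 := by
    rw [div_lt_iff₀ hlt] at hk₀
    have : (k : ℝ) = k₀ + 2 := by rw [hk]; push_cast; ring
    rw [this]
    nlinarith
  obtain ⟨m₀, hm₀⟩ := exists_nat_gt (C / min ρ ρ₀)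
  set m := m₀ + 1 with hm
  have hm0 : 0 < m := by omega
  have hm' : (0 : ℝ) < m := by exact_mod_cast hm0
  have hmin : 0 < min ρ ρ₀ := lt_min hρ hρ₀
  have hmC : C / m ≤ min ρ ρ₀ := by
    rw [div_lt_iff₀ hmin] at hm₀
    rw [div_le_iff₀ hm']
    have : (m : ℝ) = m₀ + 1 := by rw [hm]; push_cast; ring
    rw [this]
    nlinarith
  have hN : 0 < k * m := by positivity
  obtain ⟨c, η, hη, hc, hper, ⟨t₁, ht₁⟩, ⟨t₂, ht₂⟩, hen⟩ := hB.exists_localGeod hτ hu'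
    (min_le_left _ _) hN hk0.ne' (continuous_sweep (w := w))
    (fun u => hα.sweep_mem_polys hL0 hk0 hm0 hmC u) (u₀ := -(k * m : ℕ)) (u₁ := 1)
    (E := (k * L ^ 2 + 8 * C ^ 2) / m)
    (fun i => by
      rw [sweep, front_eq_zero, zero_smul, add_zero]
      · exact hαΓ (mem_range_self _)
      · have h1 := centerDist_le hN i
        have h2 : centerDist (k * m) i / m ≤ centerDist (k * m) i :=
          div_le_self (centerDist_nonneg i) (by exact_mod_cast hm0)
        linarith)
    (fun i => by
      rw [sweep, front_eq_one, one_smul]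
      · exact hw _
      · have := centerDist_nonneg (N := k * m) i
        have : 0 ≤ centerDist (k * m) i / m := by positivity
        linarith)
    (fun u => by
      rw [le_div_iff₀ hm', mul_comm]
      exact hα.polyEnergy_sweep_le hL0 hk0 hm0 u)
  set Λ := ((k * m : ℕ) : ℝ) * η with hΛ
  have hN' : (0 : ℝ) < (k * m : ℕ) := by exact_mod_cast hN
  have hΛ0 : 0 < Λ := mul_pos hN' hη
  have hΛk : Λ < k * ξ := by
    refine lt_of_pow_lt_pow_left₀ 2 (by positivity) ?_
    have hkR : (0 : ℝ) < k := by exact_mod_cast hk0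
    rw [le_div_iff₀ hm'] at hen
    calc Λ ^ 2 = k * ((k * m : ℕ) * η ^ 2 * m) := by rw [hΛ]; push_cast; ring
      _ ≤ k * (k * L ^ 2 + 8 * C ^ 2) := by gcongr
      _ < k * (k * ξ ^ 2) := by gcongr
      _ = (k * ξ) ^ 2 := by ring
  obtain ⟨s, hs1, hs2⟩ : ∃ s, c s ∉ Low τ Γ ∧ c s ∉ Up τ Γ' := by
    by_contra! hcon
    have hcc : Continuous c := hc.contDiff.continuous
    have hpre := (isPreconnected_univ (α := ℝ)).image c hcc.continuousOn
    have hsub : c '' univ ⊆ Low τ Γ ∪ Up τ Γ' := by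
      rintro _ ⟨s, -, rfl⟩
      by_cases h : c s ∈ Low τ Γ
      · exact Or.inl h
      · exact Or.inr (hcon s h)
    have hd := disjoint_left.1 (hB.disjoint hτ)
    have h1 : c t₁ ∈ Up τ Γ' := hcon t₁ ht₁
    have h2 : c t₂ ∈ Low τ Γ := (hsub (mem_image_of_mem c (mem_univ t₂))).resolve_right ht₂
    obtain ⟨y, -, hy1, hy2⟩ := hpre _ _ (isOpen_Up (τ := -τ) (hB.wave.isClosed hτ))
      (isOpen_Up (τ := τ) (hB.wave'.isClosed hτ)) hsub
      ⟨_, mem_image_of_mem c (mem_univ t₂), h2⟩ ⟨_, mem_image_of_mem c (mem_univ t₁), h1⟩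
    exact hd hy1 hy2
  have hkτ : (k : ℤ) • τ ≠ 0 := smul_ne_zero (by exact_mod_cast hk0.ne') hτ
  refine ⟨k, c, by omega, ⟨hc.isGeodesic, hkτ, Λ, hper⟩, ?_⟩
  exact hc.range_ne hξ0 hΛ0 hΛk hper fun m n hmn =>
    le_dist_lat hτ hL0.le hL hB.le (hB.disp _ hs1 hs2) hmn

end TorusMetric

/-- Suppose there exists a primitive translation element `τ` whose minimal axes do not
foliate `ℝ²`, i.e. the union of the images of the minimal axes of `τ` is not all of `ℝ²`.
Then there exist an integer `k ≥ 2` and a non-primitive axis of `τ^k`, i.e. an axis `α` of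
`τ^k` with `α(ℝ) ≠ τ α(ℝ)`. -/
theorem stmt13 (M : TorusMetric) (τ : ℤ × ℤ) (hτ : IsPrimitive τ)
    (hfol : (⋃ (α : ℝ → ℝ × ℝ) (_ : IsAxisOf M α τ ∧ IsMinimal M α), Set.range α)
      ≠ Set.univ) :
    ∃ (k : ℤ) (α : ℝ → ℝ × ℝ), 2 ≤ k ∧ IsAxisOf M α (k • τ) ∧
      Set.range α ≠ Set.range (transl τ α) := by
  obtain ⟨q, hq0, hq⟩ := M.exists_min_displacement hτ.1
  obtain ⟨p, hp⟩ := (Set.ne_univ_iff_exists_notMem _).1 hfol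
  have hlt : M.dist q (q + lat τ) < M.dist p (p + lat τ) := by
    refine (hq p).lt_of_ne fun he => hp ?_
    obtain ⟨α, hα, hαp⟩ := TorusMetric.exists_minLine hτ.1 hq0 hq he.symm
    exact mem_iUnion₂.2 ⟨α, ⟨hα.isAxisOf hτ.1, hα.isMinimal⟩, 0, hαp⟩
  obtain ⟨α, hα, -⟩ := TorusMetric.exists_minLine hτ.1 hq0 hq rfl
  obtain ⟨Γ, Γ', ρ, ξ, hB⟩ := TorusMetric.exists_barrier hτ.1 hq0 hq ⟨α, hα⟩ hlt
  obtain ⟨k, c, hk, hc, hne⟩ := hB.exists_axis hτ.1 hq0 hq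
  exact ⟨k, c, by exact_mod_cast hk, hc, hne⟩
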